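/- There are exactly 1532 equivalence classes of bordered double circulant doubly even self-dual binary codes of length 96 with minimum weight 16, where two codes are equivalent if one is obtained from the other by a permutation of coordinates. -/

import Mathlib

/-- The standard inner product on `ι → ZMod 2`. -/
def dot {ι : Type*} [Fintype ι] (x y : ι → ZMod 2) : ZMod 2 := ∑ i, x i * y i

/-- A binary linear code is self-dual if it coincides with its dual. -/
def IsSelfDual {ι : Type*} [Fintype ι] (C : Submodule (ZMod 2) (ι → ZMod 2)) : Prop :=
  ∀ x, x ∈ C ↔ ∀ y ∈ C, dot x y = 0

/-- `C` has minimum (nonzero) weight exactly `d`. -/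
def MinWeightIs {ι : Type*} [Fintype ι] (C : Submodule (ZMod 2) (ι → ZMod 2)) (d : ℕ) : Prop :=
  (∃ x ∈ C, x ≠ 0 ∧ hammingNorm x = d) ∧ ∀ x ∈ C, x ≠ 0 → d ≤ hammingNorm x

/-- `A_i(C)`: the number of codewords of `C` of Hamming weight `i`. -/
noncomputable def weightEnum {ι : Type*} [Fintype ι] (C : Submodule (ZMod 2) (ι → ZMod 2)) (i : ℕ) : ℕ :=
  Set.ncard {x : ι → ZMod 2 | x ∈ C ∧ hammingNorm x = i}

/-- Two codes are equivalent if a coordinate permutation maps one onto the other. -/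
def CodeEquiv {ι : Type*} [Fintype ι] (C C' : Submodule (ZMod 2) (ι → ZMod 2)) : Prop :=
  ∃ σ : Equiv.Perm ι, Submodule.map (LinearMap.funLeft (ZMod 2) (ZMod 2) ⇑σ) C = C'

/-- The order of the automorphism group of a code: the number of coordinate
permutations mapping the code onto itself. -/
noncomputable def autGroupOrder {ι : Type*} [Fintype ι] (C : Submodule (ZMod 2) (ι → ZMod 2)) : ℕ :=
  Nat.card {σ : Equiv.Perm ι // Submodule.map (LinearMap.funLeft (ZMod 2) (ZMod 2) ⇑σ) C = C}

/-- A circulant matrix: each row is the cyclic shift of the previous one. -/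
def IsCirculant {n : ℕ} (R : Matrix (Fin n) (Fin n) (ZMod 2)) : Prop :=
  ∃ v : Fin n → ZMod 2, R = Matrix.circulant v

/-- The pure double circulant code with generator matrix `(I_n | R)`. -/
def pureDCC {n : ℕ} (R : Matrix (Fin n) (Fin n) (ZMod 2)) :
    Submodule (ZMod 2) (Fin n ⊕ Fin n → ZMod 2) :=
  Submodule.span (ZMod 2)
    (Set.range fun i : Fin n =>
      Sum.elim (fun j => if j = i then (1 : ZMod 2) else 0) (R i))

/-- A bordered matrix: first row `(0,1,…,1)`, first column `(0,1,…,1)ᵀ`, and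
lower-right block an `n × n` circulant matrix. -/
def IsBorderMatrix {n : ℕ} (B : Matrix (Fin (n + 1)) (Fin (n + 1)) (ZMod 2)) : Prop :=
  B 0 0 = 0 ∧ (∀ j, j ≠ 0 → B 0 j = 1) ∧ (∀ i, i ≠ 0 → B i 0 = 1) ∧
  ∃ R' : Matrix (Fin n) (Fin n) (ZMod 2), IsCirculant R' ∧
    ∀ i j : Fin n, B i.succ j.succ = R' i j

/-- The bordered double circulant code with generator matrix `(I_{n+1} | B)`. -/
def borderedDCC {n : ℕ} (B : Matrix (Fin (n + 1)) (Fin (n + 1)) (ZMod 2)) :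
    Submodule (ZMod 2) (Fin (n + 1) ⊕ Fin (n + 1) → ZMod 2) :=
  Submodule.span (ZMod 2)
    (Set.range fun i : Fin (n + 1) =>
      Sum.elim (fun j => if j = i then (1 : ZMod 2) else 0) (B i))


abbrev Z47 := ZMod 47
abbrev F2 := ZMod 2
abbrev KK := AlgebraicClosure (ZMod 2)

instance fact47 : Fact (Nat.Prime 47) := ⟨by norm_num⟩

theorem exists_alpha : ∃ a : KK, IsPrimitiveRoot a 47 := by
  haveI : NeZero ((47 : ℕ) : KK) := ⟨by
    have h2 : (2 : KK) = 0 := CharTwo.two_eq_zero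
    have : ((47 : ℕ) : KK) = 1 := by
      push_cast
      linear_combination 23 * h2
    rw [this]; exact one_ne_zero⟩
  obtain ⟨a, ha⟩ := IsAlgClosed.exists_root (Polynomial.cyclotomic 47 KK)
    (by rw [Polynomial.degree_cyclotomic]; decide)
  exact ⟨a, (Polynomial.isRoot_cyclotomic_iff).1 ha⟩

noncomputable def alpha : KK := Classical.choose exists_alpha
theorem alpha_prim : IsPrimitiveRoot alpha 47 := Classical.choose_spec exists_alpha

noncomputable def chi (j : Z47) : KK := alpha ^ j.val

theorem chi_add (a b : Z47) : chi (a + b) = chi a * chi b := by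
  unfold chi
  rw [← pow_add, ZMod.val_add]
  exact (pow_eq_pow_mod _ alpha_prim.pow_eq_one).symm

theorem chi_zero : chi 0 = 1 := by simp [chi]

theorem chi_ne_zero (a : Z47) : chi a ≠ 0 := by
  intro h
  have := chi_add a (-a)
  rw [h, add_neg_cancel, chi_zero, zero_mul] at this
  exact one_ne_zero this

theorem chi_pow (a : Z47) : chi a ^ 47 = 1 := by
  unfold chi
  rw [← pow_mul, mul_comm, pow_mul, alpha_prim.pow_eq_one, one_pow]

theorem exists_chi {q : KK} (hq : q ^ 47 = 1) : ∃ s : Z47, q = chi s := by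
  obtain ⟨i, hi, h⟩ := alpha_prim.eq_pow_of_pow_eq_one hq
  refine ⟨(i : Z47), ?_⟩
  rw [chi, ZMod.val_natCast_of_lt hi, h]

theorem chi_eq_one {a : Z47} (h : chi a = 1) : a = 0 := by
  by_contra hne
  have h1 := alpha_prim.pow_ne_one_of_pos_of_lt (l := a.val) (by
    intro h0; exact hne ((ZMod.val_eq_zero a).1 h0)) (ZMod.val_lt a)
  exact h1 h

theorem sum_chi (t : Z47) : ∑ s : Z47, chi (s * t) = if t = 0 then 1 else 0 := by
  have h2 : (2 : KK) = 0 := CharTwo.two_eq_zero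
  split_ifs with h
  · subst h
    simp only [mul_zero, chi_zero, Finset.sum_const, Finset.card_univ, ZMod.card, nsmul_eq_mul, mul_one]
    push_cast
    linear_combination 23 * h2
  · have h1 : ∑ s : Z47, chi (s * t) = chi t * ∑ s : Z47, chi (s * t) := by
      rw [Finset.mul_sum]
      conv_lhs => rw [← Equiv.sum_comp (Equiv.addRight (1 : Z47))]
      refine Finset.sum_congr rfl fun s _ => ?_
      rw [← chi_add]; congr 1; simp; ring
    have h3 : chi t ≠ 1 := fun h' => h (chi_eq_one h')
    have h4 : (1 - chi t) * ∑ s : Z47, chi (s * t) = 0 := by linear_combination h1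
    rcases mul_eq_zero.1 h4 with h5 | h5
    · exact absurd (sub_eq_zero.1 h5).symm h3
    · exact h5

noncomputable def emb (a : F2) : KK := algebraMap F2 KK a

theorem emb_add (a b : F2) : emb (a + b) = emb a + emb b := map_add _ _ _
theorem emb_mul (a b : F2) : emb (a * b) = emb a * emb b := map_mul _ _ _
theorem emb_sum {ι : Type*} (s : Finset ι) (f : ι → F2) : emb (∑ i ∈ s, f i) = ∑ i ∈ s, emb (f i) :=
  map_sum _ _ _
theorem emb_inj {a b : F2} (h : emb a = emb b) : a = b := (algebraMap F2 KK).injective h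
theorem emb_sq (a : F2) : emb a ^ 2 = emb a := by
  unfold emb; rw [← map_pow]; congr 1; revert a; decide

noncomputable def hat (r : Z47 → F2) (t : Z47) : KK := ∑ j : Z47, emb (r j) * chi (j * t)

theorem hat_inv (r : Z47 → F2) (i : Z47) : emb (r i) = ∑ t : Z47, hat r t * chi (- (i * t)) := by
  unfold hat
  simp_rw [Finset.sum_mul]
  rw [Finset.sum_comm]
  have : ∀ j : Z47, ∑ t : Z47, emb (r j) * chi (j * t) * chi (-(i * t)) =
      if j = i then emb (r j) else 0 := by
    intro j
    have h := sum_chi (j - i)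
    calc _ = emb (r j) * ∑ t : Z47, chi (t * (j - i)) := by
            rw [Finset.mul_sum]
            refine Finset.sum_congr rfl fun t _ => ?_
            rw [mul_assoc, ← chi_add]; congr 2; ring
      _ = _ := by rw [h]; simp [sub_eq_zero]
  simp_rw [this]
  simp

theorem hat_inj {r s : Z47 → F2} (h : ∀ t, hat r t = hat s t) : r = s := by
  funext i
  apply emb_inj
  rw [hat_inv, hat_inv]
  simp_rw [h]

def affine (m s : Z47) (r : Z47 → F2) : Z47 → F2 := fun j => r (m * j + s)

theorem hat_affine (m s t : Z47) (hm : m ≠ 0) (r : Z47 → F2) :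
    hat (affine m s r) t = chi (- (m⁻¹ * s * t)) * hat r (m⁻¹ * t) := by
  unfold hat affine
  rw [Finset.mul_sum]
  have e : Z47 ≃ Z47 := (Equiv.mulLeft₀ m hm).trans (Equiv.addRight s)
  rw [← Equiv.sum_comp ((Equiv.mulLeft₀ m hm).trans (Equiv.addRight s))
    (fun i => chi (-(m⁻¹ * s * t)) * (emb (r i) * chi (i * (m⁻¹ * t))))]
  refine Finset.sum_congr rfl fun j _ => ?_
  simp only [Equiv.trans_apply, Equiv.mulLeft₀_apply, Equiv.coe_addRight]
  rw [mul_left_comm, ← chi_add]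
  congr 2
  field_simp
  ring

def conv (a b : Z47 → F2) : Z47 → F2 := fun i => ∑ j, a (i - j) * b j

theorem hat_conv (a b : Z47 → F2) (t : Z47) : hat (conv a b) t = hat a t * hat b t := by
  unfold hat conv
  simp_rw [emb_sum, Finset.sum_mul]
  rw [Finset.sum_comm]
  simp_rw [Finset.mul_sum]
  conv_rhs => rw [Finset.sum_comm]
  refine Finset.sum_congr rfl fun j _ => ?_
  rw [← Equiv.sum_comp (Equiv.addRight j)]
  refine Finset.sum_congr rfl fun i _ => ?_
  simp only [Equiv.coe_addRight, add_sub_cancel_right]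
  rw [emb_mul, add_mul, chi_add]; ring

theorem hat_two (r : Z47 → F2) (t : Z47) : hat r (2 * t) = hat r t ^ 2 := by
  unfold hat
  rw [sum_pow_char 2]
  refine Finset.sum_congr rfl fun j _ => ?_
  rw [mul_pow, emb_sq, pow_two, ← chi_add]
  congr 2; ring

def ac (r : Z47 → F2) : Z47 → F2 := fun t => ∑ j, r j * r (j + t)
def eps : Z47 → F2 := fun t => if t = 0 then 0 else 1

theorem hat_ac (r : Z47 → F2) (t : Z47) : hat (ac r) t = hat r t * hat r (-t) := by
  unfold hat ac
  simp_rw [emb_sum, Finset.sum_mul]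
  rw [Finset.sum_comm]
  simp_rw [Finset.mul_sum]
  rw [Finset.sum_comm]
  conv_rhs => rw [Finset.sum_comm]
  rw [Finset.sum_comm]
  refine Finset.sum_congr rfl fun j _ => ?_
  rw [← Equiv.sum_comp (Equiv.subRight j)]
  refine Finset.sum_congr rfl fun i _ => ?_
  simp only [Equiv.subRight_apply, add_sub_cancel]
  rw [emb_mul]
  have : chi ((i - j) * t) = chi (i * t) * chi (j * (-t)) := by rw [← chi_add]; congr 1; ring
  rw [this]; ring

theorem hat_eps (t : Z47) : hat eps t = if t = 0 then 0 else 1 := by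
  have h1 : ∀ s : Z47, emb (eps s) * chi (s * t) = chi (s * t) - if s = 0 then 1 else 0 := by
    intro s
    unfold eps
    split_ifs with h
    · subst h; simp [emb, chi_zero]
    · simp [emb]
  unfold hat
  simp_rw [h1]
  rw [Finset.sum_sub_distrib, sum_chi]
  have h2 : (2 : KK) = 0 := CharTwo.two_eq_zero
  simp only [Finset.sum_ite_eq', Finset.mem_univ, if_true]
  split_ifs
  · ring
  · linear_combination -h2

def UU (r : Z47 → F2) : Prop := hat r 0 = 0 ∧ ∀ t, t ≠ 0 → hat r t * hat r (-t) = 1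

theorem UU_iff (r : Z47 → F2) : UU r ↔ ac r = eps := by
  constructor
  · rintro ⟨h0, h1⟩
    apply hat_inj
    intro t
    rw [hat_ac, hat_eps]
    split_ifs with h
    · subst h; rw [h0, zero_mul]
    · exact h1 t h
  · intro h
    have h' : ∀ t, hat r t * hat r (-t) = if t = 0 then 0 else 1 := by
      intro t; rw [← hat_ac, h, hat_eps]
    refine ⟨?_, fun t ht => by rw [h', if_neg ht]⟩
    have := h' 0
    simpa using this

theorem UU.conv {a b : Z47 → F2} (ha : UU a) (hb : UU b) : UU (conv a b) := by
  refine ⟨by rw [hat_conv, ha.1, zero_mul], fun t ht => ?_⟩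
  rw [hat_conv, hat_conv]
  linear_combination hat b t * hat b (-t) * ha.2 t ht + hb.2 t ht

theorem UU.affine {r : Z47 → F2} (hr : UU r) {m : Z47} (hm : m ≠ 0) (s : Z47) : UU (affine m s r) := by
  refine ⟨by rw [hat_affine _ _ _ hm, mul_zero, mul_zero, hr.1, mul_zero], fun t ht => ?_⟩
  rw [hat_affine _ _ _ hm, hat_affine _ _ _ hm]
  have h1 := hr.2 (m⁻¹ * t) (mul_ne_zero (inv_ne_zero hm) ht)
  have h2 : chi (-(m⁻¹ * s * t)) * chi (-(m⁻¹ * s * -t)) = 1 := by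
    rw [← chi_add, ← chi_zero]; congr 1; ring
  rw [mul_neg m⁻¹ t]
  linear_combination hat r (m⁻¹ * t) * hat r (-(m⁻¹ * t)) * h2 + h1

theorem UU_eps : UU eps := by
  refine ⟨by rw [hat_eps, if_pos rfl], fun t ht => ?_⟩
  rw [hat_eps, hat_eps, if_neg ht, if_neg (neg_ne_zero.2 ht), one_mul]

theorem UU.ne_zero {r : Z47 → F2} (hr : UU r) {t : Z47} (ht : t ≠ 0) : hat r t ≠ 0 := by
  intro h
  have := hr.2 t ht
  rw [h, zero_mul] at this
  exact zero_ne_one this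

theorem UU.hat_neg_two {r : Z47 → F2} (hr : UU r) {t : Z47} (ht : t ≠ 0) :
    hat r (-2 * t) = hat r t ^ (-2 : ℤ) := by
  have h := hr.2 (2 * t) (mul_ne_zero (by decide) ht)
  rw [hat_two] at h
  have h0 := hr.ne_zero ht
  rw [show (-2 : Z47) * t = -(2 * t) by ring, zpow_neg]
  exact eq_inv_of_mul_eq_one_right (by exact_mod_cast h)

theorem UU.hat_pow {r : Z47 → F2} (hr : UU r) (k : ℕ) :
    hat r ((-2) ^ k) = hat r 1 ^ ((-2 : ℤ) ^ k) := by
  induction k with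
  | zero => simp
  | succ k ih =>
    rw [pow_succ', hr.hat_neg_two (pow_ne_zero _ (by decide)), ih, ← zpow_mul, pow_succ]

theorem neg_two_gen (t : Z47) (ht : t ≠ 0) : ∃ k : ℕ, k < 46 ∧ (-2 : Z47) ^ k = t := by
  revert t; decide +kernel

theorem UU.inj {a b : Z47 → F2} (ha : UU a) (hb : UU b) (h : hat a 1 = hat b 1) : a = b := by
  apply hat_inj
  intro t
  by_cases ht : t = 0
  · subst ht; rw [ha.1, hb.1]
  · obtain ⟨k, -, hk⟩ := neg_two_gen t ht
    rw [← hk, ha.hat_pow, hb.hat_pow, h]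

abbrev PP : ℕ := 178481
theorem prime_PP : Nat.Prime PP := by norm_num [PP]
instance factPP : Fact (Nat.Prime PP) := ⟨prime_PP⟩

theorem powPP (a n c : ℕ) (h : Nat.beq (a ^ n % 178481) c = true) : ((a : ℕ) : ZMod PP) ^ n = (c : ℕ) := by
  have h := Nat.eq_of_beq_eq_true h
  rw [← h, ← Nat.cast_pow]
  exact (ZMod.natCast_mod _ _).symm

theorem neOnePP (a n c : ℕ) (h : Nat.beq (a ^ n % 178481) c = true) (h1 : c ≠ 1) (h2 : c < PP) :
    ((a : ℕ) : ZMod PP) ^ n ≠ 1 := by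
  rw [powPP a n c h]
  intro h3
  have h4 : ((c : ℕ) : ZMod PP) = ((1 : ℕ) : ZMod PP) := by rw [h3]; simp
  rw [ZMod.natCast_eq_natCast_iff'] at h4
  rw [Nat.mod_eq_of_lt h2] at h4
  exact h1 (by rw [h4]; rfl)

set_option exponentiation.threshold 1000000 in
theorem prim3 : IsPrimitiveRoot ((3 : ZMod PP) ^ 46) 3880 := by
  have h : orderOf ((3 : ZMod PP) ^ 46) = 3880 := by
    apply orderOf_eq_of_pow_and_pow_div_prime (by norm_num)
    · rw [← pow_mul]
      have := powPP 3 (46 * 3880) 1 (by decide +kernel)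
      simpa using this
    · intro q hq hd
      have h0 : q ∣ 2 ^ 3 * 5 * 97 := by simpa using hd
      have h1 : q = 2 ∨ q = 5 ∨ q = 97 := by
        rcases (Nat.Prime.dvd_mul hq).1 h0 with h | h
        · rcases (Nat.Prime.dvd_mul hq).1 h with h | h
          · left; exact (Nat.prime_dvd_prime_iff_eq hq Nat.prime_two).1 (hq.dvd_of_dvd_pow h)
          · right; left; exact (Nat.prime_dvd_prime_iff_eq hq (by norm_num)).1 h
        · right; right; exact (Nat.prime_dvd_prime_iff_eq hq (by norm_num)).1 h
      rw [← pow_mul]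
      rcases h1 with rfl | rfl | rfl
      · exact_mod_cast neOnePP 3 (46 * (3880 / 2)) 178480 (by decide +kernel) (by norm_num) (by norm_num)
      · exact_mod_cast neOnePP 3 (46 * (3880 / 5)) 160867 (by decide +kernel) (by norm_num) (by norm_num)
      · exact_mod_cast neOnePP 3 (46 * (3880 / 97)) 113011 (by decide +kernel) (by norm_num) (by norm_num)
  rw [← h]; exact IsPrimitiveRoot.orderOf _

theorem neg2_eq : (-2 : ZMod PP) = ((178479 : ℕ) : ZMod PP) := by decide +kernel

set_option exponentiation.threshold 1000000 in
theorem prim2 : IsPrimitiveRoot (-2 : ZMod PP) 46 := by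
  have h : orderOf (-2 : ZMod PP) = 46 := by
    rw [neg2_eq]
    apply orderOf_eq_of_pow_and_pow_div_prime (by norm_num)
    · have := powPP 178479 46 1 (by decide +kernel)
      simpa using this
    · intro q hq hd
      have h0 : q ∣ 2 * 23 := by simpa using hd
      have h1 : q = 2 ∨ q = 23 := by
        rcases (Nat.Prime.dvd_mul hq).1 h0 with h | h
        · left; exact (Nat.prime_dvd_prime_iff_eq hq Nat.prime_two).1 h
        · right; exact (Nat.prime_dvd_prime_iff_eq hq (by norm_num)).1 h
      rcases h1 with rfl | rfl
      · exact neOnePP 178479 (46 / 2) 178480 (by decide +kernel) (by norm_num) (by norm_num)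
      · exact neOnePP 178479 (46 / 23) 4 (by decide +kernel) (by norm_num) (by norm_num)
  rw [← h]; exact IsPrimitiveRoot.orderOf _

theorem decompPP (e : ZMod PP) (he : e ≠ 0) : ∃ i < 3880, ∃ k : ℕ, e = (-2) ^ k * 3 ^ i := by
  have h1 : e ^ (PP - 1) = 1 := ZMod.pow_card_sub_one_eq_one he
  have h2 : (e ^ 46) ^ 3880 = 1 := by rw [← pow_mul]; exact h1
  obtain ⟨i, hi, h⟩ := prim3.eq_pow_of_pow_eq_one h2
  have h3 : (3 : ZMod PP) ^ i ≠ 0 := pow_ne_zero _ (by decide +kernel)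
  have h4 : (e / 3 ^ i) ^ 46 = 1 := by
    rw [div_pow, ← h, ← pow_mul, ← pow_mul, mul_comm]
    exact div_self (pow_ne_zero _ (by decide +kernel))
  obtain ⟨k, -, hk⟩ := prim2.eq_pow_of_pow_eq_one h4
  exact ⟨i, hi, k, by rw [hk]; field_simp⟩

theorem hat_two_pow (r : Z47 → F2) (k : ℕ) : hat r (2 ^ k) = hat r 1 ^ (2 ^ k) := by
  induction k with
  | zero => simp
  | succ k ih => rw [pow_succ', hat_two, ih, ← pow_mul]; rfl

theorem UU.pow_order {r : Z47 → F2} (hr : UU r) : (hat r 1 ^ 47) ^ PP = 1 := by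
  have h := hat_two_pow r 23
  rw [show (2 : Z47) ^ 23 = 1 by decide +kernel] at h
  have h0 := hr.ne_zero (t := 1) (by decide)
  rw [← pow_mul]
  apply mul_left_cancel₀ h0
  rw [mul_one, ← pow_succ']
  exact h.symm

theorem eps_of_pow {r : Z47 → F2} (hr : UU r) (h : hat r 1 ^ 47 = 1) : ∃ s, r = affine 1 s eps := by
  obtain ⟨s, hs⟩ := exists_chi h
  refine ⟨-s, UU.inj hr (UU_eps.affine (by decide) _) ?_⟩
  rw [hat_affine _ _ _ (by decide), hs, hat_eps, if_neg (by simp)]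
  simp

noncomputable def rrF (rho : Z47 → F2) : ℕ → Z47 → F2
  | 0 => rho
  | i + 1 => conv (rrF rho i) (conv (rrF rho i) (rrF rho i))

theorem UU_rrF {rho : Z47 → F2} (h : UU rho) (i : ℕ) : UU (rrF rho i) := by
  induction i with
  | zero => exact h
  | succ i ih => exact ih.conv (ih.conv ih)

theorem hat_rrF (rho : Z47 → F2) (i : ℕ) : hat (rrF rho i) 1 = hat rho 1 ^ (3 ^ i) := by
  induction i with
  | zero => simp [rrF]
  | succ i ih => rw [rrF, hat_conv, hat_conv, ih]; ring

theorem beta_prim {rho : Z47 → F2} (h : UU rho) (hne : ∀ s, rho ≠ affine 1 s eps) :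
    IsPrimitiveRoot (hat rho 1 ^ 47) PP := by
  have : orderOf (hat rho 1 ^ 47) = PP := orderOf_eq_prime h.pow_order (fun h1 => by
    obtain ⟨s, hs⟩ := eps_of_pow h h1
    exact hne s hs)
  rw [← this]; exact IsPrimitiveRoot.orderOf _

theorem zpow_congr {b : KK} (hb : IsPrimitiveRoot b PP) (x y : ℤ) : b ^ x = b ^ y ↔ (x : ZMod PP) = y := by
  have h0 : b ≠ 0 := hb.ne_zero (by norm_num)
  have h1 : b ^ x = b ^ y ↔ b ^ (x - y) = 1 := by
    rw [zpow_sub₀ h0, div_eq_one_iff_eq (zpow_ne_zero _ h0)]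
  rw [h1, hb.zpow_eq_one_iff_dvd, ← ZMod.intCast_zmod_eq_zero_iff_dvd, Int.cast_sub, sub_eq_zero]

theorem UU_class {rho : Z47 → F2} (h : UU rho) (hne : ∀ s, rho ≠ affine 1 s eps)
    {r : Z47 → F2} (hr : UU r) :
    (∃ s, r = affine 1 s eps) ∨ ∃ i < 3880, ∃ m s, m ≠ 0 ∧ r = affine m s (rrF rho i) := by
  have hb := beta_prim h hne
  obtain ⟨e, he, hre⟩ := hb.eq_pow_of_pow_eq_one hr.pow_order
  rcases Nat.eq_zero_or_pos e with h0 | hpos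
  · left
    exact eps_of_pow hr (by rw [← hre, h0, pow_zero])
  right
  have hez : ((e : ℕ) : ZMod PP) ≠ 0 := by
    intro h1
    rw [ZMod.natCast_eq_zero_iff] at h1
    exact absurd (Nat.le_of_dvd hpos h1) (by omega)
  obtain ⟨i, hi, k, hk⟩ := decompPP _ hez
  have h2k : ((-2 : Z47) ^ k) ≠ 0 := pow_ne_zero _ (by decide)
  have hA := UU_rrF h i
  set a := affine ((-2 : Z47) ^ k)⁻¹ 0 (rrF rho i) with ha
  have hUa : UU a := hA.affine (inv_ne_zero h2k) 0
  have hat_a : hat a 1 = hat (rrF rho i) 1 ^ ((-2 : ℤ) ^ k) := by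
    rw [ha, hat_affine _ _ _ (inv_ne_zero h2k), ← hA.hat_pow]
    simp [chi_zero]
  have h3 : hat r 1 ^ 47 = hat a 1 ^ 47 := by
    have h4 : hat a 1 ^ 47 = (hat rho 1 ^ 47) ^ ((3 : ℤ) ^ i * (-2 : ℤ) ^ k) := by
      rw [hat_a, hat_rrF]
      rw [← zpow_natCast, ← zpow_natCast, ← zpow_natCast, ← zpow_mul, ← zpow_mul, ← zpow_mul]
      congr 1
      push_cast; ring
    rw [← hre, h4, ← zpow_natCast, zpow_congr hb]
    push_cast
    rw [hk]; ring
  have ha0 := hUa.ne_zero (t := 1) (by decide)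
  obtain ⟨s, hs⟩ := exists_chi (q := hat r 1 / hat a 1) (by rw [div_pow, h3]; exact div_self (pow_ne_zero _ ha0))
  refine ⟨i, hi, ((-2 : Z47) ^ k)⁻¹, ((-2 : Z47) ^ k)⁻¹ * (-s), inv_ne_zero h2k, ?_⟩
  have h5 : r = affine 1 (-s) a := by
    apply UU.inj hr (hUa.affine (by decide) _)
    rw [hat_affine _ _ _ (by decide)]
    simp only [inv_one, one_mul, mul_one, neg_neg]
    rw [← hs]; field_simp
  rw [h5, ha]
  funext j
  simp only [affine]
  congr 1; ring

theorem UU_dist {rho : Z47 → F2} (h : UU rho) (hne : ∀ s, rho ≠ affine 1 s eps)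
    {i j : ℕ} (hi : i < 3880) (hj : j < 3880) {m s : Z47} (hm : m ≠ 0)
    (he : rrF rho j = affine m s (rrF rho i)) : i = j := by
  have hb := beta_prim h hne
  obtain ⟨k, -, hk⟩ := neg_two_gen m⁻¹ (inv_ne_zero hm)
  have h1 : hat (rrF rho j) 1 = chi (-(m⁻¹ * s * 1)) * hat (rrF rho i) 1 ^ ((-2 : ℤ) ^ k) := by
    rw [he, hat_affine _ _ _ hm, ← (UU_rrF h i).hat_pow, hk, mul_one (m⁻¹)]
  have h2 : hat (rrF rho j) 1 ^ 47 = (hat (rrF rho i) 1 ^ ((-2 : ℤ) ^ k)) ^ 47 := by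
    rw [h1, mul_pow, chi_pow, one_mul]
  rw [hat_rrF, hat_rrF] at h2
  have h3 : (hat rho 1 ^ 47) ^ ((3 : ℤ) ^ j) = (hat rho 1 ^ 47) ^ ((3 : ℤ) ^ i * (-2) ^ k) := by
    convert h2 using 1
    · rw [← zpow_natCast, ← zpow_natCast, ← zpow_natCast, ← zpow_mul, ← zpow_mul]
      congr 1; push_cast; ring
    · rw [← zpow_natCast, ← zpow_natCast, ← zpow_natCast, ← zpow_mul, ← zpow_mul, ← zpow_mul]
      congr 1; push_cast; ring
  rw [zpow_congr hb] at h3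
  push_cast at h3
  have h4 : ((3 : ZMod PP) ^ 46) ^ j = ((3 : ZMod PP) ^ 46) ^ i := by
    calc ((3 : ZMod PP) ^ 46) ^ j = ((3 : ZMod PP) ^ j) ^ 46 := by rw [← pow_mul, ← pow_mul, mul_comm]
      _ = ((3 : ZMod PP) ^ 46) ^ i * ((-2) ^ 46) ^ k := by
        rw [h3, mul_pow, ← pow_mul, ← pow_mul, ← pow_mul, ← pow_mul, mul_comm i, mul_comm k]
      _ = _ := by rw [prim2.pow_eq_one, one_pow, mul_one]
  exact (prim3.pow_inj hj hi h4).symm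

def pk (b L : ℕ) (f : ℕ → ℕ) : ℕ := ∑ k ∈ Finset.range L, f k * 2 ^ (b * k)

theorem pk_succ (b L : ℕ) (f : ℕ → ℕ) : pk b (L + 1) f = f 0 + 2 ^ b * pk b L (fun k => f (k + 1)) := by
  unfold pk
  rw [Finset.sum_range_succ', Finset.mul_sum, add_comm]
  congr 1
  · simp
  · refine Finset.sum_congr rfl fun k _ => ?_
    rw [mul_add, mul_one, pow_add]; ring

theorem pk_congr {b L : ℕ} {f g : ℕ → ℕ} (h : ∀ k < L, f k = g k) : pk b L f = pk b L g :=
  Finset.sum_congr rfl fun k hk => by rw [h k (Finset.mem_range.1 hk)]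

theorem pk_add (b L : ℕ) (f g : ℕ → ℕ) : pk b L f + pk b L g = pk b L (fun k => f k + g k) := by
  unfold pk; rw [← Finset.sum_add_distrib]
  exact Finset.sum_congr rfl fun k _ => by ring

theorem pk_sub (b L : ℕ) (f g : ℕ → ℕ) (h : ∀ k < L, g k ≤ f k) :
    pk b L f - pk b L g = pk b L (fun k => f k - g k) := by
  rw [Nat.sub_eq_iff_eq_add, pk_add]
  · exact pk_congr fun k hk => (Nat.sub_add_cancel (h k hk)).symm
  · exact Finset.sum_le_sum fun k hk => Nat.mul_le_mul_right _ (h k (Finset.mem_range.1 hk))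

theorem pk_mul (b L : ℕ) (f : ℕ → ℕ) (c : ℕ) : pk b L f * c = pk b L (fun k => f k * c) := by
  unfold pk; rw [Finset.sum_mul]
  exact Finset.sum_congr rfl fun k _ => by ring

theorem pk_regroup (b c m : ℕ) (f : ℕ → ℕ) :
    pk (b * c) m (fun k => pk b c (fun i => f (c * k + i))) = pk b (c * m) f := by
  induction m with
  | zero => simp [pk]
  | succ m ih =>
    unfold pk at ih ⊢
    rw [Finset.sum_range_succ, ih, mul_add, mul_one, Finset.sum_range_add]
    congr 1
    rw [Finset.sum_mul]
    refine Finset.sum_congr rfl fun i _ => ?_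
    rw [mul_assoc, ← pow_add]; congr 2; ring

theorem pk_shift (b L i : ℕ) (f : ℕ → ℕ) :
    pk b L f * 2 ^ (b * i) = pk b (i + L) (fun j => if j < i then 0 else f (j - i)) := by
  unfold pk
  rw [Finset.sum_range_add, Finset.sum_mul]
  rw [Finset.sum_eq_zero (s := Finset.range i), zero_add]
  · refine Finset.sum_congr rfl fun k _ => ?_
    simp only [Nat.not_lt.2 (Nat.le_add_right i k), if_false, Nat.add_sub_cancel_left]
    rw [mul_assoc, ← pow_add]; congr 2; ring
  · intro k hk
    simp [Finset.mem_range.1 hk]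

theorem pk_extend (b L c : ℕ) (f : ℕ → ℕ) : pk b L f = pk b (L + c) (fun j => if j < L then f j else 0) := by
  unfold pk
  rw [Finset.sum_range_add, Finset.sum_eq_zero (s := Finset.range c), add_zero]
  · exact Finset.sum_congr rfl fun k hk => by simp [Finset.mem_range.1 hk]
  · intro k _; simp

theorem testBit_pk (b L : ℕ) (f : ℕ → ℕ) (hf : ∀ k < L, f k < 2 ^ b) (k j : ℕ) (hj : j < b) :
    (pk b L f).testBit (b * k + j) = (decide (k < L) && (f k).testBit j) := by
  induction L generalizing f k with
  | zero => simp [pk]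
  | succ L ih =>
    rw [pk_succ, add_comm]
    have h0 := hf 0 (Nat.succ_pos _)
    rw [Nat.testBit_two_pow_mul_add _ h0]
    cases k with
    | zero => simp [hj]
    | succ k =>
      rw [if_neg (by rw [mul_add, mul_one]; omega), show b * (k + 1) + j - b = b * k + j by rw [mul_add, mul_one]; omega,
        ih _ (fun k hk => hf (k + 1) (by omega))]
      simp

theorem pk_ext {b L : ℕ} (hb : 0 < b) {N : ℕ} {f : ℕ → ℕ} (hf : ∀ k < L, f k < 2 ^ b)
    (h : ∀ k j, j < b → N.testBit (b * k + j) = (decide (k < L) && (f k).testBit j)) : N = pk b L f := by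
  apply Nat.eq_of_testBit_eq
  intro i
  have := h (i / b) (i % b) (Nat.mod_lt _ hb)
  have h2 := testBit_pk b L f hf (i / b) (i % b) (Nat.mod_lt _ hb)
  rw [Nat.div_add_mod] at this h2
  rw [this, h2]

theorem pk_shr_land {w L s c : ℕ} (hw : 0 < w) {f : ℕ → ℕ} (hf : ∀ k < L, f k < 2 ^ w) (hs : s ≤ w)
    (hc : c < 2 ^ (w - s)) :
    (pk w L f >>> s) &&& pk w L (fun _ => c) = pk w L (fun k => (f k >>> s) &&& c) := by
  have hc' : c < 2 ^ w := lt_of_lt_of_le hc (Nat.pow_le_pow_right (by norm_num) (by omega))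
  apply pk_ext hw
  · intro k _
    exact lt_of_le_of_lt Nat.and_le_right hc'
  · intro k j hj
    rw [Nat.testBit_and, Nat.testBit_shiftRight, testBit_pk w L _ (fun _ _ => hc') k j hj, Nat.testBit_and,
      Nat.testBit_shiftRight]
    by_cases h : j + s < w
    · rw [show s + (w * k + j) = w * k + (s + j) by ring, testBit_pk w L f hf k (s + j) (by omega)]
      cases decide (k < L) <;> simp
    · have : c.testBit j = false := Nat.testBit_lt_two_pow (lt_of_lt_of_le hc (Nat.pow_le_pow_right (by norm_num) (by omega)))
      rw [this]; simp

theorem pk_xor {w L : ℕ} (hw : 0 < w) {f g : ℕ → ℕ} (hf : ∀ k < L, f k < 2 ^ w) (hg : ∀ k < L, g k < 2 ^ w) :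
    pk w L f ^^^ pk w L g = pk w L (fun k => f k ^^^ g k) := by
  apply pk_ext hw
  · intro k hk
    exact Nat.xor_lt_two_pow (hf k hk) (hg k hk)
  · intro k j hj
    rw [Nat.testBit_xor, testBit_pk w L _ hf k j hj, testBit_pk w L _ hg k j hj, Nat.testBit_xor]
    cases decide (k < L) <;> simp

/-- one halving level -/
theorem pk_level (b m : ℕ) (hb : 0 < b) (g : ℕ → ℕ) (hg : ∀ k < 2 * m, g k < 2 ^ b) :
    (pk b (2 * m) g &&& pk (b * 2) m (fun _ => 2 ^ b - 1)) +
      ((pk b (2 * m) g >>> b) &&& pk (b * 2) m (fun _ => 2 ^ b - 1)) =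
    pk (b * 2) m (fun k => g (2 * k) + g (2 * k + 1)) := by
  have hpos : 0 < 2 ^ b := by positivity
  have e := pk_regroup b 2 m g
  have h2 : ∀ k, pk b 2 (fun i => g (2 * k + i)) = g (2 * k) + 2 ^ b * g (2 * k + 1) := by
    intro k; simp [pk, Finset.sum_range_succ]; ring
  have hlt : ∀ k < m, pk b 2 (fun i => g (2 * k + i)) < 2 ^ (b * 2) := by
    intro k hk
    rw [h2, show b * 2 = b + b by ring, pow_add]
    have h3 := hg (2 * k) (by omega)
    have h4 := hg (2 * k + 1) (by omega)
    nlinarith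
  have hA := pk_shr_land (w := b * 2) (L := m) (s := 0) (c := 2 ^ b - 1) (by omega) hlt (by omega)
    (lt_of_lt_of_le (by omega : 2 ^ b - 1 < 2 ^ b) (Nat.pow_le_pow_right (by norm_num) (by omega)))
  have hB := pk_shr_land (w := b * 2) (L := m) (s := b) (c := 2 ^ b - 1) (by omega) hlt (by omega)
    (by rw [show b * 2 - b = b by omega]; omega)
  rw [e] at hA hB
  rw [Nat.shiftRight_zero] at hA
  rw [hA, hB, pk_add]
  refine pk_congr fun k hk => ?_
  have h3 := hg (2 * k) (by omega)
  have h4 := hg (2 * k + 1) (by omega)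
  rw [h2, Nat.and_two_pow_sub_one_eq_mod, Nat.and_two_pow_sub_one_eq_mod, Nat.shiftRight_zero,
    Nat.shiftRight_eq_div_pow]
  rw [Nat.add_mul_mod_self_left, Nat.mod_eq_of_lt h3, Nat.add_mul_div_left _ _ hpos, Nat.div_eq_of_lt h3, zero_add,
    Nat.mod_eq_of_lt h4]

theorem pk_const (b c m x : ℕ) (y : ℕ) (h : pk b c (fun _ => x) = y) :
    pk (b * c) m (fun _ => y) = pk b (c * m) (fun _ => x) := by
  rw [← pk_regroup, h]

theorem pk_digits (b L N : ℕ) (h : N < 2 ^ (b * L)) : N = pk b L (fun k => N / 2 ^ (b * k) % 2 ^ b) := by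
  induction L generalizing N with
  | zero => simp [pk] at h ⊢; omega
  | succ L ih =>
    rw [pk_succ]
    have h1 : N / 2 ^ b < 2 ^ (b * L) := by
      rw [Nat.div_lt_iff_lt_mul (by positivity), ← pow_add]; exact h
    have h2 := ih _ h1
    have h3 : pk b L (fun k => N / 2 ^ b / 2 ^ (b * k) % 2 ^ b) = pk b L (fun k => N / 2 ^ (b * (k + 1)) % 2 ^ b) :=
      pk_congr fun k _ => by
        rw [Nat.div_div_eq_div_mul, ← pow_add, show b + b * k = b * (k + 1) by ring]
    rw [← h3, ← h2]
    simp [Nat.mod_add_div]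

/-- popcount -/
def onesL (L : ℕ) : ℕ := Nat.div (Nat.sub (Nat.pow 2 (Nat.mul 48 L)) 1) (Nat.sub (Nat.pow 2 48) 1)

theorem onesL_eq (L c : ℕ) : onesL L * c = pk 48 L (fun _ => c) := by
  have h : onesL L = pk 48 L (fun _ => 1) := by
    show (2 ^ (48 * L) - 1) / (2 ^ 48 - 1) = _
    apply Nat.div_eq_of_eq_mul_left (by norm_num)
    unfold pk
    simp only [one_mul, pow_mul]
    rw [Nat.geomSum_eq (by norm_num), Nat.div_mul_cancel]
    have := Nat.sub_dvd_pow_sub_pow (2 ^ 48) 1 L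
    rwa [one_pow] at this
  rw [h, pk_mul]; simp

def swP1 (M x : ℕ) : ℕ := Nat.add (Nat.land x M) (Nat.land (Nat.shiftRight x 1) M)
def swP2 (M x : ℕ) : ℕ := Nat.add (Nat.land x M) (Nat.land (Nat.shiftRight x 2) M)
def swP4 (M x : ℕ) : ℕ := Nat.add (Nat.land x M) (Nat.land (Nat.shiftRight x 4) M)
def swPop (M1 M2 M4 x : ℕ) : ℕ := Nat.mul (swP4 M4 (swP2 M2 (swP1 M1 x))) 0x010101010101

def bitN (x j : ℕ) : ℕ := if x.testBit j then 1 else 0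
def popN (x : ℕ) : ℕ := ∑ j ∈ Finset.range 48, bitN x j

theorem bitN_le (x j : ℕ) : bitN x j ≤ 1 := by unfold bitN; split <;> simp

theorem pk_bits (w x : ℕ) (hx : x < 2 ^ w) : pk 1 w (fun j => bitN x j) = x := by
  symm
  apply pk_ext (by norm_num)
  · intro k _; have := bitN_le x k; omega
  · intro k j hj
    obtain rfl : j = 0 := by omega
    by_cases h : k < w
    · simp only [one_mul, add_zero, h, decide_true, Bool.true_and]
      unfold bitN; split <;> simp_all
    · simp only [one_mul, add_zero, h, decide_false, Bool.false_and]
      exact Nat.testBit_lt_two_pow (lt_of_lt_of_le hx (Nat.pow_le_pow_right (by norm_num) (by omega)))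

def byteS (g : ℕ → ℕ) (q : ℕ) : ℕ := ∑ i ∈ Finset.range 8, g (8 * q + i)

theorem swP_eq (L : ℕ) (f : ℕ → ℕ) (hf : ∀ k < L, f k < 2 ^ 48) :
    ∃ g : ℕ → ℕ, (∀ q, g q ≤ 8) ∧
     (∀ k < L, ∑ i ∈ Finset.range 6, g (6 * k + i) = popN (f k)) ∧
     swP4 (pk 48 L (fun _ => 0x0f0f0f0f0f0f)) (swP2 (pk 48 L (fun _ => 0x333333333333))
       (swP1 (pk 48 L (fun _ => 0x555555555555)) (pk 48 L f))) = pk 8 (6 * L) g := by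
  set b : ℕ → ℕ := fun j => bitN (f (j / 48)) (j % 48) with hb
  have hb1 : ∀ j, b j ≤ 1 := fun j => bitN_le _ _
  have e0 : pk 48 L f = pk 1 (2 * (24 * L)) b := by
    rw [show 2 * (24 * L) = 48 * L by ring, ← pk_regroup 1 48 L b]
    refine pk_congr fun k hk => ?_
    rw [← pk_bits 48 (f k) (hf k hk)]
    refine pk_congr fun i hi => ?_
    simp only [hb]
    rw [show (48 * k + i) / 48 = k by omega, show (48 * k + i) % 48 = i by omega]
  set b2 : ℕ → ℕ := fun k => b (2 * k) + b (2 * k + 1) with hb2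
  set b4 : ℕ → ℕ := fun k => b2 (2 * k) + b2 (2 * k + 1) with hb4
  set b8 : ℕ → ℕ := fun k => b4 (2 * k) + b4 (2 * k + 1) with hb8
  have h2 : ∀ k, b2 k ≤ 2 := fun k => by have := hb1 (2 * k); have := hb1 (2 * k + 1); simp only [hb2]; omega
  have h4 : ∀ k, b4 k ≤ 4 := fun k => by have := h2 (2 * k); have := h2 (2 * k + 1); simp only [hb4]; omega
  have h8 : ∀ k, b8 k ≤ 8 := fun k => by have := h4 (2 * k); have := h4 (2 * k + 1); simp only [hb8]; omega
  refine ⟨b8, h8, ?_, ?_⟩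
  · intro k hk
    have hbk : ∀ i < 48, b (48 * k + i) = bitN (f k) i := by
      intro i hi
      simp only [hb]
      rw [show (48 * k + i) / 48 = k by omega, show (48 * k + i) % 48 = i by omega]
    unfold popN
    rw [← Finset.sum_congr rfl fun i hi => hbk i (Finset.mem_range.1 hi)]
    simp only [Finset.sum_range_succ, Finset.sum_range_zero, hb8, hb4, hb2, mul_add, ← mul_assoc]
    norm_num [add_assoc]
  · have m1 := pk_const 2 24 L 1 0x555555555555 (by decide +kernel)
    have m2 := pk_const 4 12 L 3 0x333333333333 (by decide +kernel)
    have m4 := pk_const 8 6 L 15 0x0f0f0f0f0f0f (by decide +kernel)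
    norm_num at m1 m2 m4
    rw [m1, m2, m4, e0]
    have l1 := pk_level 1 (24 * L) (by norm_num) b (fun k _ => by have := hb1 k; omega)
    have l2 := pk_level 2 (12 * L) (by norm_num) b2 (fun k _ => by have := h2 k; omega)
    have l4 := pk_level 4 (6 * L) (by norm_num) b4 (fun k _ => by have := h4 k; omega)
    have l1' : swP1 (pk 2 (24 * L) fun _ => 1) (pk 1 (2 * (24 * L)) b) = pk 2 (2 * (12 * L)) b2 := by
      rw [show 2 * (12 * L) = 24 * L by ring]; exact l1
    have l2' : swP2 (pk 4 (12 * L) fun _ => 3) (pk 2 (2 * (12 * L)) b2) = pk 4 (2 * (6 * L)) b4 := by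
      rw [show 2 * (6 * L) = 12 * L by ring]; exact l2
    rw [l1', l2']
    exact l4

theorem swPop_eq (L : ℕ) (f : ℕ → ℕ) (hf : ∀ k < L, f k < 2 ^ 48) :
    ∃ h : ℕ → ℕ, (∀ q, h q ≤ 48) ∧ (∀ k < L, h (6 * k + 5) = popN (f k)) ∧
     swPop (pk 48 L (fun _ => 0x555555555555)) (pk 48 L (fun _ => 0x333333333333))
      (pk 48 L (fun _ => 0x0f0f0f0f0f0f)) (pk 48 L f) = pk 8 (6 * L + 5) h := by
  obtain ⟨g, hg, hg2, hg3⟩ := swP_eq L f hf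
  set G : ℕ → ℕ → ℕ := fun i j => if j < i + 6 * L then (if j < i then 0 else g (j - i)) else 0 with hG
  have hG8 : ∀ i j, G i j ≤ 8 := by
    intro i j; simp only [hG]
    have := hg (j - i)
    split_ifs <;> omega
  have key : ∀ i, i ≤ 5 → pk 8 (6 * L) g * 2 ^ (8 * i) = pk 8 (6 * L + 5) (G i) := by
    intro i hi
    rw [pk_shift, pk_extend 8 (i + 6 * L) (5 - i), show i + 6 * L + (5 - i) = 6 * L + 5 by omega]
  refine ⟨fun j => G 0 j + G 1 j + G 2 j + G 3 j + G 4 j + G 5 j, ?_, ?_, ?_⟩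
  · intro q
    have := hG8 0 q; have := hG8 1 q; have := hG8 2 q
    have := hG8 3 q; have := hG8 4 q; have := hG8 5 q
    show G 0 q + G 1 q + G 2 q + G 3 q + G 4 q + G 5 q ≤ 48
    omega
  · intro k hk
    rw [← hg2 k hk]
    have h1 : ∀ i ≤ 5, G i (6 * k + 5) = g (6 * k + (5 - i)) := by
      intro i hi
      simp only [hG]
      rw [if_pos (by omega), if_neg (by omega), show 6 * k + 5 - i = 6 * k + (5 - i) by omega]
    simp only [Finset.sum_range_succ, Finset.sum_range_zero]
    rw [h1 0 (by omega), h1 1 (by omega), h1 2 (by omega), h1 3 (by omega), h1 4 (by omega), h1 5 (by omega)]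
    simp only [Nat.sub_zero, Nat.sub_self, Nat.reduceSub]
    ring
  · rw [swPop, hg3]
    show pk 8 (6 * L) g * 0x010101010101 = _
    rw [← pk_add, ← pk_add, ← pk_add, ← pk_add, ← pk_add]
    rw [← key 0 (by omega), ← key 1 (by omega), ← key 2 (by omega), ← key 3 (by omega), ← key 4 (by omega),
      ← key 5 (by omega)]
    ring

theorem testBit_seven (x : ℕ) (hx : x < 256) : x.testBit 7 = decide (128 ≤ x) := by
  revert hx; revert x; decide +kernel

theorem testBit_swPop (L : ℕ) (f : ℕ → ℕ) (hf : ∀ k < L, f k < 2 ^ 48) (c : ℕ) (hc : c ≤ 128) (k : ℕ) (hk : k < L) :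
    (swPop (pk 48 L (fun _ => 0x555555555555)) (pk 48 L (fun _ => 0x333333333333))
      (pk 48 L (fun _ => 0x0f0f0f0f0f0f)) (pk 48 L f) + pk 48 L (fun _ => 0x010000000000 * c)).testBit (48 * k + 47)
      = decide (128 ≤ popN (f k) + c) := by
  obtain ⟨h, h48, h2, h3⟩ := swPop_eq L f hf
  set cc : ℕ → ℕ := fun j => if j < 6 * L then (if j % 6 = 5 then c else 0) else 0 with hcc
  have hcc' : ∀ j, cc j ≤ 128 := by intro j; simp only [hcc]; split_ifs <;> omega
  have e : pk 48 L (fun _ => 0x010000000000 * c) = pk 8 (6 * L + 5) cc := by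
    rw [hcc, ← pk_extend 8 (6 * L) 5, ← pk_regroup 8 6 L]
    refine pk_congr fun k _ => ?_
    simp only [pk, Finset.sum_range_succ, Finset.sum_range_zero, Nat.mul_add_mod_self_left]
    norm_num
    ring
  rw [h3, e, pk_add, show 48 * k + 47 = 8 * (6 * k + 5) + 7 by ring,
    testBit_pk _ _ _ (fun j _ => by have := h48 j; have := hcc' j; omega) _ _ (by norm_num)]
  have hc2 : cc (6 * k + 5) = c := by simp only [hcc]; rw [if_pos (by omega), if_pos (by omega)]
  have hlt : popN (f k) + c < 256 := by have := h48 (6 * k + 5); rw [h2 k hk] at this; omega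
  rw [hc2, h2 k hk, testBit_seven _ hlt]
  simp; omega

theorem testBit_H (L k : ℕ) (hk : k < L) : (pk 48 L (fun _ => 0x800000000000)).testBit (48 * k + 47) = true := by
  rw [testBit_pk _ _ _ (fun _ _ => by norm_num) _ _ (by norm_num)]
  simp only [hk, decide_true, Bool.true_and]
  decide +kernel
attribute [irreducible] onesL

def vecN (x : ℕ) : Z47 → F2 := fun j => if x.testBit j.val then 1 else 0

theorem vecN_xor (x y : ℕ) : vecN (x ^^^ y) = vecN x + vecN y := by
  funext j
  simp only [vecN, Pi.add_apply, Nat.testBit_xor]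
  cases x.testBit j.val <;> cases y.testBit j.val <;> decide

theorem popN_eq (x : ℕ) (hx : x < 2 ^ 47) : popN x = hammingNorm (vecN x) := by
  unfold popN hammingNorm
  rw [Finset.sum_range_succ, Finset.card_filter]
  have h : bitN x 47 = 0 := by unfold bitN; rw [Nat.testBit_lt_two_pow hx]; simp
  rw [h, add_zero, Finset.sum_range]
  refine Finset.sum_congr rfl fun j _ => ?_
  show bitN x (j : ℕ) = if (if x.testBit (j : ℕ) then (1 : F2) else 0) ≠ 0 then 1 else 0
  unfold bitN
  cases x.testBit (j : ℕ) <;> simp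

def rotF (x : ℕ) : ℕ := x + x - ((x >>> 46) &&& 1) * (2 ^ 47 - 1)

theorem rotF_cases (x : ℕ) (hx : x < 2 ^ 47) :
    (x < 2 ^ 46 ∧ rotF x = 2 * x) ∨ (∃ y < 2 ^ 46, x = 2 ^ 46 + y ∧ rotF x = 2 * y + 1) := by
  unfold rotF
  rw [Nat.and_one_is_mod, Nat.shiftRight_eq_div_pow]
  by_cases h : x < 2 ^ 46
  · left; refine ⟨h, ?_⟩
    rw [Nat.div_eq_of_lt h]; omega
  · right
    refine ⟨x - 2 ^ 46, by omega, by omega, ?_⟩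
    have : x / 2 ^ 46 = 1 := by omega
    rw [this]; omega

theorem rotF_le (x : ℕ) (hx : x < 2 ^ 47) : ((x >>> 46) &&& 1) * (2 ^ 47 - 1) ≤ x + x := by
  rw [Nat.and_one_is_mod, Nat.shiftRight_eq_div_pow]
  by_cases h : x < 2 ^ 46
  · rw [Nat.div_eq_of_lt h]; omega
  · have : x / 2 ^ 46 = 1 := by omega
    rw [this]; omega

theorem rotF_lt (x : ℕ) (hx : x < 2 ^ 47) : rotF x < 2 ^ 47 := by
  rcases rotF_cases x hx with ⟨h, h1⟩ | ⟨y, hy, _, h1⟩ <;> omega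

theorem vecN_rotF (x : ℕ) (hx : x < 2 ^ 47) (j : Z47) : vecN (rotF x) j = vecN x (j - 1) := by
  have hj : j.val < 47 := ZMod.val_lt j
  unfold vecN
  have hval : (j - 1).val = if j.val = 0 then 46 else j.val - 1 := by
    revert j; decide +kernel
  have : (rotF x).testBit j.val = x.testBit (j - 1).val := by
    rw [hval]
    rcases rotF_cases x hx with ⟨h, h1⟩ | ⟨y, hy, h0, h1⟩
    · rw [h1]
      split_ifs with h2
      · rw [h2, Nat.testBit_lt_two_pow h]; simp
      · obtain ⟨n, hn⟩ : ∃ n, j.val = n + 1 := ⟨j.val - 1, by omega⟩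
        rw [hn, Nat.testBit_succ]; simp
    · rw [h1]
      split_ifs with h2
      · rw [h2, h0, Nat.testBit_two_pow_add_eq, Nat.testBit_lt_two_pow hy]; simp
      · obtain ⟨n, hn⟩ : ∃ n, j.val = n + 1 := ⟨j.val - 1, by omega⟩
        rw [hn, Nat.testBit_succ, h0]
        simp only [Nat.add_sub_cancel]
        rw [Nat.testBit_two_pow_add_gt (by omega)]
        congr 1; omega
  rw [this]

def simdT : Nat := 0x1acd0e91f71f6244edc9d01d5e2f7b63182d20a45bd0856179a194c0d5530a8fb8ea259232bca2c1f93f1f5f1701d87b3e64561d5a824ebb86200e7313d3509f1fae6653f11725120d4a1021f9fe4a22c5efa90c2ef17d10881d725b7c7bc849366e32d1d3ae327cd36c1b08255b630d775d71e04bc2164f0d31520888f57de6715430a055c9339937cb0d8a8f45073e54bf12caf31e5141b19d50ee084128df0387789764e8d3da7a256c2411123879cd3ae17a395d3702fe8e4489361eba5316c40d56eb8c355944fcfe4a728e0f4316a35f8f895d4c9a789cc64f65797dbfd469b91b6aabbc8bd61663ed40f683220d19a6c0206d61e87ecdf1895d3aa20763fe3c7c2d88ba5060eda858584f305890a8d3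130d56f4772482792910bafb764219d07d67fd7607b920e3b0207e435127973b78c98925a42eaf8f7698a277d9dd39a9f15a7c61a3e54026380c5a031e26cc687f16f933d0d31797f24e624e47672104652d3d9d614689fef6dd3e2409cf4b5f7e546bc96d820e7569b385bf42257f174b71b4584f324d783173af5e1f0fbc2cec02a595d56aa56d8fb3832047378995e303d21021371e1147ff85d3a97840395dbc1c7b9a23b3ba5476222d8aa4801afdab5f279d5b85e8e582312b06b444b5d63ac904120b4b7d14fa3aa6000380ee45c5847b43d457ecf7536bcfdf17ff385e70972709534124cbd13b0b2bfcfb2dbe3f0e31dbb77e0b503dda24a76e9b4b51973a139d47cb78793592accb60592e731b2836a87c70491fd55e3e979385557c5f98d2dce7110dee9a4135890749b8f58e42033d44ba6ad8225e148b8f56550ed4b717d526e815d232672ba0f3da9a3b6c32318f97120505141219fd01159e5f5efa50d860625fd51981050eab1c5b9935ccdec21c59b04e749c3d88ddbf63440e40d5a254466b59ff2f1b175f2791f2d77e1b8c9d16a75f5f9cdd4f0d8836d8d8b105471677331e71cb331d4cbbee2501497274c76b418eaaa366a61a7a9c18b1596ba62eb507cd03c46bcc81a04057ed10277657c7521d7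96951707a2c34d63e5b719d4b8a0339eaee20c9671a385e2e847e3a268e15bb4e9ab1750945791502294fb572d98c4200ac6ceeded59b8b36a84e22165f753324785e11365d691a15434ec370c4beeb635af1f3069b6789f419bed476e16451160f465c62f2b511319b8134995b3f8dea2d7e3d4a6d413d5962010e1ccd39e70b4645a90742047aeedf8ab83bc8cd4d4e764f6e578636b41de2a118440b0798849ca8465f6a6cd07fbb6c1b6654acfe18a47873aaff7e88c99f39a626a955f273d67d0d00b789a6464141616efb2cd11260fc4f46e3c89fc47d1b03048b76124ddd2cf6f0236949d05155107ab6f02d24ee3e9e2845c5514f4757d17d4864b0eca057f04a9cb9a1e76e2be69d18d57c3e3e542eeb0e4e7ea129285c78d186dfd1b23083624afd783c9c3b289aa277276c0b74f13347c9aefbee3415a2d98727540c35bf7ad537656c952afc7aec24f4b20174380decfb5a2f0d179fc5ca2115aedb521a0f9232035ed96c43082bae3e52733e00d4cb03562ce516ad4c6e9aecdb43751bf17e3f990f292248945532979a83d5e7479016887add019c53e320837da626763a71452f59b5f7bb48c9c6d64707073dafce20094d39cf9152d77e46782f5b2c5a5306f7bd6256c907cd39c01e7a9a37067d4597c2782030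6f0df62c56555d791bf9e5b319cf58f7d12c5542780174611db762acf85933c8b71988395fcf1036d5d174ea5efd08a57c322efc76611cda0cfefc8c4c4b8485255267f0fc5a4b0769e288c963a53f4200ba572e4e76ade7a5bd668884ac381c4d864a7c52e83d18e27ed4f267af3d01874027f89da4932021e2d9704eaa133e079e3e973022ed96cd4364a1a97a4d2c41368caec8a7582c40273f9e2ae7a0afd86d13d5c03ae6585f0949e2d7f14d6d2301e19e53aa4e208c14366b71e590af131abd87caf53d38b648cdb764ba3ed92b27047953936f307008c3a3249a58366c38db7d68c6dc5b9f8c4a9424100b3f7528073901fb55ee13a5a8052274dfa6e0cf5c4c82ef50961b8f06d4a3d042ecaf20d8717035231975001c4c17b0bea2474d81961ce63995c343892b4ed29ce21a64313641650a317c62402c0d8c244f33ed52484122ffcfdb117ce1f3895c3337ef5e287fc35d832947bf1e698e75c849451578603b43b608c316ba9b3a60b54e0c19af1147b4865c5b7e4940c8ceb1269802cc6be77eeb6a3cf1376c7796be71ee3d84ceec235f4fbdca34c3ff54654aeb4ecf0f466eef469c4b400aec5b804e84d310454c6bc26d906fcd4e40460e119772f66d55260f67857c52217156755d1d883077b5566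1952e1b2cfff94cd7427531a5c9e21de75a8e79f770a47bc4603d41abb3f787163a86d29b0a8b2e1a2884d26410fcb619f3ad0de805b5b0f236f75ea3baec30c7508fc08245b4e30651da2d445aa0e0fb10a9f9129e8d1961180952ae18a831a197fa43ff1898270a2242781049eb23e4666e429c72a72b29fca34d5ca9b69637294ea4983ec62e08d1e88834615c6531073b64c4cc9fc9af337b1b02edab6738954e46852cda4937000c322719fa94913a33ce65683f744617cf7a4b77aa67c25f5f1750fdda0dce40842422590e5b5bd22bd8787a124ed99464178294ade0b316dd4c8d8662038697f319f71b27b90b76081a9570d8dc136a07919b2ea4021e5d7532a63e7c3e4906225e56ffa5a2420953908020c968c892bd32c35e567dd41f114504466b2beb31427de3aaf54149296a6f2e45231982f9f22fcff5dc69271e7b10e164ac487600eacc122abf60ba57e142460d164b6860a2894161ea2a6c0f4b3b5f57d54c4590566daaf3bf4a2f3f22ddb0e16e4233929e2c801a6ab2679d8f25b7185c781950d6f5b0a9242a9865c5e3235b4cf349698f681997a785867c9565938c2852bfb5153bfe45ec929bd1b75bcb8e45dca95833d44e25e164e80bc94f0b2be53f1694d53184d7f2601e1fb1a9c0562c2b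cc1c2710db6d8cdf89033f34dfb95ba0ac4816d060658d476d16c285e829a62d12c3c708d908afda0f5166f50b10d97ba24545b2c13f460dd9b5873becd3381976411c755c5e705fc402b26b1c53ca63d186fb31428ed7807d5cd03218cf4d2c931a9ed27f51c4551459f9419fe1b9a41129ede5e81acd28a3a06dc1882a510ec76ac918a3ec4411a8373ceac45f38060afc817f0d0b63a5fc9b9c3172fb72aa3c10f1b03d615d58a674bd67e447539d4779a66881c3605fcd3d3d5c0c37a74f2259cf0174388bc7d2caeb07459c402028058dfbe4683f42f2f96ac7a91fc4714e0d707c9f0654415c3a38a273fd330262af7c6e5f6caf98f4a8ec49352a1ac5b3634029bdee8835c11d5edaec5262e20a1e065ed6be10a212620c867b585b02660eb57edf219c41b1a6f66a089a5885c262a06907cb3700b7e52d298b0dfdc7002d922f38c0abec427aed26ce7464077850b3de3042fbc97ec3c1749cf31832c250bd58d246392f31343c2791700743ad30f94ada6b1884370a0f97d627774878d69315e43039e97bcb6c3df2887dd8ac7052c64a21640df1dddf017127b1810009124b9625639f5b0e12dfbc3ab95a022bdc92757b9b29f677993b281a4dd4aa63a64883be294c784d1388037442c4e0facc496d6b6458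c2152fea5028ce0de17f85356727797787078e648757602eb26b1db8753d941c58effaa4874474b29c6593498391b724b53320ec7e829605ce9065d1c71c0dd692c7381723b1ff451d7f65003cd9ee004502aa2dbd1635a6fbd8696e4ac4139aaa1e20c11fe4ea4d7095165c560e14fb6cfacc71d3998d1213221b11263b0641b96505ec714049f6df201d21b7ac906f06663133c31b465ce09172b3920f8ee4697db22ee2e76160984c662704d9ce43f42bf017a0031ec5ba1e8a16e9f04632d845f9d21afcaa50771c1b47a26999b98c185c0781ffdcb2590b1a3570619f467c69d23fb433a3ca9b3cd60b30ab340b41443f81888f5b03ed21ae509e7d07166e4bb311e1c3c5651b7b9679d3eb1e7299bc1b99a715f00052139e48f03bb58b8200670cf3a7d14997903ce42e2aa0ef99a7d970e6e84fce5a255c00dafce8513e3a7ebc342a9fdf0f8fc770442510f2934d6c764ae7e83b9a0758b5424abcf6bbb206029fa1c3c4f279c339c0281f1eda8bebb35f398fc54301e62c9e1348388465d92745771d1b3a0876f9094dee0a2d56e76b8bf728d9a465f36f7f3b1214699a6590054ab039f0bbdd442f781ecfe56c480b0d8adf1afd9a5697bf5854412d94924648b474fc704f0a00cfc8eb33ae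99cd856e3aa70f5adcb833c96b26c2bf1ae89763139471d42ced8aa001323d279ed2665e96ddcef533256ca7f3932836c0e45512072b88f2cc3a66b20d75460b409fc6d25bd72bda25a049ec190170cb4be750294e4092e95f0daebb6f5c1f64461080f43e5dcb6479f74c94cf468c996108b1d8d1bd6482eedb03b00004ee11c35b31d8d083996e18da2dfc4cfa5f6c5c3ceddd33f88c052b36279fe5cf0df612f82e5179b0324425f5da83612836e32eb46e7cd71866b12c268bb7040274151e7167f65783cb41fcae30f276f2ce7408034e15a24f256ef03b8ef463a29196403834a0b32e4b59772dcddd46504588a0379a7e2f1cbba509c01b331949417706abf604b4352ffe08dfa59f25fd4c442cd4595257a5a4837ad9703b872b174e67cd9dfb4fe078d1cedc0fee4c2759e9795433a2554569263c40e9087894c2e42367049f45848f3b2cf1b3ef035a73aa2f4fe609497504d3c29e52f761c9a9bc4a056603014200c9f0657cbc24b07fc83c315e18087495095581b95ce97b2e5fb9995d12236e78fa84ee435f5e959c8b200e5a7a9bc35e691ff905ac2bf6ea6168c76aad489352c94b8f848bcca119d12a210395623a40c7da9c6dd74b06c04a629e37a4514c1107434d05e44b4ce04f8f0365ba3466261677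95dc33d08b5c173b473337450ce8c2c09c606d5490d5b607251a5ff68f3c5b178597ce1d3cb971fef5215ea2da5946317e939f7af920ce69e0bb0d0e73573dcf4255cc44348dcb41a188481775611321a2ed8f7c125f0e009f5f0b7d97fbfd2d847907c6937fe15c67e4244320f8ea48af6f54454531b205d5857e43c146db91ee2b0f13a80f4e63716f614de84f17016f574bed4e3c2da182f6fb468a0d1ef2a622c72c6a7c153da81c55c31c2fbd2bcfd7073eed930edf2f3d386cb19fb278abd832fe3460612a173a4137da0571aecd2d3fcc40f41868c39b3a9a3f4455129ad7937817bfb4926556554b9e2921232e9c8856f26e41fd18821e09e68cd5677d70f88dd0423e179799cd275942bd53d805a635e67ce315aa68352c458af372234d9c24ab2ad37addad180aad8ca71aac5c21a924d01576b38329c1612c3bfb2a81a02855b7ad9a793057efc618f90ff1ff088c3b3367462b407c12e5e3ed46012500dc2b77c609ff53e63e0929a0e12f6a66674283cc340138486322254b3d253664cc9807631ce42b9376f4f3aabd171e08c4bfb0176b945174c41e3ae40e5de450764f6029076c2f8a46a30fb02b10ad05d74d13a549459bc92ac26b2ba70a2e61c3ecfe986827fd5d8ec86150b643bca95a4ae2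188eb37c3ec5b7c7e964f2073b6e1f5a7b540bd7d8198f71ed2cf20e72dc40a6f12a4a72cc47c312d9b5da429244ceb28d43aa16cc764728695cbbd90d4e4b00127163a71512ab21176d2e264569777cdc30978fa2c9c429725726cca8543e98882bd61340d61003a04a513168b4034e6d4dc0ebea1c582525973d452b2a98ea1d373e46550f401787ee60f758462b7d65339e774642089bb9307c58a5432025b9100984dc3f6728c3106a7c50e29f71da113cd14c31fa02e640508a88566a38814ef4796a6c1138f07ce19d2bfb8f6edeb15455781b6ad02b7384319804f212c57395d0fcd77b738a398f3b5c67dbdff49d441ec5b70e20593e12fa3f386615d05cf142cd5618fe27290c2bb45738a1c8017282c7d3b60635695ce389470fe9159f2e41b169324dbc04b740cd2bda5e50dc7befc7685b0213fb1a4d8cf1560b162189abcdf27e50c9a3a345dc2c3ddacc68dd4302f062550d165c4397216d34dcb3430d8a6da0c2a823226cf9529e40fb1579344f3a0a04b79c982089653c23c910de280396da937948385097d09802c51a25dcc00aa0f28f6635717ebad004b069bc2b34eeaa3ed2126d759e103fe05b21cd6096fabdae8c32120007188b22195bc17f7d77e25997d8076fbaf6d68f581a3bfcf5bf834eb0253c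2ae53b2d10b232ce61170c2e469056fb40d4e6bc2fd37bda8c604b3129a4b3c30bcd02fd43a433f0d03172a62ac656725b420bb6167992a27badd5fc7c983248deb113b237c24e538b3f20e01f0fad172b674bed4e944010499a4edc3cdaa1d0523a3baa2fe5c835546673ec1b021c04c1c7010269d05e65549234ed9cc3f18d2fee8bf5b87a61b723396f5511a9509386467dee01e77d010eb1c61fbeb805cd338d56c130fa6c3837f64cc2bdd0d1265ce9bd213d9a723d74e4879e78eb69f22d943ce6e4b7add7033d454f871a01d2ee92c4ae2d27c9aa876048078ea06c381ad35ee8dce217aaa387557d317a893c266949c610bec91e64d91e45d9f319042d2e515874f6424f2abb0afbd46b917a37d379ef32f13dad5c00794336091f254ae60cde4ca6be6b47f5f694d47f0c7abf817f6410d4de738df33432273b383a25694cd4b2595aceaf4e573f0d57a69cf0060ea6becc09983bc6a021157e42ab263a3cc679fe7688ac252b8b3d2f8d5c0351cae5626757a0c2eec82a562049afc6a942960ebc98e37ebf22fcdd45018cfaa29a7c1f7815b2d203074fd9181c393b4d14616437643b8c5eed55266aa1763e5f22798f482e0044e10329138b6475733b6ad4109fcbd8037169c86910459275b5cd3fe2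c759cef9ad8ce03c5d3223fcb641049b88c4a737931defed275872ce8cff071ca079c50eae640b452253980eabcc88c9d26efdf4de811f3a33ce081a5b1c4c0c17b5d952e5a8189a2f7ead5e852fdd3d48f9434f1f20da93ad453a0c9002594aeb2dbc5ed8454f6211a5022c8f3ee17ada486b51d06372199b274e30cc37325915cb0fbacd305677cf587612067c60e990173ef5fb9cf00afe771050355942f0b8168032bd53e1a76616bf0ad558b7777c9dc781912bedc938ec5a77c8ac67694d614da323b7f90cfb02a84adb0adcadd56ba526ae189ba9c21e4447ee00b707a855ebc96f7e5e05dde7ec0ab8b3b245cc3a3441bb8876423b2c99b83c546a8ca426bb7dd8a4aa20537f92f1f5a0df3e6e6324a9416033d20b1ab753dfb58f8db31ffab07678f7302d48b7aaac26cd1220c6a81b849e180b3f364952d377da465ea5dd8a2f10794945e43f37c7f6f8ca04228290a9d3986b5c14b5f4ad7982a9c668d421350036e9c24d1dfc1677344e38bddd0a047aab911aa48506c102aace54101317ed0d2f4a53d218939e48fd1558b0ff11382c9c1d7731bc4569b7d6275515b9d08548c06208abcb5cc6fcba96c823f22e78f8b577c86a2cb0fb07bd1d1581f01978d2fd34e5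657ca0c1e87206225e02d199359016f2fe3b0a58cebb43460f2d97d96bfe07ff323643a702794d0311743e55851f5367536e37c75fd9618255f156a310d8e964b98b284ee8b6c1365bed44b583206a003504e9e80e61e6338faf535708f37a6d0a3fb90d33db35be7657db005bf1b0392fca13c8e076e0f271198441a90e4faa85008bfc352c45f1838e75c290fa2d2452c84b0a29bf71a5b125456c51babbf0e18b22381d6258462262ee828ba747b77fcaa7552dc4608b7e325bc311ad0ae87f615291eb0f7c239498713574b6a62d06ef1a0e0e827cf35da0d7cc150a0b29ff9bdaf91c9f2ec24e050c242e40505442a3b559dd7a2b4301e4b5d620c2cd61aed6119be702989b708f84a703a706977714e88570bb06401b7d7a53d910d8bf76664dd51db84b1cd8e40da30cab2eb6dfc8108836fbfbd53bf2315de272076c49b1d0b511e0fa8d22ec65954e1d3641129b5d120283229aa9694f0e71e4fae0e3632a44c7f2e5777a14d1e7ca1024b2fa6820eb1fbfee09f2026f156b63295d1abfdf2a8d24748b5eb2b1f155148672150a322b97f6c5f02079b5bf0512065b09a6d91d290da3f6f8e616cbe336e4103888e322630a5b72449ce0e15d70d7ac12be7e79c4f00fd127467a0a27aa55e6cb08d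b082bb9e1950a8652c82746182a52f7826b353e548b349b929962718e60113839f4d44749db7a5a1c8eecda2c2b500f86110bdd14094e0410dede38bb471d674cac77d25a333d84eeba102f0466469624ba6fafb5f34325b415f84703970712b14852634ffb832d3e6455e617ad21f1163154fc1ef5b5db102d0f364854f44b51bb2be47ac90c38cfee42986c91b3bf60ce33eb470bdd072ca467849e350c9a322b60380f3ea9b0839439d7157c44c012dd2bd2ecd36e8fc1b810aa5283101851ed6af478e5e0cb348d2fec00d322a07e86da2d5c7232962a3c216f306495da6d07b0f475cb102f7b5ba59d10c61e493f6a1986d8384f653f58f7fa471e51004b8479a91d191555ba622332eb89cf5739a3f77dcbb2241eb80d56b95e5e0e15e8ed50c1af3195961379b6e7c48e0832025af5982651d186d7431c051172698c2511475f73b75a981a1dc8803e6c73b1e2ff7db58da5f697263389377eec5dbe95536c584bf3bdf19ba63ff7b99bde3d6f89aefb284325a2bb76dd92024e2566700d6f9f1b39c82a6a124ac723e636eae336ae380158e7c5d6c472884b9bcc135da4fb096bb11684771320fb6b47f62071e77557ac1113521c921e3599e26d67d23adf757844eaf4ecba39d3010c5a484e2af7cc277174ae95b60abd5c772934a6fc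654e746421b5041db1b959e44e7e7c0af83573aebe7a1a7b770ee120628f0fd8e0107c6e279334c5469c3b1951c0991f0048e377b7fb3fbef9a89f451c9431c537a93edda1c5953365caff0826140e6821ebe78166ef5d23425773ce18151bdf038e3c53b91c5deb5185c4d739a0fb58bc3d6de067b17dfe5635adbcc8d62e9a4b31324d586c4759f6404a1c76965c2904ef824339bc720d40c589c4691509b4ecf03e4612c251f303fc7298611b5832ecc6431e75a7a70ac6015d0e6e5af358325915dbb5b968b016e3f5903099f073e1682be76eef71aa09d76dd8422a0699659e67de08abc4caa9672737d94ab64b4105b067b10a11678985bef71b94c630279d238742f8699660e83aec76242b8ae1d4d51146cea1be1514183cf81f3b6d7b6e3988c2f540974c7859bc23063c1932526449e5aa638c4bafb45b0e660551926870ff3465b99968f758894c3ca14206827ce332b3717e2c25fff607b1afb0d22806b68ed4570604d351b8152115b820a0c34703b6de4c1c700ee2f9067618575b459e773056efceff8839724856df38057274fcbe0754281ab59856d65e7a395bf88816823aef4e185d9cded6e1146b9a0d8292a750db7752ddef06fb69ef0571317118592b976cfb09385bf47203557a64b8394e985a21376abaf841809d0a241185cfa47226ee9ee3d005a6d5ce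335f05f252941af34550bf8e235255dde75f907e3b49c8c8a1803e961e63ade4217ca4e92c1d418f85ba3c315817b1d6ec401cb834331e9972b39d8a05940a1aaec4b257702ddd308d1c7cc59dd3311d751695ffaee64b93f0d52c146a830ab0cbec6e65bae253567d117a36e987324fb7f1854e002d57cfa472110f61cabeef67eebb5ac128673bbe34825e5135fc1c3948298f67d36566726dd57dcd02072ad1f0d11e33dd3c8d8ab94c13596e11752a498e4d36ca2fb843742c161b78969bb13b305ed6fe29e20e606b3730e94c8b71fc4d9d0580ffc342da22434c23302f690c4554793e0a78b5871fd7257809d043e01f718b492c51728ca51f4c15195376c312a572c7f75c590c26dd387ea0057589e319810f4042551bff26601c4834680853c7903426d32cfb8ca593e916a04a5fc9a62a34fbf717fa21a0106ac9015ed1c3ce329e7ae1e1ab1d710ca86ad050a565a55bda1c1041655aecaa0b0cae785931c3242b455b4e7112fb94345a983d0bece2cfa86fa9e9cef54e1d44b489e7e06c0590ba347d4b2b7b79bb4f492532308a56460019c171ba2384f950c51f20b25a16cfd4006cb55c150906a4994847641d9244af0f982d7785f1d83a120ec5b451446a4ade42a5c82958023a646a01f83a1e00691e1e0579cda0237f8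e981c144f1acdb2b9273ce0691befe11e724bf610a803c77583c3946398b96610b974a06cd2e9c43271ab03753103a279e60b537eaf27f7835a24ee846fa4542aa5a0a3339d3076504e51de0460b3130a3d683d34e540ab3be087398c0b21b6692d12ae5fe077df42fa36147abf33e10d2daedcdc1d531c9182af366e9da5c26f2959d6eea73ee6184e04e1aa4c226d05230220052757ae316444f59c2fb89d6b77884657e3448f3c39a6892382936ec99a7620b36acd60098ac77ecfa35ccdacf815574e82ddf532bc69578043220b4fb7e3dc4a501764b9e7a280170c1667529d2a52f19975287bc21ae6c59b0d7a8eaf663a3460071299b16177aadd786433653cc0217b1f12be43d12169bb724191510f4f07d25d4f5a588fd4cac02d5d096574324963713e14b246f0bc738fa337f9e8b304cb36f6d90e435d778b5548e96b4ee2b45a243911a2467b1c4f52d6f423f8e364b6a63597e300191aec7f3a40c2a94e245c7b23551c5a7d3a046bbb99ee4c09acf23a961d165445b30f19be2c2fe5965925c4d43dc41bacd462435c0b0cf4707e230bf5408a4a0a0dd7df14a98d218779e222b6361b2c156e9820155ed92b356c2b06e2603f61a7a1c3078d355eed7aa7b905b2d0bb73226dddaa7a291a5116723e79770bfe3ec6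a4593a24ab0ef46809590d9ad4200e5b8338703d5971779d32657c6dd62bed6e7b5d1c065f2d35d51ba4057812a5481c2dd05cdff73811893fccbe1b35b7238614da72975efbd9c17c8f74d562427bbb3d4e36d24621591f96e482c13133f8950b0e6e652cf853f10560d6df3a03020443b439ec1789999ed3103d113952b1cc6da29c0a3e235754b602af4249feabd3ba015c626f2594c8406864001e4a3a9b2b9333f26fb941ce2ea319e9b6d8f21e0cae7b79910845fca5450f9f56fddb54e68f127e8272fdda662b40cdc5d450dee00311a15e2b5b7d2ef35274dbfaefa67513ae5dd34326d857d4b87b0aa2c050d26732f3ff657d46311ef7f702d823c07afdd2e562f720f0480876487bab737f58c287aba67f13fa7eddeb0d58f05c2b9a312398b57a4aa22b7783a57a6361e54df54e6c00d4bb58114526f93c05cf9e3bdab47021380073f0d5f0561d5b28be2ef22d039e48c07f4a683141176811f640fbadae6993bd3ad692492720b437b6634f448613f42671d84ff1f452320f4ec43d796ec4d5626725727a14ad944129647ef6060c56bb0bc7f67e094d804c7b40db58cf733d682723330cf54b9140ccb28875af7f652b9935b84cfaa74e2ae335d529843fdfe9cadc2a69cd3816b24550c294b529db2cdc95a491b2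3325024988d67772490521ab4b4ee4f48f4b2bfb3c4c929b3a2b10037a82469c47eb21c85b0266e365261c56c61b23532e0985edbb5735f1d4bf0bd06c34511e210573b014aace91658bb0c8b3a414ce70fde9ac4f259bf72f0444c097332152670d695ca10b2866618dc89f2730a306df265c31da039ae476c41b40ec5c3f9170592cc43b9ab3e00a865e5ad588b0a4769b0027f8070a2f24609b3f200704cd1da9342e37c39d972e5448e764277e6ef9649d3d420f5a8212ca23b0861bc40c653e11b65c81426ab3997b9721be0a14e80963a266fe23ad06141e446d2672534ba8052f421da4dfc5d70d7b03bf4c7523b26edd3b9233032389bad5181617bab48d572881ae52c714d4ffd911ad4882dfabab4f61af65b4cce55d8384d6b47f6d35175a0692648fc0c01a6413c08ba733ca5003320b3f052a945d3962a52467d8a5b60a1022e8922d3335cc55ebca6958ea4b7add4500c15c0f4b4a118f03be263a78721357a1614b07a65ddd9500fadfb86c3b105ab6c52c570c434ed1b9cc280c54b972ee293b424a257b3687e25e565d62ec79e9ebfa235b39f7472539d3d9c3935c4931d2bb14a63f8a03e9e55b1f578f8f093c585c7caac48526afdbfc97c60a8794449e7e121ea77bd1b51f9d92272d5d37d2ef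fe41025f72d85ad32a5a92c795ee9510e81a235fd337e15d8e945b004543623c0148884083a80751058e9095527c9b7752cdde1c6403ab01b85a98f2dbdbdb2ed3fef63b8a46fae11462a94cdbfcf9c3022172278aead810c7390afcb271972dfecd10201ab3327b0f468a730117af741bb2543bf95ad031377bab48acf9d11e0c15b1c8b0017145f8399d7e547de5674a269967f946a4ae9322ab0c58029727ca6f4ce75178e95a82c6c26f9296199056600127af5eca53152f07dc1114f71675b57834bd54ce2bcb6a78fdec39422f4da533d6ff3c6fe6902b9765be12d737bf1891928b77364f580666069f2b89048f127f1d1fed2549b301dc3d2a684f33dd3bbe918240baa4df43bf5c90a699ad5136f8ba49727968042190b03101d5ccf3aaed7adde6b56b9667ecef3552bd43f2fcb9f39b683a627045d74ca524f33bbb40d3caf6a7b5302dc52abca93d79a7983e921394d3995c8630705a7dfb0f0b6d7a58b4bd62d835d3afc36b6e9bbb9dcc3e4fdb00011f6e0bc478550b1aca589de41626d5f76dc3123b5d1640c5a6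
def simdOnes : Nat := onesL 1532
def simdM1 : Nat := Nat.mul simdOnes 0x555555555555
def simdM2 : Nat := Nat.mul simdOnes 0x333333333333
def simdM4 : Nat := Nat.mul simdOnes 0x0f0f0f0f0f0f
def simdH : Nat := Nat.mul simdOnes 0x800000000000
def simdC (lo : Nat) : Nat := Nat.mul simdOnes (Nat.mul 0x010000000000 (Nat.sub 128 lo))
def simdPop (x : Nat) : Nat := swPop simdM1 simdM2 simdM4 x
def simdLo (c : Nat) (x : Nat) : Bool := Nat.beq (Nat.land (Nat.add (simdPop x) c) simdH) simdH
def simdHi (c : Nat) (x : Nat) : Bool := Nat.beq (Nat.land (Nat.add (simdPop x) c) simdH) 0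
def simdRot1 (t : Nat) : Nat :=
  Nat.sub (Nat.add t t) (Nat.mul (Nat.land (Nat.shiftRight t 46) simdOnes) (Nat.sub (Nat.pow 2 47) 1))
theorem simdOnes_def : simdOnes = onesL 1532 := by rw [simdOnes]
attribute [irreducible] simdOnes simdT
noncomputable def simdStep (d : Nat) (F : List Nat → Nat → Bool) : List Nat → Nat → Bool :=
  fun l acc => List.rec true (fun h t ih => and (F (List.drop d t) (Nat.xor acc h)) ih) l
noncomputable def simdGo (chk : Nat → Bool) (d : Nat) (n : Nat) : List Nat → Nat → Bool :=
  Nat.rec (fun _ acc => chk acc) (fun _ F => simdStep d F) n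
noncomputable def simdTab (n : Nat) : Nat → List Nat :=
  Nat.rec (fun _ => []) (fun _ F t => t :: F (simdRot1 t)) n
noncomputable def rotN (n : Nat) (t : Nat) : Nat := Nat.rec t (fun _ x => simdRot1 x) n

noncomputable def chkLo (n : Nat) : Nat → Bool :=
  simdLo (simdC (Nat.sub 13 (Nat.add n (Nat.mod n 2))))
noncomputable def chkHi (n : Nat) : Nat → Bool :=
  simdHi (simdC (Nat.add 36 (Nat.add n (Nat.mod n 2))))
noncomputable def chkB (n : Nat) : Nat → Bool := fun x => and (chkLo n x) (chkHi n x)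

/-- rows of the enumeration -/
noncomputable def simdRow (chk : Nat → Bool) (m d p : Nat) : Bool :=
  simdGo chk (Nat.sub d 1) m (simdTab (Nat.sub (Nat.sub 48 (Nat.mul 2 d)) p) (rotN (Nat.add p d) simdT))
    (Nat.xor (Nat.xor simdT (rotN d simdT)) (rotN p simdT))
/-- rows `p, p+1, ..., p+c-1` -/
noncomputable def simdRows (chk : Nat → Bool) (m d p c : Nat) : Bool :=
  Nat.rec true (fun j ih => and (simdRow chk m d (Nat.add p j)) ih) c

/-- lane decomposition -/
def IsL (N : ℕ) (F : ℕ → ℕ) : Prop := N = pk 48 1532 F ∧ ∀ k < 1532, F k < 2 ^ 47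

theorem lt48 {x : ℕ} (h : x < 2 ^ 47) : x < 2 ^ 48 := by omega

theorem simdMask (c : ℕ) : Nat.mul simdOnes c = pk 48 1532 (fun _ => c) := by
  rw [simdOnes_def]; exact onesL_eq 1532 c

theorem simdM1_eq : simdM1 = pk 48 1532 (fun _ => 0x555555555555) := simdMask _
theorem simdM2_eq : simdM2 = pk 48 1532 (fun _ => 0x333333333333) := simdMask _
theorem simdM4_eq : simdM4 = pk 48 1532 (fun _ => 0x0f0f0f0f0f0f) := simdMask _
theorem simdH_eq : simdH = pk 48 1532 (fun _ => 0x800000000000) := simdMask _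
theorem simdC_eq (lo : ℕ) : simdC lo = pk 48 1532 (fun _ => 0x010000000000 * (128 - lo)) := simdMask _
attribute [irreducible] simdM1 simdM2 simdM4 simdH simdC

theorem IsL.xor {N M : ℕ} {F G : ℕ → ℕ} (hN : IsL N F) (hM : IsL M G) : IsL (Nat.xor N M) (fun k => F k ^^^ G k) := by
  refine ⟨?_, fun k hk => Nat.xor_lt_two_pow (hN.2 k hk) (hM.2 k hk)⟩
  rw [hN.1, hM.1]
  exact pk_xor (by norm_num) (fun k hk => lt48 (hN.2 k hk)) (fun k hk => lt48 (hM.2 k hk))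

theorem IsL.rot {N : ℕ} {F : ℕ → ℕ} (hN : IsL N F) : IsL (simdRot1 N) (fun k => rotF (F k)) := by
  refine ⟨?_, fun k hk => rotF_lt _ (hN.2 k hk)⟩
  show N + N - ((N >>> 46) &&& simdOnes) * (2 ^ 47 - 1) = _
  have h1 : simdOnes = pk 48 1532 (fun _ => 1) := by rw [← simdMask]; exact (Nat.mul_one _).symm
  rw [h1, hN.1, pk_shr_land (by norm_num) (fun k hk => lt48 (hN.2 k hk)) (by norm_num) (by norm_num), pk_add, pk_mul,
    pk_sub]
  · rfl
  · intro k hk; exact rotF_le _ (hN.2 k hk)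

theorem IsL.rotN {N : ℕ} {F : ℕ → ℕ} (hN : IsL N F) (n : ℕ) : IsL (rotN n N) (fun k => rotF^[n] (F k)) := by
  induction n with
  | zero => exact hN
  | succ n ih =>
    have := ih.rot
    simp only [Function.iterate_succ_apply']
    exact this

theorem iter_rotF (x : ℕ) (hx : x < 2 ^ 47) (n : ℕ) :
    rotF^[n] x < 2 ^ 47 ∧ ∀ j : Z47, vecN (rotF^[n] x) j = vecN x (j - n) := by
  induction n with
  | zero => exact ⟨hx, fun j => by simp⟩
  | succ n ih =>
    rw [Function.iterate_succ_apply']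
    refine ⟨rotF_lt _ ih.1, fun j => ?_⟩
    rw [vecN_rotF _ ih.1, ih.2]
    congr 1; push_cast; ring

theorem testBit_simd {N : ℕ} {F : ℕ → ℕ} (hN : IsL N F) (lo : ℕ) (k : ℕ) (hk : k < 1532) :
    (simdPop N + simdC lo).testBit (48 * k + 47) = decide (128 ≤ hammingNorm (vecN (F k)) + (128 - lo)) := by
  have h := testBit_swPop 1532 F (fun k hk => lt48 (hN.2 k hk)) (128 - lo) (by omega) k hk
  rw [← popN_eq _ (hN.2 k hk), ← h, simdPop, simdM1_eq, simdM2_eq, simdM4_eq, ← hN.1, simdC_eq]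

theorem simdLo_spec {N : ℕ} {F : ℕ → ℕ} (hN : IsL N F) {lo : ℕ} (hlo : lo ≤ 128) (h : simdLo (simdC lo) N = true) (k : ℕ)
    (hk : k < 1532) : lo ≤ hammingNorm (vecN (F k)) := by
  have h1 := Nat.eq_of_beq_eq_true h
  have h2 : ((simdPop N + simdC lo) &&& simdH).testBit (48 * k + 47) = true := by
    have h3 : (simdPop N + simdC lo) &&& simdH = simdH := h1
    rw [h3, simdH_eq]
    exact testBit_H _ _ hk
  rw [Nat.testBit_and, testBit_simd hN lo k hk] at h2
  simp at h2
  omega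

theorem simdHi_spec {N : ℕ} {F : ℕ → ℕ} (hN : IsL N F) {hi : ℕ} (hhi : hi ≤ 128) (h : simdHi (simdC hi) N = true) (k : ℕ)
    (hk : k < 1532) : hammingNorm (vecN (F k)) < hi := by
  have h1 := Nat.eq_of_beq_eq_true h
  have h2 : ((simdPop N + simdC hi) &&& simdH).testBit (48 * k + 47) = false := by
    have h3 : (simdPop N + simdC hi) &&& simdH = 0 := h1
    rw [h3]; simp
  have h4 : simdH.testBit (48 * k + 47) = true := by rw [simdH_eq]; exact testBit_H _ _ hk
  rw [Nat.testBit_and, testBit_simd hN hi k hk, h4] at h2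
  simp at h2
  omega

theorem simdTab_eq (len : ℕ) : ∀ p, simdTab len (rotN p simdT) = (List.range' p len).map (fun q => rotN q simdT) := by
  induction len with
  | zero => intro p; rfl
  | succ len ih =>
    intro p
    rw [List.range'_succ, List.map_cons, ← ih (p + 1)]
    rfl

theorem simdGo_spec (chk : ℕ → Bool) (d : ℕ) (n : ℕ) : ∀ (len p acc : ℕ),
    simdGo chk d n ((List.range' p len).map (fun q => rotN q simdT)) acc = true →
    ∀ S : List ℕ, S.length = n → S.Pairwise (fun a b => a + (d + 1) ≤ b) → (∀ x ∈ S, p ≤ x ∧ x < p + len) →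
    chk (S.foldl (fun a x => Nat.xor a (rotN x simdT)) acc) = true := by
  induction n with
  | zero =>
    intro len p acc h S hS _ _
    rw [List.length_eq_zero_iff.1 hS]
    exact h
  | succ n ih =>
    intro len
    induction len with
    | zero =>
      intro p acc h S hS _ hm
      cases S with
      | nil => simp at hS
      | cons x S => have := hm x (by simp); omega
    | succ len ihl =>
      intro p acc h S hS hP hm
      cases S with
      | nil => simp at hS
      | cons x S =>
        rw [List.range'_succ, List.map_cons] at h
        have h' : ((simdGo chk d n (List.drop d ((List.range' (p + 1) len).map (fun q => rotN q simdT)))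
          (Nat.xor acc (rotN p simdT))) && (simdGo chk d (n + 1) ((List.range' (p + 1) len).map (fun q => rotN q simdT)) acc)) = true := h
        rw [Bool.and_eq_true] at h'
        have hx := hm x (by simp)
        rw [List.pairwise_cons] at hP
        by_cases hxp : x = p
        · subst hxp
          rw [List.foldl_cons]
          rw [← List.map_drop, List.drop_range'] at h'
          refine ih (len - d) _ _ h'.1 S (by simpa using hS) hP.2 ?_
          intro y hy
          have h1 := hP.1 y hy
          have h2 := hm y (by simp [hy])
          omega
        · refine ihl (p + 1) acc h'.2 (x :: S) hS (List.pairwise_cons.2 hP) ?_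
          intro y hy
          have h2 := hm y hy
          rcases List.mem_cons.1 hy with rfl | hy'
          · omega
          · have := hP.1 y hy'
            omega

set_option maxRecDepth 100000
theorem rwAll :
    (simdRows (chkB 3) 0 1 2 45 = true ∧ simdRows (chkB 3) 0 2 4 42 = true ∧ simdRows (chkB 3) 0 3 6 39 = true ∧ simdRows (chkB 3) 0 4 8 36 = true ∧ simdRows (chkB 3) 0 5 10 33 = true ∧ simdRows (chkB 3) 0 6 12 30 = true ∧ simdRows (chkB 3) 0 7 14 27 = true ∧ simdRows (chkB 3) 0 8 16 24 = true ∧ simdRows (chkB 3) 0 9 18 21 = true ∧ simdRows (chkB 3) 0 10 20 18 = true ∧ simdRows (chkB 3) 0 11 22 15 = true ∧ simdRows (chkB 3) 0 12 24 12 = true ∧ simdRows (chkB 3) 0 13 26 9 = true ∧ simdRows (chkB 3) 0 14 28 6 = true ∧ simdRows (chkB 3) 0 15 30 3 = true) ∧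
    (simdRows (chkB 4) 1 1 2 45 = true ∧ simdRows (chkB 4) 1 2 4 42 = true ∧ simdRows (chkB 4) 1 3 6 39 = true ∧ simdRows (chkB 4) 1 4 8 36 = true ∧ simdRows (chkB 4) 1 5 10 33 = true ∧ simdRows (chkB 4) 1 6 12 30 = true ∧ simdRows (chkB 4) 1 7 14 27 = true ∧ simdRows (chkB 4) 1 8 16 24 = true ∧ simdRows (chkB 4) 1 9 18 21 = true ∧ simdRows (chkB 4) 1 10 20 18 = true ∧ simdRows (chkB 4) 1 11 22 15 = true ∧ simdRows (chkB 4) 1 12 24 12 = true ∧ simdRows (chkB 4) 1 13 26 9 = true ∧ simdRows (chkB 4) 1 14 28 6 = true ∧ simdRows (chkB 4) 1 15 30 3 = true) ∧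
    (simdRows (chkB 5) 2 1 2 26 = true) ∧
    (simdRows (chkB 5) 2 1 28 19 = true ∧ simdRows (chkB 5) 2 2 4 42 = true ∧ simdRows (chkB 5) 2 3 6 4 = true) ∧
    (simdRows (chkB 5) 2 3 10 35 = true ∧ simdRows (chkB 5) 2 4 8 36 = true ∧ simdRows (chkB 5) 2 5 10 33 = true ∧ simdRows (chkB 5) 2 6 12 30 = true ∧ simdRows (chkB 5) 2 7 14 27 = true ∧ simdRows (chkB 5) 2 8 16 24 = true ∧ simdRows (chkB 5) 2 9 18 21 = true ∧ simdRows (chkB 5) 2 10 20 18 = true ∧ simdRows (chkB 5) 2 11 22 15 = true ∧ simdRows (chkB 5) 2 12 24 12 = true ∧ simdRows (chkB 5) 2 13 26 9 = true ∧ simdRows (chkB 5) 2 14 28 6 = true ∧ simdRows (chkB 5) 2 15 30 3 = true) ∧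
    (simdRows (chkLo 6) 3 1 2 1 = true) ∧
    (simdRows (chkLo 6) 3 1 3 1 = true) ∧
    (simdRows (chkLo 6) 3 1 4 1 = true) ∧
    (simdRows (chkLo 6) 3 1 5 1 = true) ∧
    (simdRows (chkLo 6) 3 1 6 1 = true) ∧
    (simdRows (chkLo 6) 3 1 7 1 = true) ∧
    (simdRows (chkLo 6) 3 1 8 1 = true) ∧
    (simdRows (chkLo 6) 3 1 9 1 = true) ∧
    (simdRows (chkLo 6) 3 1 10 1 = true) ∧
    (simdRows (chkLo 6) 3 1 11 2 = true) ∧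
    (simdRows (chkLo 6) 3 1 13 2 = true) ∧
    (simdRows (chkLo 6) 3 1 15 3 = true) ∧
    (simdRows (chkLo 6) 3 1 18 5 = true) ∧
    (simdRows (chkLo 6) 3 1 23 24 = true) ∧
    (simdRows (chkLo 6) 3 2 4 1 = true) ∧
    (simdRows (chkLo 6) 3 2 5 1 = true) ∧
    (simdRows (chkLo 6) 3 2 6 1 = true) ∧
    (simdRows (chkLo 6) 3 2 7 2 = true) ∧
    (simdRows (chkLo 6) 3 2 9 2 = true) ∧
    (simdRows (chkLo 6) 3 2 11 3 = true) ∧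
    (simdRows (chkLo 6) 3 2 14 5 = true) ∧
    (simdRows (chkLo 6) 3 2 19 27 = true) ∧
    (simdRows (chkLo 6) 3 3 6 2 = true) ∧
    (simdRows (chkLo 6) 3 3 8 3 = true) ∧
    (simdRows (chkLo 6) 3 3 11 6 = true) ∧
    (simdRows (chkLo 6) 3 3 17 28 = true ∧ simdRows (chkLo 6) 3 4 8 2 = true) ∧
    (simdRows (chkLo 6) 3 4 10 34 = true) ∧
    (simdRows (chkLo 6) 3 5 10 33 = true ∧ simdRows (chkLo 6) 3 6 12 30 = true ∧ simdRows (chkLo 6) 3 7 14 27 = true ∧ simdRows (chkLo 6) 3 8 16 24 = true ∧ simdRows (chkLo 6) 3 9 18 21 = true ∧ simdRows (chkLo 6) 3 10 20 18 = true ∧ simdRows (chkLo 6) 3 11 22 15 = true ∧ simdRows (chkLo 6) 3 12 24 12 = true ∧ simdRows (chkLo 6) 3 13 26 9 = true ∧ simdRows (chkLo 6) 3 14 28 6 = true ∧ simdRows (chkLo 6) 3 15 30 3 = true) := by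
  refine ⟨by decide +kernel, ?_⟩
  refine ⟨by decide +kernel, ?_⟩
  refine ⟨by decide +kernel, ?_⟩
  refine ⟨by decide +kernel, ?_⟩
  refine ⟨by decide +kernel, ?_⟩
  refine ⟨by decide +kernel, ?_⟩
  refine ⟨by decide +kernel, ?_⟩
  refine ⟨by decide +kernel, ?_⟩
  refine ⟨by decide +kernel, ?_⟩
  refine ⟨by decide +kernel, ?_⟩
  refine ⟨by decide +kernel, ?_⟩
  refine ⟨by decide +kernel, ?_⟩
  refine ⟨by decide +kernel, ?_⟩
  refine ⟨by decide +kernel, ?_⟩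
  refine ⟨by decide +kernel, ?_⟩
  refine ⟨by decide +kernel, ?_⟩
  refine ⟨by decide +kernel, ?_⟩
  refine ⟨by decide +kernel, ?_⟩
  refine ⟨by decide +kernel, ?_⟩
  refine ⟨by decide +kernel, ?_⟩
  refine ⟨by decide +kernel, ?_⟩
  refine ⟨by decide +kernel, ?_⟩
  refine ⟨by decide +kernel, ?_⟩
  refine ⟨by decide +kernel, ?_⟩
  refine ⟨by decide +kernel, ?_⟩
  refine ⟨by decide +kernel, ?_⟩
  refine ⟨by decide +kernel, ?_⟩
  refine ⟨by decide +kernel, ?_⟩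
  refine ⟨by decide +kernel, ?_⟩
  refine ⟨by decide +kernel, ?_⟩
  refine ⟨by decide +kernel, ?_⟩
  refine ⟨by decide +kernel, ?_⟩
  decide +kernel
theorem rw3_0 : simdRows (chkB 3) 0 1 2 45 = true ∧ simdRows (chkB 3) 0 2 4 42 = true ∧ simdRows (chkB 3) 0 3 6 39 = true ∧ simdRows (chkB 3) 0 4 8 36 = true ∧ simdRows (chkB 3) 0 5 10 33 = true ∧ simdRows (chkB 3) 0 6 12 30 = true ∧ simdRows (chkB 3) 0 7 14 27 = true ∧ simdRows (chkB 3) 0 8 16 24 = true ∧ simdRows (chkB 3) 0 9 18 21 = true ∧ simdRows (chkB 3) 0 10 20 18 = true ∧ simdRows (chkB 3) 0 11 22 15 = true ∧ simdRows (chkB 3) 0 12 24 12 = true ∧ simdRows (chkB 3) 0 13 26 9 = true ∧ simdRows (chkB 3) 0 14 28 6 = true ∧ simdRows (chkB 3) 0 15 30 3 = true := rwAll.1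
theorem rw4_0 : simdRows (chkB 4) 1 1 2 45 = true ∧ simdRows (chkB 4) 1 2 4 42 = true ∧ simdRows (chkB 4) 1 3 6 39 = true ∧ simdRows (chkB 4) 1 4 8 36 = true ∧ simdRows (chkB 4) 1 5 10 33 = true ∧ simdRows (chkB 4) 1 6 12 30 = true ∧ simdRows (chkB 4) 1 7 14 27 = true ∧ simdRows (chkB 4) 1 8 16 24 = true ∧ simdRows (chkB 4) 1 9 18 21 = true ∧ simdRows (chkB 4) 1 10 20 18 = true ∧ simdRows (chkB 4) 1 11 22 15 = true ∧ simdRows (chkB 4) 1 12 24 12 = true ∧ simdRows (chkB 4) 1 13 26 9 = true ∧ simdRows (chkB 4) 1 14 28 6 = true ∧ simdRows (chkB 4) 1 15 30 3 = true := rwAll.2.1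
theorem rw5_0 : simdRows (chkB 5) 2 1 2 26 = true := rwAll.2.2.1
theorem rw5_1 : simdRows (chkB 5) 2 1 28 19 = true ∧ simdRows (chkB 5) 2 2 4 42 = true ∧ simdRows (chkB 5) 2 3 6 4 = true := rwAll.2.2.2.1
theorem rw5_2 : simdRows (chkB 5) 2 3 10 35 = true ∧ simdRows (chkB 5) 2 4 8 36 = true ∧ simdRows (chkB 5) 2 5 10 33 = true ∧ simdRows (chkB 5) 2 6 12 30 = true ∧ simdRows (chkB 5) 2 7 14 27 = true ∧ simdRows (chkB 5) 2 8 16 24 = true ∧ simdRows (chkB 5) 2 9 18 21 = true ∧ simdRows (chkB 5) 2 10 20 18 = true ∧ simdRows (chkB 5) 2 11 22 15 = true ∧ simdRows (chkB 5) 2 12 24 12 = true ∧ simdRows (chkB 5) 2 13 26 9 = true ∧ simdRows (chkB 5) 2 14 28 6 = true ∧ simdRows (chkB 5) 2 15 30 3 = true := rwAll.2.2.2.2.1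
theorem rw6_0 : simdRows (chkLo 6) 3 1 2 1 = true := rwAll.2.2.2.2.2.1
theorem rw6_1 : simdRows (chkLo 6) 3 1 3 1 = true := rwAll.2.2.2.2.2.2.1
theorem rw6_2 : simdRows (chkLo 6) 3 1 4 1 = true := rwAll.2.2.2.2.2.2.2.1
theorem rw6_3 : simdRows (chkLo 6) 3 1 5 1 = true := rwAll.2.2.2.2.2.2.2.2.1
theorem rw6_4 : simdRows (chkLo 6) 3 1 6 1 = true := rwAll.2.2.2.2.2.2.2.2.2.1
theorem rw6_5 : simdRows (chkLo 6) 3 1 7 1 = true := rwAll.2.2.2.2.2.2.2.2.2.2.1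
theorem rw6_6 : simdRows (chkLo 6) 3 1 8 1 = true := rwAll.2.2.2.2.2.2.2.2.2.2.2.1
theorem rw6_7 : simdRows (chkLo 6) 3 1 9 1 = true := rwAll.2.2.2.2.2.2.2.2.2.2.2.2.1
theorem rw6_8 : simdRows (chkLo 6) 3 1 10 1 = true := rwAll.2.2.2.2.2.2.2.2.2.2.2.2.2.1
theorem rw6_9 : simdRows (chkLo 6) 3 1 11 2 = true := rwAll.2.2.2.2.2.2.2.2.2.2.2.2.2.2.1
theorem rw6_10 : simdRows (chkLo 6) 3 1 13 2 = true := rwAll.2.2.2.2.2.2.2.2.2.2.2.2.2.2.2.1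
theorem rw6_11 : simdRows (chkLo 6) 3 1 15 3 = true := rwAll.2.2.2.2.2.2.2.2.2.2.2.2.2.2.2.2.1
theorem rw6_12 : simdRows (chkLo 6) 3 1 18 5 = true := rwAll.2.2.2.2.2.2.2.2.2.2.2.2.2.2.2.2.2.1
theorem rw6_13 : simdRows (chkLo 6) 3 1 23 24 = true := rwAll.2.2.2.2.2.2.2.2.2.2.2.2.2.2.2.2.2.2.1
theorem rw6_14 : simdRows (chkLo 6) 3 2 4 1 = true := rwAll.2.2.2.2.2.2.2.2.2.2.2.2.2.2.2.2.2.2.2.1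
theorem rw6_15 : simdRows (chkLo 6) 3 2 5 1 = true := rwAll.2.2.2.2.2.2.2.2.2.2.2.2.2.2.2.2.2.2.2.2.1
theorem rw6_16 : simdRows (chkLo 6) 3 2 6 1 = true := rwAll.2.2.2.2.2.2.2.2.2.2.2.2.2.2.2.2.2.2.2.2.2.1
theorem rw6_17 : simdRows (chkLo 6) 3 2 7 2 = true := rwAll.2.2.2.2.2.2.2.2.2.2.2.2.2.2.2.2.2.2.2.2.2.2.1
theorem rw6_18 : simdRows (chkLo 6) 3 2 9 2 = true := rwAll.2.2.2.2.2.2.2.2.2.2.2.2.2.2.2.2.2.2.2.2.2.2.2.1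
theorem rw6_19 : simdRows (chkLo 6) 3 2 11 3 = true := rwAll.2.2.2.2.2.2.2.2.2.2.2.2.2.2.2.2.2.2.2.2.2.2.2.2.1
theorem rw6_20 : simdRows (chkLo 6) 3 2 14 5 = true := rwAll.2.2.2.2.2.2.2.2.2.2.2.2.2.2.2.2.2.2.2.2.2.2.2.2.2.1
theorem rw6_21 : simdRows (chkLo 6) 3 2 19 27 = true := rwAll.2.2.2.2.2.2.2.2.2.2.2.2.2.2.2.2.2.2.2.2.2.2.2.2.2.2.1
theorem rw6_22 : simdRows (chkLo 6) 3 3 6 2 = true := rwAll.2.2.2.2.2.2.2.2.2.2.2.2.2.2.2.2.2.2.2.2.2.2.2.2.2.2.2.1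
theorem rw6_23 : simdRows (chkLo 6) 3 3 8 3 = true := rwAll.2.2.2.2.2.2.2.2.2.2.2.2.2.2.2.2.2.2.2.2.2.2.2.2.2.2.2.2.1
theorem rw6_24 : simdRows (chkLo 6) 3 3 11 6 = true := rwAll.2.2.2.2.2.2.2.2.2.2.2.2.2.2.2.2.2.2.2.2.2.2.2.2.2.2.2.2.2.1
theorem rw6_25 : simdRows (chkLo 6) 3 3 17 28 = true ∧ simdRows (chkLo 6) 3 4 8 2 = true := rwAll.2.2.2.2.2.2.2.2.2.2.2.2.2.2.2.2.2.2.2.2.2.2.2.2.2.2.2.2.2.2.1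
theorem rw6_26 : simdRows (chkLo 6) 3 4 10 34 = true := rwAll.2.2.2.2.2.2.2.2.2.2.2.2.2.2.2.2.2.2.2.2.2.2.2.2.2.2.2.2.2.2.2.1
theorem rw6_27 : simdRows (chkLo 6) 3 5 10 33 = true ∧ simdRows (chkLo 6) 3 6 12 30 = true ∧ simdRows (chkLo 6) 3 7 14 27 = true ∧ simdRows (chkLo 6) 3 8 16 24 = true ∧ simdRows (chkLo 6) 3 9 18 21 = true ∧ simdRows (chkLo 6) 3 10 20 18 = true ∧ simdRows (chkLo 6) 3 11 22 15 = true ∧ simdRows (chkLo 6) 3 12 24 12 = true ∧ simdRows (chkLo 6) 3 13 26 9 = true ∧ simdRows (chkLo 6) 3 14 28 6 = true ∧ simdRows (chkLo 6) 3 15 30 3 = true := rwAll.2.2.2.2.2.2.2.2.2.2.2.2.2.2.2.2.2.2.2.2.2.2.2.2.2.2.2.2.2.2.2.2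
noncomputable def simdPairs (c : Nat) : Bool :=
  Nat.rec true (fun j ih => and (chkB 2 (Nat.xor simdT (rotN (Nat.add 1 j) simdT))) ih) c
theorem pairs_ok : simdPairs 46 = true := by decide +kernel
theorem single_ok : chkB 1 simdT = true := by decide +kernel
theorem clean_ok : Nat.ble (Nat.add simdT 1) (Nat.pow 2 73536) = true ∧ Nat.beq (Nat.land simdT simdH) 0 = true := by decide +kernel

theorem simdRows_spec (chk : ℕ → Bool) (m d p c : ℕ) (h : simdRows chk m d p c = true) (q : ℕ) (h1 : p ≤ q) (h2 : q < p + c) :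
    simdRow chk m d q = true := by
  induction c with
  | zero => omega
  | succ c ih =>
    have h' : (simdRow chk m d (p + c) && simdRows chk m d p c) = true := h
    rw [Bool.and_eq_true] at h'
    by_cases hq : q = p + c
    · rw [hq]; exact h'.1
    · exact ih h'.2 (by omega)

theorem simdPairs_spec (c : ℕ) (h : simdPairs c = true) (q : ℕ) (h1 : 1 ≤ q) (h2 : q ≤ c) :
    chkB 2 (Nat.xor simdT (rotN q simdT)) = true := by
  induction c with
  | zero => omega
  | succ c ih =>
    have h' : (chkB 2 (Nat.xor simdT (rotN (1 + c) simdT)) && simdPairs c) = true := h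
    rw [Bool.and_eq_true] at h'
    by_cases hq : q = 1 + c
    · rw [hq]; exact h'.1
    · exact ih h'.2 (by omega)

theorem rows3 (d p : ℕ) (h0 : 1 ≤ d) (h1 : 2 * d ≤ p) (h2 : p + d ≤ 47) : simdRow (chkB 3) 0 d p = true := by
  have hd : d ≤ 15 := by omega
  interval_cases d
  · rcases (by omega : (2 ≤ p ∧ p < 2 + 45)) with ⟨ha, hb⟩
    · exact simdRows_spec _ _ _ _ _ rw3_0.1 p ha hb
  · rcases (by omega : (4 ≤ p ∧ p < 4 + 42)) with ⟨ha, hb⟩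
    · exact simdRows_spec _ _ _ _ _ rw3_0.2.1 p ha hb
  · rcases (by omega : (6 ≤ p ∧ p < 6 + 39)) with ⟨ha, hb⟩
    · exact simdRows_spec _ _ _ _ _ rw3_0.2.2.1 p ha hb
  · rcases (by omega : (8 ≤ p ∧ p < 8 + 36)) with ⟨ha, hb⟩
    · exact simdRows_spec _ _ _ _ _ rw3_0.2.2.2.1 p ha hb
  · rcases (by omega : (10 ≤ p ∧ p < 10 + 33)) with ⟨ha, hb⟩
    · exact simdRows_spec _ _ _ _ _ rw3_0.2.2.2.2.1 p ha hb
  · rcases (by omega : (12 ≤ p ∧ p < 12 + 30)) with ⟨ha, hb⟩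
    · exact simdRows_spec _ _ _ _ _ rw3_0.2.2.2.2.2.1 p ha hb
  · rcases (by omega : (14 ≤ p ∧ p < 14 + 27)) with ⟨ha, hb⟩
    · exact simdRows_spec _ _ _ _ _ rw3_0.2.2.2.2.2.2.1 p ha hb
  · rcases (by omega : (16 ≤ p ∧ p < 16 + 24)) with ⟨ha, hb⟩
    · exact simdRows_spec _ _ _ _ _ rw3_0.2.2.2.2.2.2.2.1 p ha hb
  · rcases (by omega : (18 ≤ p ∧ p < 18 + 21)) with ⟨ha, hb⟩
    · exact simdRows_spec _ _ _ _ _ rw3_0.2.2.2.2.2.2.2.2.1 p ha hb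
  · rcases (by omega : (20 ≤ p ∧ p < 20 + 18)) with ⟨ha, hb⟩
    · exact simdRows_spec _ _ _ _ _ rw3_0.2.2.2.2.2.2.2.2.2.1 p ha hb
  · rcases (by omega : (22 ≤ p ∧ p < 22 + 15)) with ⟨ha, hb⟩
    · exact simdRows_spec _ _ _ _ _ rw3_0.2.2.2.2.2.2.2.2.2.2.1 p ha hb
  · rcases (by omega : (24 ≤ p ∧ p < 24 + 12)) with ⟨ha, hb⟩
    · exact simdRows_spec _ _ _ _ _ rw3_0.2.2.2.2.2.2.2.2.2.2.2.1 p ha hb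
  · rcases (by omega : (26 ≤ p ∧ p < 26 + 9)) with ⟨ha, hb⟩
    · exact simdRows_spec _ _ _ _ _ rw3_0.2.2.2.2.2.2.2.2.2.2.2.2.1 p ha hb
  · rcases (by omega : (28 ≤ p ∧ p < 28 + 6)) with ⟨ha, hb⟩
    · exact simdRows_spec _ _ _ _ _ rw3_0.2.2.2.2.2.2.2.2.2.2.2.2.2.1 p ha hb
  · rcases (by omega : (30 ≤ p ∧ p < 30 + 3)) with ⟨ha, hb⟩
    · exact simdRows_spec _ _ _ _ _ rw3_0.2.2.2.2.2.2.2.2.2.2.2.2.2.2 p ha hb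

theorem rows4 (d p : ℕ) (h0 : 1 ≤ d) (h1 : 2 * d ≤ p) (h2 : p + d ≤ 47) : simdRow (chkB 4) 1 d p = true := by
  have hd : d ≤ 15 := by omega
  interval_cases d
  · rcases (by omega : (2 ≤ p ∧ p < 2 + 45)) with ⟨ha, hb⟩
    · exact simdRows_spec _ _ _ _ _ rw4_0.1 p ha hb
  · rcases (by omega : (4 ≤ p ∧ p < 4 + 42)) with ⟨ha, hb⟩
    · exact simdRows_spec _ _ _ _ _ rw4_0.2.1 p ha hb
  · rcases (by omega : (6 ≤ p ∧ p < 6 + 39)) with ⟨ha, hb⟩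
    · exact simdRows_spec _ _ _ _ _ rw4_0.2.2.1 p ha hb
  · rcases (by omega : (8 ≤ p ∧ p < 8 + 36)) with ⟨ha, hb⟩
    · exact simdRows_spec _ _ _ _ _ rw4_0.2.2.2.1 p ha hb
  · rcases (by omega : (10 ≤ p ∧ p < 10 + 33)) with ⟨ha, hb⟩
    · exact simdRows_spec _ _ _ _ _ rw4_0.2.2.2.2.1 p ha hb
  · rcases (by omega : (12 ≤ p ∧ p < 12 + 30)) with ⟨ha, hb⟩
    · exact simdRows_spec _ _ _ _ _ rw4_0.2.2.2.2.2.1 p ha hb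
  · rcases (by omega : (14 ≤ p ∧ p < 14 + 27)) with ⟨ha, hb⟩
    · exact simdRows_spec _ _ _ _ _ rw4_0.2.2.2.2.2.2.1 p ha hb
  · rcases (by omega : (16 ≤ p ∧ p < 16 + 24)) with ⟨ha, hb⟩
    · exact simdRows_spec _ _ _ _ _ rw4_0.2.2.2.2.2.2.2.1 p ha hb
  · rcases (by omega : (18 ≤ p ∧ p < 18 + 21)) with ⟨ha, hb⟩
    · exact simdRows_spec _ _ _ _ _ rw4_0.2.2.2.2.2.2.2.2.1 p ha hb
  · rcases (by omega : (20 ≤ p ∧ p < 20 + 18)) with ⟨ha, hb⟩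
    · exact simdRows_spec _ _ _ _ _ rw4_0.2.2.2.2.2.2.2.2.2.1 p ha hb
  · rcases (by omega : (22 ≤ p ∧ p < 22 + 15)) with ⟨ha, hb⟩
    · exact simdRows_spec _ _ _ _ _ rw4_0.2.2.2.2.2.2.2.2.2.2.1 p ha hb
  · rcases (by omega : (24 ≤ p ∧ p < 24 + 12)) with ⟨ha, hb⟩
    · exact simdRows_spec _ _ _ _ _ rw4_0.2.2.2.2.2.2.2.2.2.2.2.1 p ha hb
  · rcases (by omega : (26 ≤ p ∧ p < 26 + 9)) with ⟨ha, hb⟩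
    · exact simdRows_spec _ _ _ _ _ rw4_0.2.2.2.2.2.2.2.2.2.2.2.2.1 p ha hb
  · rcases (by omega : (28 ≤ p ∧ p < 28 + 6)) with ⟨ha, hb⟩
    · exact simdRows_spec _ _ _ _ _ rw4_0.2.2.2.2.2.2.2.2.2.2.2.2.2.1 p ha hb
  · rcases (by omega : (30 ≤ p ∧ p < 30 + 3)) with ⟨ha, hb⟩
    · exact simdRows_spec _ _ _ _ _ rw4_0.2.2.2.2.2.2.2.2.2.2.2.2.2.2 p ha hb

theorem rows5 (d p : ℕ) (h0 : 1 ≤ d) (h1 : 2 * d ≤ p) (h2 : p + d ≤ 47) : simdRow (chkB 5) 2 d p = true := by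
  have hd : d ≤ 15 := by omega
  interval_cases d
  · rcases (by omega : (2 ≤ p ∧ p < 2 + 26) ∨ (28 ≤ p ∧ p < 28 + 19)) with ⟨ha, hb⟩ | ⟨ha, hb⟩
    · exact simdRows_spec _ _ _ _ _ rw5_0 p ha hb
    · exact simdRows_spec _ _ _ _ _ rw5_1.1 p ha hb
  · rcases (by omega : (4 ≤ p ∧ p < 4 + 42)) with ⟨ha, hb⟩
    · exact simdRows_spec _ _ _ _ _ rw5_1.2.1 p ha hb
  · rcases (by omega : (6 ≤ p ∧ p < 6 + 4) ∨ (10 ≤ p ∧ p < 10 + 35)) with ⟨ha, hb⟩ | ⟨ha, hb⟩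
    · exact simdRows_spec _ _ _ _ _ rw5_1.2.2 p ha hb
    · exact simdRows_spec _ _ _ _ _ rw5_2.1 p ha hb
  · rcases (by omega : (8 ≤ p ∧ p < 8 + 36)) with ⟨ha, hb⟩
    · exact simdRows_spec _ _ _ _ _ rw5_2.2.1 p ha hb
  · rcases (by omega : (10 ≤ p ∧ p < 10 + 33)) with ⟨ha, hb⟩
    · exact simdRows_spec _ _ _ _ _ rw5_2.2.2.1 p ha hb
  · rcases (by omega : (12 ≤ p ∧ p < 12 + 30)) with ⟨ha, hb⟩
    · exact simdRows_spec _ _ _ _ _ rw5_2.2.2.2.1 p ha hb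
  · rcases (by omega : (14 ≤ p ∧ p < 14 + 27)) with ⟨ha, hb⟩
    · exact simdRows_spec _ _ _ _ _ rw5_2.2.2.2.2.1 p ha hb
  · rcases (by omega : (16 ≤ p ∧ p < 16 + 24)) with ⟨ha, hb⟩
    · exact simdRows_spec _ _ _ _ _ rw5_2.2.2.2.2.2.1 p ha hb
  · rcases (by omega : (18 ≤ p ∧ p < 18 + 21)) with ⟨ha, hb⟩
    · exact simdRows_spec _ _ _ _ _ rw5_2.2.2.2.2.2.2.1 p ha hb
  · rcases (by omega : (20 ≤ p ∧ p < 20 + 18)) with ⟨ha, hb⟩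
    · exact simdRows_spec _ _ _ _ _ rw5_2.2.2.2.2.2.2.2.1 p ha hb
  · rcases (by omega : (22 ≤ p ∧ p < 22 + 15)) with ⟨ha, hb⟩
    · exact simdRows_spec _ _ _ _ _ rw5_2.2.2.2.2.2.2.2.2.1 p ha hb
  · rcases (by omega : (24 ≤ p ∧ p < 24 + 12)) with ⟨ha, hb⟩
    · exact simdRows_spec _ _ _ _ _ rw5_2.2.2.2.2.2.2.2.2.2.1 p ha hb
  · rcases (by omega : (26 ≤ p ∧ p < 26 + 9)) with ⟨ha, hb⟩
    · exact simdRows_spec _ _ _ _ _ rw5_2.2.2.2.2.2.2.2.2.2.2.1 p ha hb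
  · rcases (by omega : (28 ≤ p ∧ p < 28 + 6)) with ⟨ha, hb⟩
    · exact simdRows_spec _ _ _ _ _ rw5_2.2.2.2.2.2.2.2.2.2.2.2.1 p ha hb
  · rcases (by omega : (30 ≤ p ∧ p < 30 + 3)) with ⟨ha, hb⟩
    · exact simdRows_spec _ _ _ _ _ rw5_2.2.2.2.2.2.2.2.2.2.2.2.2 p ha hb

theorem rows6 (d p : ℕ) (h0 : 1 ≤ d) (h1 : 2 * d ≤ p) (h2 : p + d ≤ 47) : simdRow (chkLo 6) 3 d p = true := by
  have hd : d ≤ 15 := by omega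
  interval_cases d
  · rcases (by omega : (2 ≤ p ∧ p < 2 + 1) ∨ (3 ≤ p ∧ p < 3 + 1) ∨ (4 ≤ p ∧ p < 4 + 1) ∨ (5 ≤ p ∧ p < 5 + 1) ∨ (6 ≤ p ∧ p < 6 + 1) ∨ (7 ≤ p ∧ p < 7 + 1) ∨ (8 ≤ p ∧ p < 8 + 1) ∨ (9 ≤ p ∧ p < 9 + 1) ∨ (10 ≤ p ∧ p < 10 + 1) ∨ (11 ≤ p ∧ p < 11 + 2) ∨ (13 ≤ p ∧ p < 13 + 2) ∨ (15 ≤ p ∧ p < 15 + 3) ∨ (18 ≤ p ∧ p < 18 + 5) ∨ (23 ≤ p ∧ p < 23 + 24)) with ⟨ha, hb⟩ | ⟨ha, hb⟩ | ⟨ha, hb⟩ | ⟨ha, hb⟩ | ⟨ha, hb⟩ | ⟨ha, hb⟩ | ⟨ha, hb⟩ | ⟨ha, hb⟩ | ⟨ha, hb⟩ | ⟨ha, hb⟩ | ⟨ha, hb⟩ | ⟨ha, hb⟩ | ⟨ha, hb⟩ | ⟨ha, hb⟩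
    · exact simdRows_spec _ _ _ _ _ rw6_0 p ha hb
    · exact simdRows_spec _ _ _ _ _ rw6_1 p ha hb
    · exact simdRows_spec _ _ _ _ _ rw6_2 p ha hb
    · exact simdRows_spec _ _ _ _ _ rw6_3 p ha hb
    · exact simdRows_spec _ _ _ _ _ rw6_4 p ha hb
    · exact simdRows_spec _ _ _ _ _ rw6_5 p ha hb
    · exact simdRows_spec _ _ _ _ _ rw6_6 p ha hb
    · exact simdRows_spec _ _ _ _ _ rw6_7 p ha hb
    · exact simdRows_spec _ _ _ _ _ rw6_8 p ha hb
    · exact simdRows_spec _ _ _ _ _ rw6_9 p ha hb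
    · exact simdRows_spec _ _ _ _ _ rw6_10 p ha hb
    · exact simdRows_spec _ _ _ _ _ rw6_11 p ha hb
    · exact simdRows_spec _ _ _ _ _ rw6_12 p ha hb
    · exact simdRows_spec _ _ _ _ _ rw6_13 p ha hb
  · rcases (by omega : (4 ≤ p ∧ p < 4 + 1) ∨ (5 ≤ p ∧ p < 5 + 1) ∨ (6 ≤ p ∧ p < 6 + 1) ∨ (7 ≤ p ∧ p < 7 + 2) ∨ (9 ≤ p ∧ p < 9 + 2) ∨ (11 ≤ p ∧ p < 11 + 3) ∨ (14 ≤ p ∧ p < 14 + 5) ∨ (19 ≤ p ∧ p < 19 + 27)) with ⟨ha, hb⟩ | ⟨ha, hb⟩ | ⟨ha, hb⟩ | ⟨ha, hb⟩ | ⟨ha, hb⟩ | ⟨ha, hb⟩ | ⟨ha, hb⟩ | ⟨ha, hb⟩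
    · exact simdRows_spec _ _ _ _ _ rw6_14 p ha hb
    · exact simdRows_spec _ _ _ _ _ rw6_15 p ha hb
    · exact simdRows_spec _ _ _ _ _ rw6_16 p ha hb
    · exact simdRows_spec _ _ _ _ _ rw6_17 p ha hb
    · exact simdRows_spec _ _ _ _ _ rw6_18 p ha hb
    · exact simdRows_spec _ _ _ _ _ rw6_19 p ha hb
    · exact simdRows_spec _ _ _ _ _ rw6_20 p ha hb
    · exact simdRows_spec _ _ _ _ _ rw6_21 p ha hb
  · rcases (by omega : (6 ≤ p ∧ p < 6 + 2) ∨ (8 ≤ p ∧ p < 8 + 3) ∨ (11 ≤ p ∧ p < 11 + 6) ∨ (17 ≤ p ∧ p < 17 + 28)) with ⟨ha, hb⟩ | ⟨ha, hb⟩ | ⟨ha, hb⟩ | ⟨ha, hb⟩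
    · exact simdRows_spec _ _ _ _ _ rw6_22 p ha hb
    · exact simdRows_spec _ _ _ _ _ rw6_23 p ha hb
    · exact simdRows_spec _ _ _ _ _ rw6_24 p ha hb
    · exact simdRows_spec _ _ _ _ _ rw6_25.1 p ha hb
  · rcases (by omega : (8 ≤ p ∧ p < 8 + 2) ∨ (10 ≤ p ∧ p < 10 + 34)) with ⟨ha, hb⟩ | ⟨ha, hb⟩
    · exact simdRows_spec _ _ _ _ _ rw6_25.2 p ha hb
    · exact simdRows_spec _ _ _ _ _ rw6_26 p ha hb
  · rcases (by omega : (10 ≤ p ∧ p < 10 + 33)) with ⟨ha, hb⟩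
    · exact simdRows_spec _ _ _ _ _ rw6_27.1 p ha hb
  · rcases (by omega : (12 ≤ p ∧ p < 12 + 30)) with ⟨ha, hb⟩
    · exact simdRows_spec _ _ _ _ _ rw6_27.2.1 p ha hb
  · rcases (by omega : (14 ≤ p ∧ p < 14 + 27)) with ⟨ha, hb⟩
    · exact simdRows_spec _ _ _ _ _ rw6_27.2.2.1 p ha hb
  · rcases (by omega : (16 ≤ p ∧ p < 16 + 24)) with ⟨ha, hb⟩
    · exact simdRows_spec _ _ _ _ _ rw6_27.2.2.2.1 p ha hb
  · rcases (by omega : (18 ≤ p ∧ p < 18 + 21)) with ⟨ha, hb⟩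
    · exact simdRows_spec _ _ _ _ _ rw6_27.2.2.2.2.1 p ha hb
  · rcases (by omega : (20 ≤ p ∧ p < 20 + 18)) with ⟨ha, hb⟩
    · exact simdRows_spec _ _ _ _ _ rw6_27.2.2.2.2.2.1 p ha hb
  · rcases (by omega : (22 ≤ p ∧ p < 22 + 15)) with ⟨ha, hb⟩
    · exact simdRows_spec _ _ _ _ _ rw6_27.2.2.2.2.2.2.1 p ha hb
  · rcases (by omega : (24 ≤ p ∧ p < 24 + 12)) with ⟨ha, hb⟩
    · exact simdRows_spec _ _ _ _ _ rw6_27.2.2.2.2.2.2.2.1 p ha hb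
  · rcases (by omega : (26 ≤ p ∧ p < 26 + 9)) with ⟨ha, hb⟩
    · exact simdRows_spec _ _ _ _ _ rw6_27.2.2.2.2.2.2.2.2.1 p ha hb
  · rcases (by omega : (28 ≤ p ∧ p < 28 + 6)) with ⟨ha, hb⟩
    · exact simdRows_spec _ _ _ _ _ rw6_27.2.2.2.2.2.2.2.2.2.1 p ha hb
  · rcases (by omega : (30 ≤ p ∧ p < 30 + 3)) with ⟨ha, hb⟩
    · exact simdRows_spec _ _ _ _ _ rw6_27.2.2.2.2.2.2.2.2.2.2 p ha hb

def simdF (k : ℕ) : ℕ := simdT / 2 ^ (48 * k) % 2 ^ 48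
def rG (k : ℕ) : Z47 → F2 := vecN (simdF k)

theorem isL_simdT : IsL simdT simdF := by
  have h1 : simdT < 2 ^ (48 * 1532) := Nat.le_of_ble_eq_true clean_ok.1
  have h2 : simdT = pk 48 1532 simdF := pk_digits 48 1532 simdT h1
  refine ⟨h2, fun k hk => ?_⟩
  have h3 : simdT &&& simdH = 0 := Nat.eq_of_beq_eq_true clean_ok.2
  have h4 : (simdT &&& simdH).testBit (48 * k + 47) = false := by rw [h3]; simp
  have hF : ∀ k, simdF k < 2 ^ 48 := fun k => Nat.mod_lt _ (by norm_num)
  have h5 : simdH.testBit (48 * k + 47) = true := by rw [simdH_eq]; exact testBit_H _ _ hk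
  rw [Nat.testBit_and, h5, Bool.and_true, h2, testBit_pk _ _ _ (fun k _ => hF k) _ _ (by norm_num)] at h4
  simp only [hk, decide_true, Bool.true_and] at h4
  have h6 := hF k
  by_contra h7
  have h8 : simdF k = 2 ^ 47 + (simdF k - 2 ^ 47) := by omega
  rw [h8, Nat.testBit_two_pow_add_eq, Nat.testBit_lt_two_pow (by omega)] at h4
  simp at h4

def Bd (n w : ℕ) : Prop := 13 ≤ n + n % 2 + w ∧ (n ≤ 5 → w ≤ 35 + n + n % 2)

theorem chkLo_spec {N : ℕ} {F : ℕ → ℕ} (hN : IsL N F) (h : chkLo 6 N = true) (k : ℕ) (hk : k < 1532) :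
    Bd 6 (hammingNorm (vecN (F k))) := by
  have := simdLo_spec hN (lo := 7) (by norm_num) h k hk
  exact ⟨by omega, by omega⟩

theorem chkB_spec {N : ℕ} {F : ℕ → ℕ} (hN : IsL N F) (n : ℕ) (hn : n ≤ 5) (h : chkB n N = true) (k : ℕ) (hk : k < 1532) :
    Bd n (hammingNorm (vecN (F k))) := by
  have h' : (chkLo n N && chkHi n N) = true := h
  rw [Bool.and_eq_true] at h'
  have h1 := simdLo_spec hN (lo := 13 - (n + n % 2)) (by omega) h'.1 k hk
  have h2 := simdHi_spec hN (hi := 36 + (n + n % 2)) (by omega) h'.2 k hk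
  exact ⟨by omega, fun _ => by omega⟩

def sumL (k : ℕ) (P : List ℕ) : Z47 → F2 := fun j => (P.map (fun x : ℕ => rG k (j - x))).sum

theorem fold_lane (S : List ℕ) : ∀ (acc : ℕ) (A : ℕ → ℕ), IsL acc A →
    ∃ A', IsL (S.foldl (fun a x => Nat.xor a (rotN x simdT)) acc) A' ∧
      ∀ k < 1532, vecN (A' k) = vecN (A k) + sumL k S := by
  induction S with
  | nil => intro acc A h; exact ⟨A, h, fun k _ => by funext j; simp [sumL]⟩
  | cons x S ih =>
    intro acc A h
    have hx := isL_simdT.rotN x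
    obtain ⟨A', h1, h2⟩ := ih _ _ (h.xor hx)
    refine ⟨A', h1, fun k hk => ?_⟩
    rw [h2 k hk, vecN_xor]
    funext j
    have h3 := (iter_rotF (simdF k) (isL_simdT.2 k hk) x).2 j
    simp only [Pi.add_apply, sumL, List.map_cons, List.sum_cons, h3, rG]
    ring

theorem rotN_zero : rotN 0 simdT = simdT := rfl

theorem start_lane (P : List ℕ) : ∃ A', IsL (P.foldl (fun a x => Nat.xor a (rotN x simdT)) simdT) A' ∧
      ∀ k < 1532, vecN (A' k) = sumL k (0 :: P) := by
  obtain ⟨A', h1, h2⟩ := fold_lane P simdT simdF isL_simdT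
  refine ⟨A', h1, fun k hk => ?_⟩
  rw [h2 k hk]
  funext j
  simp [sumL, rG]

theorem foldl_two {α β : Type} (f : β → α → β) (a : β) (d p : α) (S : List α) :
    (d :: p :: S).foldl f a = S.foldl f (f (f a d) p) := rfl

theorem row_go {chk : ℕ → Bool} {m d p : ℕ} (h0 : 1 ≤ d) (h : simdRow chk m d p = true) (S : List ℕ)
    (hS : S.length = m) (hP : S.Pairwise (fun a b => a + d ≤ b)) (hm : ∀ x ∈ S, p + d ≤ x ∧ x + d ≤ 47) :
    chk ((d :: p :: S).foldl (fun a x => Nat.xor a (rotN x simdT)) simdT) = true := by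
  have h' : simdGo chk (d - 1) m (simdTab (48 - 2 * d - p) (rotN (p + d) simdT))
    (Nat.xor (Nat.xor simdT (rotN d simdT)) (rotN p simdT)) = true := h
  rw [simdTab_eq] at h'
  rw [foldl_two]
  refine simdGo_spec chk (d - 1) m _ _ _ h' S hS ?_ ?_
  · rw [show d - 1 + 1 = d by omega]; exact hP
  · intro x hx
    have := hm x hx
    omega

theorem list_bound (P : List ℕ) (d : ℕ) (h0 : 1 ≤ d) (hd : d ≤ 46) (hlen : 1 ≤ P.length ∧ P.length ≤ 6)
    (hP : P.Pairwise (fun a b => a + d ≤ b)) (hmem : ∀ x ∈ P, x = 0 ∨ x + d ≤ 47) (hz : 0 ∈ P)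
    (hdm : 2 ≤ P.length → d ∈ P) (k : ℕ) (hk : k < 1532) : Bd P.length (hammingNorm (sumL k P)) := by
  match P, hlen, hP, hmem, hz, hdm with
  | [a], hlen, hP, hmem, hz, hdm =>
    obtain rfl : a = 0 := (List.mem_singleton.1 hz).symm
    obtain ⟨A, h1, h2⟩ := start_lane []
    rw [List.foldl_nil] at h1
    have := chkB_spec h1 1 (by norm_num) single_ok k hk
    rw [h2 k hk] at this
    exact this
  | a :: b :: R, hlen, hP, hmem, hz, hdm =>
    have hP1 := List.pairwise_cons.1 hP
    have hP2 := List.pairwise_cons.1 hP1.2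
    obtain rfl : a = 0 := by
      rcases List.mem_cons.1 hz with h | h
      · exact h.symm
      · have := hP1.1 0 h; omega
    have hb0 := hP1.1 b (by simp)
    obtain rfl : b = d := by
      rcases List.mem_cons.1 (hdm (by simp)) with h | h
      · omega
      · rcases List.mem_cons.1 h with h | h
        · exact h.symm
        · have := hP2.1 d h; omega
    match R, hlen, hP2 with
    | [], hlen, hP2 =>
      obtain ⟨A, h1, h2⟩ := start_lane [b]
      rw [List.foldl_cons, List.foldl_nil] at h1
      have := chkB_spec h1 2 (by norm_num) (simdPairs_spec 46 pairs_ok b (by omega) (by omega)) k hk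
      rw [h2 k hk] at this
      exact this
    | p :: S, hlen, hP2 =>
      have hP3 := List.pairwise_cons.1 hP2.2
      have hpb := hP2.1 p (by simp)
      have hp47 := hmem p (by simp)
      have hS : ∀ x ∈ S, p + b ≤ x ∧ x + b ≤ 47 := by
        intro x hx
        have h1 := hP3.1 x hx
        have h2 := hmem x (by simp [hx])
        omega
      obtain ⟨A, h1, h2⟩ := start_lane (b :: p :: S)
      have hl : S.length ≤ 3 := by have := hlen.2; simp at this; omega
      have hlS : (0 :: b :: p :: S).length = S.length + 3 := by simp
      rw [hlS, ← h2 k hk]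
      generalize hn : S.length = n at hl
      interval_cases n
      · exact chkB_spec h1 3 (by norm_num) (row_go h0 (rows3 b p h0 (by omega) (by omega)) S hn hP3.2 hS) k hk
      · exact chkB_spec h1 4 (by norm_num) (row_go h0 (rows4 b p h0 (by omega) (by omega)) S hn hP3.2 hS) k hk
      · exact chkB_spec h1 5 (by norm_num) (row_go h0 (rows5 b p h0 (by omega) (by omega)) S hn hP3.2 hS) k hk
      · exact chkLo_spec h1 (row_go h0 (rows6 b p h0 (by omega) (by omega)) S hn hP3.2 hS) k hk

theorem hn_equiv {ι κ : Type*} [Fintype ι] [Fintype κ] (e : ι ≃ κ) (f : κ → F2) :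
    hammingNorm (fun i => f (e i)) = hammingNorm f := by
  unfold hammingNorm
  rw [Finset.card_filter, Finset.card_filter]
  exact Equiv.sum_comp e (fun j => if f j ≠ 0 then 1 else 0)

theorem f2_cases (a : F2) : a = 0 ∨ a = 1 := by revert a; decide

theorem conv_sumL (k : ℕ) (u : Z47 → F2) (P : List ℕ) (hnd : P.Nodup)
    (hP : ∀ x : ℕ, x ∈ P ↔ x < 47 ∧ u (x : Z47) ≠ 0) : conv (rG k) u = sumL k P := by
  funext j
  unfold conv sumL
  rw [← List.sum_toFinset _ hnd]
  have h1 : ∑ i : Z47, rG k (j - i) * u i = ∑ i ∈ Finset.univ.filter (fun i : Z47 => u i ≠ 0), rG k (j - i) := by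
    rw [Finset.sum_filter]
    refine Finset.sum_congr rfl fun i _ => ?_
    rcases f2_cases (u i) with h | h <;> simp [h]
  rw [h1]
  refine Finset.sum_bij' (fun i _ => i.val) (fun x _ => (x : Z47)) ?_ ?_ ?_ ?_ ?_
  · intro i hi
    simp only [Finset.mem_filter, Finset.mem_univ, true_and] at hi
    rw [List.mem_toFinset, hP]
    exact ⟨ZMod.val_lt i, by simpa using hi⟩
  · intro x hx
    rw [List.mem_toFinset, hP] at hx
    simpa using hx.2
  · intro i _; simp
  · intro x hx
    rw [List.mem_toFinset, hP] at hx
    exact ZMod.val_natCast_of_lt hx.1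
  · intro i _; simp

theorem canon_bound (u : Z47 → F2) (d : ℕ) (h0 : 1 ≤ d) (hd : d ≤ 46) (hu0 : u 0 ≠ 0)
    (hdm : 2 ≤ hammingNorm u → u (d : Z47) ≠ 0)
    (hmin : ∀ x y : Z47, u x ≠ 0 → u y ≠ 0 → x ≠ y → d ≤ (y - x).val)
    (h1 : 1 ≤ hammingNorm u) (h6 : hammingNorm u ≤ 6) (k : ℕ) (hk : k < 1532) :
    Bd (hammingNorm u) (hammingNorm (conv (rG k) u)) := by
  classical
  set V : Finset ℕ := (Finset.range 47).filter (fun x : ℕ => u (x : Z47) ≠ 0) with hV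
  have hcard : V.card = hammingNorm u := by
    unfold hammingNorm
    rw [hV]
    refine Finset.card_bij' (fun x _ => (x : Z47)) (fun i _ => i.val) ?_ ?_ ?_ ?_
    · intro x hx; simp only [Finset.mem_filter] at hx; simpa using hx.2
    · intro i hi
      simp only [Finset.mem_filter, Finset.mem_univ, true_and] at hi
      simp only [Finset.mem_filter, Finset.mem_range]
      exact ⟨ZMod.val_lt i, by simpa using hi⟩
    · intro x hx; simp only [Finset.mem_filter, Finset.mem_range] at hx; exact ZMod.val_natCast_of_lt hx.1
    · intro i _; simp
  set P := V.sort (· ≤ ·) with hPdef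
  have hlen : P.length = hammingNorm u := by rw [hPdef, Finset.length_sort, hcard]
  have hmem : ∀ x : ℕ, x ∈ P ↔ x < 47 ∧ u (x : Z47) ≠ 0 := by
    intro x; rw [hPdef, Finset.mem_sort, hV, Finset.mem_filter, Finset.mem_range]
  have hnd : P.Nodup := Finset.sort_nodup _ _
  have hcast : ∀ x y : ℕ, x < y → y < 47 → ((y : Z47) - (x : Z47)).val = y - x ∧ ((x : Z47) - (y : Z47)).val = 47 - (y - x) := by
    intro x y hxy hy
    constructor
    · rw [← Nat.cast_sub hxy.le, ZMod.val_natCast_of_lt (by omega)]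
    · have : (x : Z47) - (y : Z47) = ((47 - (y - x) : ℕ) : Z47) := by
        rw [Nat.cast_sub (by omega), Nat.cast_sub hxy.le]
        rw [show ((47 : ℕ) : Z47) = 0 by decide]; ring
      rw [this, ZMod.val_natCast_of_lt (by omega)]
  have hne : ∀ x y : ℕ, x < y → y < 47 → (x : Z47) ≠ (y : Z47) := by
    intro x y hxy hy h
    have := (hcast x y hxy hy).1
    rw [h] at this; simp at this; omega
  rw [conv_sumL k u P hnd hmem, ← hlen]
  apply list_bound P d h0 hd (by omega)
  · have hs : P.Pairwise (· < ·) := Finset.sortedLT_sort V |>.pairwise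
    refine hs.imp_of_mem ?_
    intro a b ha hb hab
    rw [hmem] at ha hb
    have := hmin _ _ ha.2 hb.2 (hne a b hab hb.1)
    rw [(hcast a b hab hb.1).1] at this
    omega
  · intro x hx
    rw [hmem] at hx
    rcases Nat.eq_zero_or_pos x with h | h
    · exact Or.inl h
    · right
      have := hmin _ _ hx.2 (by simpa using hu0 : u ((0 : ℕ) : Z47) ≠ 0) (hne 0 x h hx.1).symm
      rw [(hcast 0 x h hx.1).2] at this
      omega
  · rw [hmem]; exact ⟨by norm_num, by simpa using hu0⟩
  · intro h2
    rw [hmem]; exact ⟨by omega, hdm (by omega)⟩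
  · exact hk

theorem simd_main (k : ℕ) (hk : k < 1532) (u : Z47 → F2) (h1 : 1 ≤ hammingNorm u) (h6 : hammingNorm u ≤ 6) :
    Bd (hammingNorm u) (hammingNorm (conv (rG k) u)) := by
  have hshift : ∀ a : Z47, Bd (hammingNorm (fun j => u (j + a))) (hammingNorm (conv (rG k) (fun j => u (j + a)))) →
      Bd (hammingNorm u) (hammingNorm (conv (rG k) u)) := by
    intro a h
    have e1 : hammingNorm (fun j => u (j + a)) = hammingNorm u := hn_equiv (Equiv.addRight a) u
    have e2 : conv (rG k) (fun j => u (j + a)) = fun j => conv (rG k) u (j + a) := by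
      funext j
      unfold conv
      rw [← Equiv.sum_comp (Equiv.addRight a) (fun i => rG k (j + a - i) * u i)]
      refine Finset.sum_congr rfl fun i _ => ?_
      simp only [Equiv.coe_addRight, add_sub_add_right_eq_sub]
    have e3 : hammingNorm (fun j => conv (rG k) u (j + a)) = hammingNorm (conv (rG k) u) :=
      hn_equiv (Equiv.addRight a) _
    rwa [e1, e2, e3] at h
  have e1 : ∀ a, hammingNorm (fun j => u (j + a)) = hammingNorm u := fun a => hn_equiv (Equiv.addRight a) u
  set s : Finset Z47 := Finset.univ.filter (fun i => u i ≠ 0) with hs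
  have hsc : s.card = hammingNorm u := rfl
  by_cases h2 : 2 ≤ hammingNorm u
  · have hne : s.offDiag.Nonempty := by
      obtain ⟨a, ha, b, hb, hab⟩ := Finset.one_lt_card.1 (by omega : 1 < s.card)
      exact ⟨(a, b), Finset.mem_offDiag.2 ⟨ha, hb, hab⟩⟩
    obtain ⟨⟨a, b⟩, hab, hmin⟩ := Finset.exists_min_image s.offDiag (fun q => (q.2 - q.1).val) hne
    rw [Finset.mem_offDiag] at hab
    simp only [hs, Finset.mem_filter, Finset.mem_univ, true_and] at hab
    apply hshift a
    apply canon_bound _ (b - a).val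
    · rcases Nat.eq_zero_or_pos (b - a).val with h | h
      · rw [ZMod.val_eq_zero, sub_eq_zero] at h; exact absurd h.symm hab.2.2
      · exact h
    · have := ZMod.val_lt (b - a); omega
    · simpa using hab.1
    · intro _; simpa using hab.2.1
    · intro x y hx hy hxy
      have := hmin (x + a, y + a) (by
        rw [Finset.mem_offDiag]
        simp only [hs, Finset.mem_filter, Finset.mem_univ, true_and]
        exact ⟨hx, hy, by simpa using hxy⟩)
      simpa using this
    · rw [e1]; exact h1
    · rw [e1]; exact h6
    · exact hk
  · obtain ⟨a, ha⟩ := Finset.card_pos.1 (by omega : 0 < s.card)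
    simp only [hs, Finset.mem_filter, Finset.mem_univ, true_and] at ha
    apply hshift a
    apply canon_bound _ 1 (by norm_num) (by norm_num)
    · simpa using ha
    · intro h; rw [e1] at h; omega
    · intro x y _ _ hxy
      rcases Nat.eq_zero_or_pos (y - x).val with h | h
      · rw [ZMod.val_eq_zero, sub_eq_zero] at h; exact absurd h.symm hxy
      · exact h
    · rw [e1]; exact h1
    · rw [e1]; exact h6
    · exact hk

def spM : ℕ := onesL 47
def spPn (n : ℕ) : ℕ := Nat.sub (Nat.pow 2 n) 1
def spP : ℕ := spPn 2256
def spD : ℕ := Nat.sub (Nat.pow 2 48) 1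
def spQ : ℕ := Nat.sub (Nat.pow 2 47) 1
theorem spM_eq : spM = pk 48 47 (fun _ => 1) := by
  have := onesL_eq 47 1
  rwa [mul_one] at this
theorem sub_pow_eq (n : ℕ) : spPn n = 2 ^ n - 1 := rfl
attribute [irreducible] spPn
theorem pow_modEq (n : ℕ) : 2 ^ n ≡ 1 [MOD 2 ^ n - 1] :=
  ((Nat.modEq_iff_dvd' (Nat.one_le_two_pow)).2 (dvd_refl _)).symm
theorem spP_eq : spP = 2 ^ 2256 - 1 := by unfold spP; exact sub_pow_eq 2256
theorem spD_eq : spD = 2 ^ 48 - 1 := by rw [spD]; rfl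
theorem spQ_eq : spQ = 2 ^ 47 - 1 := by rw [spQ]; rfl
attribute [irreducible] spM spP spD spQ

def vS (s : ℕ) : Z47 → F2 := fun j => if s.testBit (48 * j.val) then 1 else 0
def convS (a b : ℕ) : ℕ := Nat.land (Nat.mod (Nat.mul a b) spP) spM
def bS (s : ℕ) (j : Z47) : ℕ := bitN s (48 * j.val)
def spr (f : Z47 → ℕ) : ℕ := ∑ j : Z47, f j * 2 ^ (48 * j.val)
def OkS (s : ℕ) : Prop := s = spr (bS s)

theorem vS_cast (s : ℕ) (j : Z47) : vS s j = ((bS s j : ℕ) : F2) := by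
  unfold vS bS bitN; split <;> simp

theorem spr_pk (f : ℕ → ℕ) : spr (fun j => f j.val) = pk 48 47 f := by
  unfold pk spr
  rw [Finset.sum_range]; rfl

theorem spr_pk' (f : Z47 → ℕ) : spr f = pk 48 47 (fun k => f (k : Z47)) := by
  rw [← spr_pk]
  congr 1; funext j; simp

theorem testBit_spr (f : Z47 → ℕ) (hf : ∀ j, f j < 2 ^ 48) (j : Z47) (i : ℕ) (hi : i < 48) :
    (spr f).testBit (48 * j.val + i) = (f j).testBit i := by
  rw [spr_pk', testBit_pk _ _ _ (fun k _ => hf _) _ _ hi]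
  simp [ZMod.val_lt j]

theorem okS_land (x : ℕ) : OkS (Nat.land x spM) := by
  unfold OkS
  rw [show spr (bS (Nat.land x spM)) = spr (fun j => bitN (Nat.land x spM) (48 * j.val)) from rfl]
  rw [spr_pk (fun k => bitN (Nat.land x spM) (48 * k))]
  apply pk_ext (by norm_num)
  · intro k _
    have := bitN_le (Nat.land x spM) (48 * k); omega
  · intro k j hj
    have e : ∀ i, (Nat.land x spM).testBit i = (x.testBit i && spM.testBit i) := fun i => Nat.testBit_and x spM i
    rw [e, spM_eq, testBit_pk _ _ _ (fun _ _ => by norm_num) _ _ hj]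
    unfold bitN
    have := testBit_pk 48 47 (fun _ => 1) (fun _ _ => by norm_num) k 0 (by norm_num)
    rw [add_zero] at this
    by_cases hk : k < 47
    · rcases Nat.eq_zero_or_pos j with rfl | hj0
      · rw [← spM_eq] at this ⊢
        rw [e, this]
        simp only [hk, decide_true, Bool.true_and]
        cases x.testBit (48 * k) <;> simp_all
      · obtain ⟨j, rfl⟩ : ∃ i, j = i + 1 := ⟨j - 1, by omega⟩
        simp only [Nat.testBit_succ]
        split <;> simp
    · simp [hk]

theorem spr_modEq (f g : Z47 → ℕ) :
    spr f * spr g ≡ spr (fun k => ∑ j, f (k - j) * g j) [MOD spP] := by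
  have h1 : 2 ^ 2256 ≡ 1 [MOD spP] := by
    rw [spP_eq]
    exact pow_modEq 2256
  have h2 : ∀ i j : Z47, 2 ^ (48 * i.val) * 2 ^ (48 * j.val) ≡ 2 ^ (48 * (i + j).val) [MOD spP] := by
    intro i j
    rw [ZMod.val_add, ← pow_add, ← mul_add]
    have : 48 * (i.val + j.val) = 48 * ((i.val + j.val) % 47) + 2256 * ((i.val + j.val) / 47) := by omega
    conv_lhs => rw [this, pow_add, pow_mul 2 2256]
    have := (h1.pow ((i.val + j.val) / 47)).mul_left (2 ^ (48 * ((i.val + j.val) % 47)))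
    rwa [one_pow, mul_one] at this
  have h3 : spr (fun k => ∑ j, f (k - j) * g j) = ∑ i : Z47, ∑ j : Z47, f i * g j * 2 ^ (48 * (i + j).val) := by
    unfold spr
    simp only [Finset.sum_mul]
    rw [Finset.sum_comm]
    conv_rhs => rw [Finset.sum_comm]
    refine Finset.sum_congr rfl fun j _ => ?_
    rw [← Equiv.sum_comp (Equiv.addRight j)]
    simp
  rw [h3]
  unfold spr
  rw [Finset.sum_mul_sum]
  refine Nat.ModEq.sum fun i _ => Nat.ModEq.sum fun j _ => ?_
  have := (h2 i j).mul_left (f i * g j)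
  calc _ = f i * g j * (2 ^ (48 * i.val) * 2 ^ (48 * j.val)) := by ring
    _ ≡ _ [MOD spP] := this

theorem bS_le (s : ℕ) (j : Z47) : bS s j ≤ 1 := bitN_le _ _

theorem spr_lt (f : Z47 → ℕ) (hf : ∀ j, f j < 2 ^ 48 - 1) : spr f < spP := by
  have h : spP = spr (fun _ => 2 ^ 48 - 1) := by
    have e := onesL_eq 47 (2 ^ 48 - 1)
    rw [spr_pk' (fun _ => 2 ^ 48 - 1), ← e, spP_eq]
    have e2 := onesL_eq 47 1
    rw [onesL]
    decide +kernel
  rw [h]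
  unfold spr
  refine Finset.sum_lt_sum_of_nonempty Finset.univ_nonempty fun j _ => ?_
  exact Nat.mul_lt_mul_of_pos_right (hf j) (by positivity)

theorem vS_convS {a b : ℕ} (ha : OkS a) (hb : OkS b) : vS (convS a b) = conv (vS a) (vS b) := by
  have hd : ∀ k, (∑ j, bS a (k - j) * bS b j) ≤ 47 := by
    intro k
    calc (∑ j : Z47, bS a (k - j) * bS b j) ≤ ∑ j : Z47, 1 := Finset.sum_le_sum fun j _ =>
          Nat.mul_le_mul (bS_le a (k - j)) (bS_le b j)
      _ = 47 := by simp
  have h1 : a * b % spP = spr (fun k => ∑ j, bS a (k - j) * bS b j) := by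
    conv_lhs => rw [ha, hb]
    have h := spr_modEq (bS a) (bS b)
    unfold Nat.ModEq at h
    rw [h, Nat.mod_eq_of_lt]
    exact spr_lt _ fun k => by have := hd k; omega
  funext k
  have h2 : (convS a b).testBit (48 * k.val) = (∑ j, bS a (k - j) * bS b j).testBit 0 := by
    have e : (convS a b).testBit (48 * k.val) = ((a * b % spP).testBit (48 * k.val) && spM.testBit (48 * k.val)) :=
      Nat.testBit_and _ _ _
    have := testBit_pk 48 47 (fun _ => 1) (fun _ _ => by norm_num) k.val 0 (by norm_num)
    rw [add_zero] at this
    rw [e, h1, spM_eq, this]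
    have := testBit_spr (fun k => ∑ j, bS a (k - j) * bS b j) (fun k => by have := hd k; omega) k 0 (by norm_num)
    rw [add_zero] at this
    rw [this]
    simp [ZMod.val_lt k]
  unfold vS conv
  rw [h2, Nat.testBit_zero]
  have h3 : (∑ j, (fun j => if a.testBit (48 * j.val) then (1 : F2) else 0) (k - j) * (fun j => if b.testBit (48 * j.val) then (1 : F2) else 0) j)
      = ((∑ j, bS a (k - j) * bS b j : ℕ) : F2) := by
    push_cast
    refine Finset.sum_congr rfl fun j _ => ?_
    rw [← vS_cast, ← vS_cast]; rfl
  refine Eq.trans ?_ h3.symm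
  generalize (∑ j, bS a (k - j) * bS b j) = n
  rcases Nat.mod_two_eq_zero_or_one n with h | h
  · simp only [h]
    have : ((n : ℕ) : F2) = 0 := (ZMod.natCast_eq_zero_iff n 2).2 (Nat.dvd_of_mod_eq_zero h)
    rw [this]; simp
  · have : ((n : ℕ) : F2) = 1 := by
      have h4 := ZMod.natCast_mod n 2
      rw [h] at h4; rw [← h4]; simp
    rw [this]; simp [h]

theorem pop_spD {s : ℕ} (hs : OkS s) : Nat.mod s spD = hammingNorm (vS s) := by
  have h0 : (hammingNorm (vS s)) = ∑ j, bS s j := by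
    unfold hammingNorm
    rw [Finset.card_filter]
    refine Finset.sum_congr rfl fun j _ => ?_
    unfold vS bS bitN
    cases s.testBit (48 * j.val) <;> simp
  have h1 : s ≡ ∑ j, bS s j [MOD spD] := by
    conv_lhs => rw [hs]
    unfold spr
    refine Nat.ModEq.sum fun j _ => ?_
    have h2 : 2 ^ 48 ≡ 1 [MOD spD] := by rw [spD_eq]; decide +kernel
    rw [pow_mul]
    have := (h2.pow j.val).mul_left (bS s j)
    rwa [one_pow, mul_one] at this
  have h3 : ∑ j, bS s j ≤ 47 := by
    calc (∑ j : Z47, bS s j) ≤ ∑ j : Z47, 1 := Finset.sum_le_sum fun j _ => bS_le s j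
      _ = 47 := by simp
  show s % spD = _
  rw [h0, h1, Nat.mod_eq_of_lt]
  rw [spD_eq]; omega

theorem vecN_of_mod {s t : ℕ} (hs : OkS s) (hw : hammingNorm (vS s) < 47) (h : Nat.mod s spQ = t) : vecN t = vS s := by
  have h1 : s ≡ pk 1 47 (fun k => bitN s (48 * k)) [MOD spQ] := by
    conv_lhs => rw [hs]
    rw [show spr (bS s) = spr (fun j => bitN s (48 * j.val)) from rfl, spr_pk (fun k => bitN s (48 * k))]
    unfold pk
    refine Nat.ModEq.sum fun j _ => ?_
    have h2 : 2 ^ 48 ≡ 2 ^ 1 [MOD spQ] := by rw [spQ_eq]; decide +kernel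
    rw [pow_mul, pow_mul 2 1]
    exact (h2.pow j).mul_left _
  have h2 : pk 1 47 (fun k => bitN s (48 * k)) < spQ := by
    have h3 : spQ = pk 1 47 (fun _ => 1) := by
      rw [spQ_eq]; decide +kernel
    rw [h3]
    unfold pk
    have : ∃ j, vS s j = 0 := by
      by_contra hc
      push Not at hc
      have : hammingNorm (vS s) = 47 := by
        unfold hammingNorm
        rw [Finset.filter_true_of_mem (fun i _ => hc i)]; simp
      omega
    obtain ⟨j, hj⟩ := this
    have hb : bitN s (48 * j.val) = 0 := by
      unfold vS at hj; unfold bitN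
      cases h5 : s.testBit (48 * j.val) <;> simp_all
    refine Finset.sum_lt_sum (fun k _ => Nat.mul_le_mul_right _ (bitN_le _ _)) ⟨j.val, Finset.mem_range.2 (ZMod.val_lt j), ?_⟩
    show bitN s (48 * j.val) * _ < 1 * _
    rw [hb]; simp
  have h3 : t = pk 1 47 (fun k => bitN s (48 * k)) := by
    rw [← h]
    show s % spQ = _
    rw [h1, Nat.mod_eq_of_lt h2]
  funext j
  unfold vecN vS
  rw [h3]
  have := testBit_pk 1 47 (fun k => bitN s (48 * k)) (fun k _ => by have := bitN_le s (48 * k); omega) j.val 0 (by norm_num)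
  rw [add_zero, one_mul] at this
  rw [this]
  unfold bitN
  cases s.testBit (48 * j.val) <;> simp [ZMod.val_lt j]

def seqS0 : ℕ := 0x1000000000000000000000000000000000000000000000001000000000001000000000001000000000001000000000000000000000001000000000001000000000000000000000001000000000000000000000000000000000000000000000000000000000001000000000001000000000000000000000000000000000001000000000001000000000001000000000000000000000000000000000000000000000001000000000001000000000000000000000001000000000001000000000000000000000001000000000000000000000001000000000000000000000000000000000001000000000001000000000001
def seqW : ℕ := 0xafbefbcc2768b1822970a081296573426f615202efbefbc6afbef74a255d43822590f081afbef64c2fbeb7c3afbc30811e5d1302266d3301248491026f44d101efbef7cd2a68b2412d81c541235532c12ca9c3c1afbefa81185cc1812da4e081afbefbca2b793381efbefa436f95f4c2afbefbc5afbef74eafbde5412a9d5081257594832270d1012154b1c12fbef50a2ca67801295d01826fbefbd56fa23181afbefa826fbd83c56f911341afbcc2816fa223852268710128918181afbce181243cb081afbe32821b5c7101afbd01422ca5d582efbef80b6fa4f2c1afbef7416f4d12822379c4016f38a181227932c32554f2c32ca5d181afbcc10128960101afbef802afbe75c22a5d02816f81a0812c7153c2afbef2852fbd8344217d52c2afbe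fbd1afbef8062fbefbc32caa01012785d5022ba1a402afbef889afbcb081afbe7181203c9101afbefbceafbdc3c1288cd244269101c1afbdc441afbef7cbafbdb0c11c69850124592283258971421b58b201afbe21c1afbeb101af8cc1016fbef68c1d715181efbefbd7afbe0141237dc5812d709201afbed4c16fb64601afbef74a2fbeb982288d40812d64f081afbef74b6f960243216d63832d8d32816fa635412381e5412fbe26062a3c9142afbef5481b5871812c8561c1afbd9285254cf1411e64d241afbdc141afbef7c1afbef78b2c50c1c1afbef1812b911182237931412254a142afbdb381afbd64812960d1011e64a0812481d6026fa58541266d8581afbef50422696081afbef90a1b5933012971a202258d608126588181afbefbceefbefbd26fbef7c72764c2811e389182afbe93412574b1822360a1c36f5510812c6d6341afbe0141afbe94832a9994826fbef647afbefbccafbe82c1efbefbc2afbefbc527797242294c71011c44308128988101afbdc242efbefbcc226911c2efbef3442dac70c16f48e203215cf182afbe1285afbef941afbe0641efbef6082da611016f4c9141afbd65026f7591c2afbef9c4afbd8301afbe7701afbef6cd233851012388c081afbef6482a64d2412254c2816f6973c2afbefa412a81e3011e4c40812fbd8281227481022138c101244481422fbea4c3297d13032fbe99c16f81a301237573c2252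830812b719342afbef7c46f89c603afbc71022560c183afbe91c2afbef8c6afbefbc3afbef342afbe37412fbea9012d60b201afbe0141efbefbef6f68d1022989d4831d6923832879c2012b4871412a696242afbefbd46f8de5c46fbef8c46fb5f241afbea0c16f899282296d6441afbefa041f593201238942812d899141afbefbc72fbef704216cb1c1afbed4416f65630215247101afbef2032a89d081276490c1afbef68c2fbda5051e60a0c1afbcc181efbef908afbef6cb2fbd33c2afbefbc86f71a2c22da5b0c12079c2412891d2c16f655242afbefbc523815343afbe4301afbe34412fbd848225798502afbd5342afbef9c22d549181184491822480d0c1afbe65412175028322712383afbefbcbafbefbd3efbef84b285ce2046fa9d1c22ba481012d6cf0816f6963422c8100c12d9560816f59014121797141267cb1812d5ca1c1afbd51812fbed381afbef3852c9de641afbe86842a649081122481412a8595c1afbdf602afbefbd1afbda1822060d204afbef5066f7d02c12d6ca0812a54e284afbd72412faa78422b8194811e68e2c12064e2046f9184c12d99d141207563822b851181efbef6caafbefbc9afbe8683195921012b85d4816f8d33052a94a182afbe6141afbd51422c8e14811b6970c16f9d23c26f5ce243efbefbc2217581422774f2c4278df0c12b719341afbd42412d5523012148e283afbef4852a4cc1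41afbef6caafbef8c1afbe6841207582c12b7532c1afbef6496f5d0302afbefbd62fbda5012a5d5441afbefbceafbef707afbef2c42154c282efbefbd51a44d08120287081297964416f9584426f5d11831f38a1411a40b101277d53841e44c1416f98e2816f6542022c7c61411440c0c16f4cf203207193c2afbed0c1afbea8c1afbd7101afbefbcbafbefbc5afbefbc81e7521012b9551c32fbd83462c9203c21f5d03811c5ce1822a7520c124750301246971416fa90282afbef7c2efbef802286103021848f101afbd51412585f701afbef84cafbef1012c51344127753345efbef7c6afbe61816f9dc343afbefbcd2a7951026f6132032754e0c1efbef585267182c16f8d8383afbefbd0afbe5841215d0301efbef5c9afbefbcf2c4cb0c12548a1816fb667416fb279416f4cc0816f9e55c1afbd52c12450b141267cd2022c90d1812748a183afbefbc8afbd62c16f4d13c12985d30324753141afbefbd3266102421f509081afbdc2c1235c91822670b102afbcd141afbef301afbef3032d920481afbdd3c1afbca0812c448181afbef6c6afbdc142afbefbcb6fb62381afbe45012ba25502244cd2442b8a0681afbe11c12fbd82852485a20329a10141efbef581afbefbc82a78e102afbdf502afbef4c3268190c12985c641afbefa821c68a1412585f2812fbed1811c44f202258cd1022d98c081295941c1a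fbe82032a9132c4afbefbc72fbcf34119486102afbefbccafbd01c11960d1c1afbeb0c1afbef549efbef80cafbef8c46fae79416f509101afbeb941297580c121816101afbe3801afbec141217c9101256961c12278d2416fa1a5042785d301257d80c1afbefbc56fb1b1426f85c5842795d381afbef681afbe4501afbe22811648d183267cb1012168b1022274c0812260f341afbec282afbef9c2afbefb011f6530c1afbefbc6afbca1426f79c1822688f1c123595281299ce2016f894301afbe22c5afbdb281afbefbcbafbefbca298de342afbef80d206ca1422675a3c1257d42422a491141afbe85c21c3cd101afbef74c299d10c1efbefbcaefbef705298523012da9a141afbefbc81634a1412d9603c16fb1c6012c961542afbefbc52b3c90c1afbd1383172480c12385f6c1efbef84b6fbefa432fbefbd16f5d1142afbefbc5afbe3281afbe76816fae37812fbe73c62155124324717481afbef78aafbe32042b9e45012890e3012781d2c12c7da302afbda2022c7d60812340e2c16fad33c3afbde502afbefbd1afbd5201274050816f7922822d8111412680f1426fa56282236d22c3afbde0c1238180c12da4f1c1afbef385afbefbd32d8de2812ca22642afbefbd76f80c2036f8db401efbef787afbefbd6afbefbc96f9d92c22fbe114123707142efbefa02288964812a3c40811d6d02c16f950303afbef8c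9afbefbc5216151c2afbef7092894e2c2afbefbcd226cd203278460c16fae77c16f8561022c7cc2416f74d2042460b0c11d5861416f84f142154091021b38c241efbef602232c80811940b1c36f8173c42a9192046fadd20323654383afbd6302afbefbc3afbefbd127810302194c60c11f60f0c11e7131016f9d33036f799303afbefbd71750b20215386081276071811d552242278da4011854f2c1afbef546afbefa45afbe42812b959101afbcd201afbef7856fa122442a74c1c12c64c102288da401279637016fa584c22a5ce1c3afbdd4421f490081afbef484afbda30128489181afbeb341afbef1c3afbe42012a85a101279151416f7cd181afbcc1812489c341efbefbc52989e583afbd72812b704081efbef608255ce1416f653441afbef0816fb1a182afbd84c12fbe37056f6951812370e2c1efbef60b25655381afbef4c26f6d95012ca523416f91d4422881d3412a6131c3afbe5181afbefbd7afbefa03efbef3c129615282afbd1241afbd30811b2440812c7ca241185450811b5460812054a142afbefbce1d6112422fbca1c21938b141afbef488afbd64c1afbefbca2b793243afbeb2c3afbefbcc2c7d3441afbe31c2efbefbd42b9523c11c6962c2afbefbceafbed381afbef5c2afbef40429994282afbef703afbef8c82980b142afbef1816f7d53c32730b1416f6d2142245921422581f0816fae2202afbef8026f814183afbea602efbefbc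f2681a3842d7dd5012b64f241afbdd0c1efbef7466fa616c32d9561011748e2012889a241afbefbd56f796381afbef988afbe01c1afbe1441efbef789afbda4012d91a2c12a58e182afbea684267184826fa8918221611381afbef341afbd9481afbdb4c1efbef58bafbc51011538d081afbef58bafbef9486fadb5026f9d9406215c70c12fbeb7016f9e28012978f101afbefbc56f9a26832a388101afbef8c12fbe72c4afbdb3022579b1c2254d00c1afbdd2016f9a1101afbe63816fa542816f85f2c22da9e4012875a481afbe11c12b95b583efbefbc7afbde384afbefbd0afbdf2422b91644328304081afbef78aafbefbd42c91c1c2afbef5cb2a7101012c9de1c1efbefbca2fbef387afbdd4c1267da244afbef7876f9171c3efbefbc6afbef6872fbe98046f818446afbd82026f9173c46fa99442afbef844afbef4482a6891c2afbef7412a85d0c12fbe4609afbefbd0afbef081227960c12b6141c2afbcc28129811102afbefbc36f9943436f7d94c4afbe75011b58d1416f8a07816fa5e4832fbef9c2efbef5471644b182216da101afbe51022a9931832b447181afbd8081afbef3c1afbefbef1c6984c12fbe24c42c9d2102afbd81816fadd1826f91c1c2efbefbcc2fbcc1816f794102173cd1012378e1832785c5c3afbefbd5296090c1299626c21c4d2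1c1144cc101afbdd1412fbe2202afbef5c4efbef5011d5cc0816faa54c225899482122c90c12fbea882afbd82811240c2422d6ce201efbefbd0afbefac1afbec1012891b1812d95c4c1afbef88b1c6ce241afbefbefafbef3c2267582c22b70a101efbef5012b615141215112c1afbefbc8258db3412a95e4816f852204afbe8941226521012685d5c16f9614012791a5826f68d1422c8dd102227d92c323799141afbefbc8afbde0c1afbe93c1afbd330123388101103ca0c1afbdd341afbefbc2255cd2012896160128589182afbcc1831f4051012b6521412a716283afbefbcfefbefbd424894341afbef5c224654282afbefbd3afbec2022348d28128911181afbec141afbef8cb216d7281afbec1416faa4342efbefbd1efbef387afbefbc6efbef74aafbd00c129344081afbefbc21f58f2c32c9961c1207112811a3c6141afbe73c32c70e1022c655482afbefa442b447101efbefb022c9911c21c4840c1afbde5442b6da2012989a081efbef7ccafbe21c1efbefbd7256d2341afbef384276572c22078d0816f94c1412850b1c3efbefbcd2c9070812fbe3549afbef604298e060228921142afbcf2c1afbef5c829796081afbdd0812a84c24128859142afbef6022981a405afbe12c1efbefbc56f7d74c1efbef741afbe22426fa5c5036faa55026f89d404258572022258b1822fbe1703afbefbc61444b181afbcf2c12a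8951022c78d1422b752101afbe7281afbe7302afbd9142afbcf2022fbd3243afbefbc6afbe144323758444afbef3c6267900812d90d201afbef4462c755301afbefbc9afbef982afbe62c1afbef6ccefbef7482575a1c3299a4081efbef74befbef8c2266ca1816fadc5016fb60501efbef7c52a8df1c2afbefb41226d9201afbdb341afbef244efbef6c62668e141153880c16fae544125708142afbefa05afbefbef2d5101c12b7960c1256502c1efbefbcfafbde2016f855381288d01022748b182afbe65c518347102afbd0141258533436fb5e2c11b6132c22a7cf1822b718383afbef785257c81c12c9a16412a4903812b88e181299a2741afbef9426f9954012fbe56852a7d54416fbefbc8afbef8886f5912c1297534412b78b081afbe9701afbef8c3afbef609afbefbc8afbefbc5afbef9051c5d1182afbef7091f4cf201226d92411a487102afbe1544afbefbd5afbd84811938b0c12d8e12c12988b182afbefbd2afbef441afbefa822674d1412ba582c16fa215442a9991026fae9281afbefbd4afbefbd52f889142277cf302236d22832d9d10816f9912c4afbd3183afbdb6016fa594856f8995042281c0c1afbe25c1286560c120183081afbcd281efbef4852da63301afbefbc52d6132811c3c81026f85a5012a99e142efbef50229708081afbefbd214288181297564412a6961c12a91e443257cd0811e610281afbef7822964f2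822fbe25c1275d53c2275d42012c88d1012b9923012da8c1416f91a4462da622812c7cd1c1afbef809afbef506afbd31c1afbefbef299a2301afbefbc7afbef80c275d1181efbef6c5267943456f7d7484afbd6101299601812c8070c11a2440c11c60d2022b78e0816f4c6141afbef6c5efbefbc9afbd5285277113826f9132431c657301afbd9183afbef6c3afbd03c12999c28227856303afbd94c1afbefa83afbca181afbefbceafbef8092b91834323718482afbcd281efbef9c62dae888126617281afbd73841d616281afbef6c56f8da408afbce14126611141afbef84cafbef5052575b3c1afbefbc2afbd71416f81a4c5afbef285296cb2032b6974412d5890c1afbe64c1afbd4281257143c2afbef783afbef88c6f9543c22a8071411e60b2412770a101afbefbd7afbef7c5227592c3afbefbc32fbdf303afbe14016fada3826fa0c202288da5822b553241efbefbc26f70d2412a5cb102afbef0c1afbd5241afbe72c1efbefbc2afbefbc22a71b3412a8d92432b91954214207101afbef9c1212470c1266860812caa35412850f3022ba1b1022578f202278ca1c31e5d13042a308141afbef7ccafbcd1c1afbefbd22d8da3816f74b141268d43412789d102efbefbc2afbe46c12895f101295d1281afbefbc7afbef9c629308142afbef7c8299a31021734a141afbefbd0afbef5c31f7571c1afbde3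016fb263c2afbef74a286cf2c3afbef782afbef7496fa64404afbd50c1afbd31811948f102223ca102288133822a75a3c16fbe73c1226d30c1afbc9102afbef6076fa191c2afbefbd2195111022c3cb1c2afbef7096f7d33016f8554822fbe75c2afbef946afbe71012fbdc482afbef7012a8de2041c5cd1422fbd538124698142afbefbc8afbd95c16fa17102afbef947efbef6036f9a16441f6ce243afbd4201277d62c5afbd90c1afbefbc1efbef7c6288ca182afbefbc9afbef60316543081afbefbcaafbe61411a590242efbef5421958f241afbef701afbdf1022c7562c1afbefbca2960c241268182822fbe22432aa160c1289215c21a615401afbef7862aa581012940d2c1afbef584efbef802277522011b4cd242297192012fbd22852164f141afbe21026f9204812fbd33012b911303afbcf1c32da13481efbef6cc6f6c90c12c70f102afbde3c22fbdb202afbef5c36fa2258424855281afbefbc7efbefbd36fad4401276532c4afbdb2022cacd081226d10811d5120c12999414121404081276982826f91a0c1afbefbd22450c142afbe51c11e5d03022b9c81422c748081afbefbd02d60c1c12b991242255521c2afbefbce6f852341afbcb202afbefbca278910812fbd7081afbef641264cf1421f509182afbef686afbe7501214d12c22940d1022d7d8101afbef2c4afbe83411f6554022fbe9482275502842fbe1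7c1afbefbcf2fbefa45afbef641afbefbd1efbefbc2efbefbcd237970c12880a081afbea881afbef5466f513181afbcc081236974422c40a201afbefbcf1534a182afbefbc7efbef901afbef6c723712141228162826fb593412884a1822b953282afbef84a2b8d11c1297d93021d60b2426f4cd2c1afbe14412a9cf342afbefbcc259170c1afbe948327759582298d13431928910128349081275cb102206d63c1afbef2432a718283afbef4026fb265022fbda2826fae65821548d1412c71a1822fae45412a9d524220592241afbefbd1afbcd141afbefbd1efbef645afbd01411e6d5102afbda381afbc81416f8de4831858f202afbef6c11d58e243afbef4c52b7cb1826f38c201afbefbc8afbef203afbdc401297572826f89b1022674f0c12d91d0812d9881012ca982c16fb643811f6d9541afbef9c1afbd11812fbd83c1afbef3432b6d80c1afbefbd2afbef5836f812282273cd101afbef6c5192c30816f916302244d03032da1c3016f2c81016f9d2284afbefbcf2d89d3c11940d081afbef8046fadc4012b7d8482afbd31412d81a4412b916241279101422878b2036f9552c3afbe04c62fbe4505267d910225713304afbef489afbcd1c12b4861016fa99301afbef3861e4c9182afbef98629897404afbefbefafbef1416f8112c1afbd43812958d182afbef5cbafbdd681afbef909afbd54012799410128960481afbef9c12c9534012d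7173812b7d74c11b48b142afbef68d6f68e2c1efbefbcaafbe3281237981c22279c581efbefbc12d79a3012775a1c1afbef8ca6f48d182afbefbcb6f91b544afbe87c3afbd9141afbef2432da22601afbe85846f7d6341afbe87426fbef70befbef1826f91f1c320791101afbefbceefbef4016fb674011c4cc183afbefbd4afbef581215c9101287da203efbefbcb216d9541257d91c3afbef407afbefbc7226c91836f95a543afbef60cafbe42016fa1d642afbef9066fb253021e6160c16fa162c52ba1a28226592181afbefbc5afbdf406afbe52c1efbefbd42c9e15c21a3440812940e142256c91012a90c2c125899441afbefbc1efbefbef25594081206d1102afbef3c4afbdb0c124756081afbe84016f81b303afbd82012a74c1832b752102afbef4412da62201afbe71426fbef1c2244c7142afbe2481297da183afbcb1822c9e25012660c1c118248181afbef707afbe03422a9d91021e5d32031240c1c2204840c16fa8e243afbef88a6f9de584afbce1012b692102efbefbc32da990812b851382efbef607afbefbc72160d081266961422868d081afbd210128719381afbe90c11948e0c1afbe45012d90e2c1afbdc1812b9983c3afbef744195911822b9df5836f7951c1afbd02411f75520221615102213880812b7502c225489101afbe3341298d53416fb1a2426fb62481afbefbc3afbe21c2afbef743afbef6032481b2c2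1b5451012c9e55c1afbe67412985338229815341afbeb703afbeb5811d60f341afbdc285afbe4301afbefbcbafbef7c12fbd32026fa92402afbef8c3afbd03c1194cd2012a8153c40e288081afbef64aefbef382afbef9412a7d70812a921642279635816f7962832fbd41421d511081205040c1afbe44821f3ca102afbefbd4afbefbc126615181afbd11816fa4e2422798a0c1afbe47c224489142afbe93c2153cd2016fb594416f6d7384efbef3c76f960682afbed201237974c2afbd310227812401246471412fbd02812fbea6432a5d12c3265d5181afbda2812134a0c1afbefbcb237d8102245d2201afbefbceafbefbcd1d6141c12380b141afbef743afbe74c2244ce183afbef8442b899443214881812844e2822ca621812c8533c26fbd92c4afbefbcb2b75a582afbd20c1afbef5c9afbef4072fb6a701afbda5c12448c203afbcb18229648181afbe33c22899418225613301afbe60c1afbefbca2b6cf0c12b6573012a6d9201afbefbca6fa9d6826fbe32c4afbea183afbefbd22134b1c126858101afbe44816f812301afbd73016f6103022998f302afbeb701afbefbc3afbe41c12fbdb3452a81c5816f78f301afbef9c3243c40812fbeb5c26f6d11c32aa123412b5d3101afbef282efbefbca6f9891c12875a1422989d5c41f6151c21e593281238523412254f0c1276d92422a9d50c16fa971c3a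fbe61416f91d202afbef5412fbe2304afbea0c1afbefbc7afbe8601258122c2afbefbef6f712283afbefbd31f48c241afbde541256111026f6544812d8d22c12785f2c12d94e1c12c3c61411c6553c1afbe24c4afbef70628491301289621416f85d283afbef549afbef8876f8c5081afbe7141297111c11f79a1c1afbefbc4afbefbc7afbef341254cf341afbefbcb256d33012c589102236531422a91648323798241afbd50c16f58a081afbef9416fa253c12989c2c1257563c2afbefbef2fbdb5c2214c71812a9204816fa993c4afbc7101efbefbcc6f447102afbe22c52989d1832d755341afbef3c329985081efbef2832a951242afbefbceefbef64826550201afbefbc5258583822b8d8381afbd51812785b5822890f1026f8d9203afbef542207173412fbe37c1afbef549afbefbce2a9511026f9a2503afbefbce6f4d0381afbe46036f50f2836fa95181afbef441afbefbc5afbef2c3afbefbc3efbefa82afbea081265523012ca64341afbd72c12c6d63c11b64e081afbe96026f9133c1afbd72c22c81b141afbefbcf6fa264812d85d6c12c9e3541264080c1afbef6ca6f79b3821b6500c16f7184432791f1412fbe680325856102afbefbd3afbefac1afbef3c1298cd2832fbefbc3afbef7c62b9632812a808182afbef6411d48f102afbef70aafbefa032c988181afbef481afbe918121690201255d0141afb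ef90229896401265520c1afbd73011f3c91421958e2831338608129921781efbef905185911016fa96101296d50c12b9992432a5540c12b697281afbea6016fb4c181efbef5812b89c642248971811d65414122692301afbefbc6efbefbc86fb647c12b89b583afbef9022fbcb1422c99b201236941c2237480c1afbefbef6f7101822fbd620325616441afbef9c7afbe01c2afbe35822968d2c16f8ca1016f8dd504184491c12175b5c16f4891c1afbd81426f9574446f913441afbe21c16f84b182afbd52836f89b404afbea701afbef84b298133822684f2842b8dc6032caa83c12c38b241afbef843afbdd0c16fae35c2efbefbc8afbef5c4afbefa44afbef686244cc2812a8df443afbe5441afbd53012a958483afbefbd6efbefbc52b9154036f8cd2426f80f1011340c201afbe78c1afbefbc3afbd83031f5cb1832fbd95016f961543294c70816f817445afbef442256972826fb554816f711381afbd32c2afbefbefafbefbd2afbef982258d01822785c4032fbe05412c6d9241185d0181efbef481afbef346267da401afbdf142afbefbc11c64d0812560f1412fbefbd52f74e0c1afbdc141afbc9081afbefa021a309181afbef283afbdb1c12179b1c1244d0283afbef6076fb230c1237da2c1235511422fbeb1c322711081afbefbd62b9112c22d7450c1afbd32c41d6d6281afbce2812b8183c26f8dd384203cd0812c6481821c3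430816f8983422fbefbc9afbef54a23605101afbdf141efbef8c3afbdc6412a8dc3c3afbefbc21d504081236140c1afbea1811c38a102afbeb9412b8da28316447181afbefbca2a8df503afbd8201efbef80320587141efbefbc828858101afbefbccafbefa412178e102afbe86c12c64b0c16faa84016f951342235912c1efbefbd3afbefbcbafbed401efbef3852fbe72c56f798203afbefbc8efbefbc127799381afbefbd129957181298d20c1afbea90225655304246c6141afbef6ca6fa1e281294881422fbe7705afbcb1c22140a0812b6162816f98f2016f8cb1c12340f241afbef3442b9ce081297d64426f7153c21758a0811858d1822585c5c32b792243afbdb0c1266123832d7cb0c1afbef701afbefbc96f8953c3afbef3042c5d0102afbef1012fbe1743efbefbd12485c201afbefbd7efbefa822b89d301225cf281efbefbca2580a1421a30a1812d89d101afbef8062140c183efbef68c2381a3c1afbda445afbe63410f2860c1afbe25812479330326747181afbe11012c8db582afbdf382afbef9086f91d285afbefbd06f99b302afbe230125506141efbefbd56f7d02c4afbef3826f9142c3257471012548e08120691101afbef6c12c58e1412b94f2821f548182275d61012a3cb1c1afbe77822a6d1243efbef747afbefbd5afbefbc9afbef8052789b1816fad21c12fbe4142afbde301266564c12b8910c1a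fbdc542afbef8caafbe6344afbefbc22fbcc0c1afbefbcd266d03412654c1422d7594012a7ce181afbd1341afbefbcbafbef4c12d8971c12d91c141afbe02c52d6d9501afbeb382266d7281286d12c3afbef849efbefbc2afbe83821f651341afbe01411e7151816fa5b584afbefbc71f68c241afbef708afbe78c1afbefbca1a205081226d1243afbef4432fbdf444afbef5caafbef889afbef4441c40e10124490202afbe45412d9dc541afbca10120594242afbd2101efbefbc12999d182afbef3c46fa933022860d0816fa133c32a8194c1afbef8852c6d6081266cb08120553202afbe46026fbe3783afbeb1c12b690201afbefbce2fbefbce2ba653c1206d84422fbde2836fb19401efbef203afbd4181afbe53426f50f2c2afbdd081afbef70bafbef481afbd5101afbdd4421d60a101289a3201afbeb5c1afbef446afbefbc7193c91c12a54f1422fbe8484afbef408afbefbc3afbc9181afbefbce6fa45081afbc80c12b68d1812a4d0301afbed881afbef8c8afbc8101269131412fbcf2826f9582c216448141afbd3243efbefac12a9e33c2afbef9856fae8942afbe81c22474f3032979a343295d2381afbe17032984d282264451012d9de5c12a757203265100c1298d9281afbef2c2afbefbc52470e181afbd5281258500c1268d2381afbef744258ce0c12770c1c3afbef788afbefbd5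2fbd31422fbd84812fbe42c2afbef9c62a9593c1afbea5812248b2426f9502442d5cf2c1afbef949afbefbc6afbe4681254c40c1afbd1181afbef7866f9e31c12b5840c1193860812dae7381afbde441afbefac3afbef203afbefbd2afbef705afbeb4816fa184c5efbef742afbef587afbef4c92b7cb1c1afbcf2c12b3891822a5d2201afbd7081afbe00811744810122811141266871012d9205812ba5c0812fbec6821f6c4081afbefb41195030811f5c81016f897401efbefbc32fbe5701afbef885afbc80816fa4b2412c85d6c1afbe66c11b58b241afbe31836f6102c56f6d12c4afbef6072b99f3c2afbefbceafbefbc22650b1812ba14081afbefbceafbef7461240d241efbefbcfafbef2c3afbd7301afbd11c16f345101efbefbc56f9512c3afbef7482d74e2812b9cb183afbe71c12a7984c2afbef9c2afbc50c1afbef2c22fbdd4012a8934412948b081277900c1efbefbd66f8150812fbefbef257d3285afbef986efbefbca6f9d7283afbeb2c2afbcd0c1afbefbef2a611342afbef84c6f6cc0c1afbd3141afbd7503afbcd0c127819381afbef141afbef909274cb102afbefa0325891182286cd141afbe97c2afbefbc4efbefac2afbd0181afbef4826f758404afbefbd725654305244902412a3cb1821e7141422174d2836f89a3031e7551c1afb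ef3412378d2012999f4c22574a141226551836f95a3c32a90c0c1afbd2285246144816fbdd1c3afbefbd46f9dd485246522c26f54e1822a756141afbed201215532412dae03c12fbd4282afbef60aafbefbc82590b101289460812364b202afbef7cdafbef282afbefbc66fa1d4c22b84d28212409182287574c22b94e24322590081afbefbc1afbeb7c12c9e0242afbef647afbefb01afbef78217306102afbcf1c1efbefbd7afbefbc9afbe13822760c1c12a91f202afbed3412fbd1281efbefa032995a303afbc40c1192c50c1efbef1026fae2783202880c12c54a0c16f64f2c12b6171c1afbefbc1122c910125790182efbef9492c44a081efbefac3afbefa022760e283afbe8243afbefa05afbe87812ba1d281248174822b718301247911c1afbefbc5288140c16fa984c2efbef58a6fa9b342afbcf242afbe92c3235460816f48f282afbda6016fa961c1afbefa032279c24119592081283ca201afbe35c2afbeda812c443081afbef70c6fa24703afbefbc6afbe56c4afbef3876f74b1c2afbef983296944422489e1c22978f141afbed2012785f281afbe23016fb276412ca9c0812681d541afbef70d182450c1afbef784afbef2426f4d1201afbeb101afbefbd2afbdd6016f8923c3efbef644257994432b9d340329899081efbef5c3266d6481efbefbd76f91e441247491822fbd93852fbe02842d9d13412050b1026fb626c1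afbc8101227521822060b1422448d2012c9225c1efbefbc8afbefbcb2cace0c126695242afbef686afbefbc7afbefbc32a9e4402afbde141afbdf081afbef543efbef5481f5102421e64c2432b58f1c2afbefa416f8dd4426fa141411a4060c12c6cf102291c3081afbd41822a91a382afbd0141afbefbd5afbda1c22981c503277123c12fbde244afbefbc4afbe47836fb11182afbefbcb2fbe3588afbef9c21e712182afbeb142256131411d5d11412685a5822ba560c1afbef70eafbe54c42b89f0c1afbd5241efbef7c32c48b1012381c6412c81d54223690342222870811e1440812d103081afbcc2021f50f1812fbe33826f715386266531012a60a0c12a6881422ca612812a694241295500c12fbe3386afbef202afbe7581285901411b58c201afbe6201afbefbc3afbefbc4217551426f7d84c2afbc9101299151022558d202298594c1afbcd0816fbef9c52d6d4141217101012fbdf1012789b3830c2860812fbe640128911343efbefbefefbef5412544f2816fa89081afbefbc32038c141afbefbcc275902422a5911412c7d8542afbe33012485a481253481022a8e16012350f2c2efbef6c6afbefbd4237db641288554822854e1021838b1c26fb28882277174c1afbea3c1efbefa062ba224422b85b3812589e2811a2840c1afbef5066f7d3281efbef4882b4881421a285101efbefbca6f85a301afbef5c6afbdf1c1afbdc341a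fbef141afbefbd5afbef5c2afbe2443efbef486afbe7081efbef6c6288da2c2298163c4afbeb282afbefbc62058d141afbef74eafbefbc129994081afbde10127607101afbce1422991e7016fa1b5c2afbcd301efbef70d28993201efbef70eafbdc201afbde4452c7c80812064f1412860f341efbefbcb185d51416fa58382afbef58624698141afbef902efbefbc31f5d1282afbefbceafbef784afbeb142afbefbc5afbd91821e50a1011d44b101afbef5862b915241235cf182afbefbd2afbef7036f7191012b8d7283afbea641232071412985c482248a0201266571412fbce2016fae1302afbef78eafbde2011f6502c5216ce2842a8595422050f2021848f0c1afbe7781afbd72c12789d2c11b50c1826f854404efbef7ccafbefa432fbe95c3afbefbd3236901c11e6542432964e281afbef7452a7c5081afbdc501afbefbcbafbef882afbefbc625710101293c9181efbef5836f993341afbef648afbd33c16f949102206d53442c7120c1afbef6c5efbef789226123436f74a0c16f89d3422a8513812fbe554822648181265c71012795420222752242afbe43822fbd8482afbd62421f5ca1c12a9214c1236c60c16fb0e201afbefbca1c610181afbda281afbef5442c7985022679a343285101c1afbef909efbefa056f7961c12b89f6c12c3cc141afbefbc7afbd12816f9542041a58a1c220698301235490811b64d08116346081268172c3afbef9416fa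256c12fb27402195480c16fa963c16f9941c16f89a404afbe8841afbc5101afbe12446fb1f542afbde34129793101277564026f714285205d51c2efbefb41afbefa43afbdb1812c8d518122798481afbd3101267163c1afbef3872a9851012ca4b081efbef581afbef488266d42826f81b2c42348f201afbcc2812540f2c12a9dc641afbef5ca6f6553412fbcb1422c7da382184d01012b5050c1afbef846afbef9846f6553422a9953c1efbef5496f9a2702afbef8042a8182c42689b304243cb183efbef7ce2aa180812990f142296491c2afbef70e6f7d91c32fbce24428899342afbef8c21b3471012fbe98452c5891816fa941412fbe05c2267cf2041e6974812c4ca182237595812a9170c1132ca2011e7573c1afbd83c12da870812aa5b141efbefbc7afbef3c4285d0303afbef6caafbef60a6fb564412b74d201142870812060b181afbc9181afbefa05afbef346afbd43842b9de302afbc80c1afbef643afbefa432a95c303afbefbce257164816fa964812668f241afbed7c1afbef7472c952242efbef9072b8de2c21e4cd0c1268df302215081416f60a1c31d4d02c22a9962c36f953101afbe25412b89e081afbdd2011b4c80c1afbef282afbefac3268112c4afbd44c12fbd7382206920c1294880c1afbef487afbefbc4efbefa842a91a4c32a859242afbe0681afbcc2816f752384278df403afbd13c12478d244afbde3c1207571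426fbef9482b699181afbe23c122718282afbef8c22840d1c1afbef3836fb111812a7100812b7983832b5101c26fa61183afbef701afbef942afbdf6c1afbe4381afbe51c121647181afbefbd42fbda5416f95d4c52c5c91426f9e15016f6d9302efbef60b2a69730117511202afbef3c6afbe74816f349181afbeb2c1afbefbccafbefa41efbefbd3afbd92812d5d22c1afbefa451a50e0c11858a181266090c1afbe02c2223860816fae4301afbea601afbd628227754202afbefbcf2a5d1141afbe80c12258d1c32a8932831f4ce0c1afbcd204afbd6282afbef444efbef941efbef6452c79b081afbefa426f8d3203225903012fbe460aafbefbef298995812450a183297c8141278503016fb258c1afbef607afbeb181237952c4afbef8c2215ce241299d95012fbe11c21138c1c113288181afbe3701afbefbef6faa7241afbe87c11d5050c1287992c36f7cf202281c60c11f7152032690b18128898141efbefbc3196090c1afbe9744afbeb4c3afbefbca2fbe61c31938a1c12c89f2c12ca67601afbce101afbef8c2afbef3852fbdf5456f9a0505299d12c12c6d0142afbefbccafbefb41268592432a9534422fbe36c16f85a5822a7da4c1226932852a44d182243cc203afbec2c1efbef182afbefbcdafbefbd3afbef284247941422c8530c1afbef3026fae80c1297571412c696441afbef202257182c26f94c1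82264cb1c26f95f1c1256572816f686081efbef6cd1f69524114450081274ce281afbef484efbef74aafbd7141afbef2822b553181246c7142efbefbc61d4081c1afbea442afbefbc12b8561c12fbefbcb1a5912c31e7194016fa1c301296902c2afbe66c12daa6541afbcc08128917201afbd1244afbe8301279511822b5502c2afbe47c1266cf181298cc0c11a4501c16f81a2011230a1421654f101afbce1c2afbefbd714388101215cb1c2afbefbd0afbe92c1afbef383afbeba022fbe6781efbefbcaafbef9c3afbefbd02790918128817142afbe2641efbef9882fbe44466f79a3c32058f3412a7dd5c1efbe24472b60b1416f94b202285d1281214cd0c1afbd84c1afbefbc2236923c1afbefbcb2aa215812b9554032d918081afbefbc8296d3241afbef5066fa212c11b4cf2816f99e2411e44d081afbe80811c6163c1265cb1411f50f3012a81538226611182258580812fbe52c5afbef301289cd101afbed1016fa243c32074d1812b9a4681afbefbef2038d281efbef84aafbe7081afbef343233460c11c6511416f71b481247ce14223850241266d3141254ce1412fbe8844afbef6c12ca0a0816f74e243296921c125859281afbef54aafbef6c427817181efbefbd4afbef1c1afbef787afbc91012fbe98821b594101afbef8c3284d0341afbe1201efbefbcb2884c102288973c1afbe44021c54e2c1ef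befbc96f8a02822ca51282afbd61c124897141299d00c1afbe4401efbefbca6fa112c4279601016f8d938426752081afbeb981afbef888afbda4046f88c181207d22c16fb1c5412068c1422ca67441247d63412880a142efbefbc429959383206060c1afbdb2012068d2c16fb55241287162c26fb277812a8cc201afbdc182afbef1426f6d61832895e1c1288ce202286970816f9a12c3afbefbcaafbef6882748e081afbef9422d9225412ba6430128817384afbe0542afbefbc9efbefbccafbe6301afbef402141c5081afbde401299e25c1afbd71c12158c1832985c242afbef701afbefbc4efbef242afbe8241efbefb416faa04826fa52284efbef1412d793401286554c1268e1081afbea202259111c1afbe31416f8cd241286913432d95f5c12fbdf5492781b181afbefbc26faa27412040b2022a84b1832ca100c16f89c383afbd40c11e50d141efbefbce2fbde1c1277902841f75b181afbefbc9afbd33812a58b1c31d6ce281afbef9c1afbefbd7afbcf1c1afbef7ce23812381afbef302afbef6c5afbef7432fbd7241287d7306afbef6072a4d1342efbef2812fbe74461b38d081268df102efbefb02efbef60b1e58e2436f8901c1246d13036f6920c12d6ce0c1afbefbd2207161426fb252412d9d84416f9184c2afbefbc96f4cd281afbef78eafbefbc7afbefbc4297d834429614341afbed381afbe02011c30a1812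27d8402278dd3032a8503011b4050812a818382afbefbcb6fb251c1afbc90c127691305efbef8446f347142afbef5816faa47c2afbef1c2afbef9c11d5d54c121512302afbd84832964e204afbef1c31f34b14123554341afbef7046fbef6c6afbd9182afbef10227548102267511422c51328124389182afbefbc2afbe8601afbde281afbefbef1d550102afbefbcc236cf1016f856241265531c1246144036facf1c12b80f2822c9141026f50d2046f79a5c12ca56241275460c12d8d7381288582c1afbef6c22fbe2701afbdd5c1287d93852aa143816f6113012d68f0c1afbef74eefbef5071d2ca181276d22411f5d22c1afbde243afbd21c1afbef1c3afbde1421f7174426fa4f204afbef7cdafbe92826fb6a3c11c6501c11c6142031c6513816fae61831c6880816f7912c3afbef701afbe8081afbef3c22fbd9443afbef8892c6d20c16fa5e582afbef888efbef381afbef8c3efbef903afbdb141afbefbcbafbe72c226692101afbd80816f80c1c12a9dc2c2afbefbd4efbef8c826751181afbef9c22d34b201afbd6241afbd30816faa3582afbef7cfafbef88c2481d402afbef7421c6941416f647141255cc281296481016f693243275501812c4ce1012d79a381278554412c593302295d23c2afbef4c9afbd6403afbe98c16fb24341258de341247513c11c58f1816f9a12416fb675c1afbefbc3afbd43c26f9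122436f8da281afbefbd76fb293c16f48f242efbef8c6afbef881afbdd4421e44e283afbe73422fbde541247da583efbefbd0299952c12ba531412fbd8481afbef6c16fb654c1278901c1217d21812b50f1c22c8541426fa1f3011e6913826f950102102c9101afbefbce2980a1836fb633012a4cb1c21f4ce1816fb5b3c16f89e5c12d3cd2012c895381afbc71811d4850c1afbe8884248d01812ca960c1267d22412fbe74c6afbefbc5afbef687afbef7c4276d42c3afbc9081afbef541afbefbc5afbefbc32869518325695142afbe3101233840811b6502c1268512441b38c182afbe634227806102afbefbcc1e6cc1c12b8db1421854a081afbe7841afbed5016f693381afbdd181297151822d99b081efbefbcaafbefbd1afbef84b275ca0c12b895382afbea803afbef5c46f7c4081285102c36fb1f3016fa8f341afbef6872fbe6405193890c1afbefbca6f9cd2832ba251c22a855341afbde343257990812891718120693384267ca1c1afbe6443afbefbd61c5cc281afbefbc5afbef847afbc71012fbcc081afbef405afbed381afbd9141299510816f8593466f5d1101afbe5541afbeb701afbefbc16fa63601afbe70c12678f3012844d281afbef747afbef5c51e68f1836f7162c223692081efbefbca2c70a101afbef80bafbefbd22b954303afbd52436f80b2022740c1811748f1012258b201efbefbcfafbe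f70b2fbe4549afbefbd6afbef7c11d54b1416f60f0c12d948101afbea1c11c5cf2432c8e04011f54d1022b3ca102afbefbd66f8da384afbda3812a491341afbef5822a9e4141afbefbd226608081226152832d9911c12558c1c12790c2031d4c4081afbef5452c7080811f757201afbdb5026f84b2022589f442afbef2842281d5012fbe6641278100c12c999102afbec10127794346afbed241afbd7341afbda5c32a899582efbefbc7268d40812d95d3816f99a141277d9501258181c11e6d83c1277d22432c6162412a85d503afbe7102afbefbcf6f5ca2012b9541812fbe6444afbef4411d50c202efbefbc1206552412b895081272c81412b8934012980f2021c5d33826fa611c12c60f181afbdf3812960e1c1afbef7ca2fbe71c1afbd22412fbdb484afbdf442afbef5ca6fa50181afbefbd0afbe7346215934412d9d23c12c506101258df141afbe2482afbef7442fbea6c2195cb08127957141236cf1426fade5411e4471011f3cd2022d94c081153ce1016fa9e2c3286973c128906101257184c11f3c9081afbefbd61d3881822a7d2183afbef3c5afbefbc76f99b5826fa59182298561c16fa246012a91b101278db5416fa600c12d9d11c1226961c2afbef74aafbde601247080c12b7d95012d84c281235060c11e6ce241afbefa432d7964416fa183822a285081216d11812fbe8545afbea101afbef4c2afbefb022644b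181afbeca012fbd9244afbefbc8afbd0102afbed3411f3491822fbd6442afbcb241afbef6416faa36422fbef283efbefbd4afbefbc3267142031b656481afbe72012fbe98c46fb28881287c6081afbcf2c12058c101afbeb1816f8da442285cd1c2afbef9066f9d638224347141afbefbef2554a0811b3c81421f5d0301afbefbefafbefbd3afbefbd2269102011938a1012b91320223793301afbe54011f58f1022fbd01012451018221386081265d42412a81d182afbefbc8afbe24416f898341afbdb4412c74a2012c8d6182afbefbc76f7542c3afbef883278df302afbd10812fbdd1016f919441278162812d89e6412d4ce0812b4ca102296521412b7503022a85e3422c8a0281efbefbd4afbe54c1efbef5012670b2816faa5603afbdd4812b6d84031f5491c2afbef844afbda14129755081afbe41c2efbef501afbd50c16fa641c36f68f2032b6d11c12d9617c1258ce2012da4d0811f3c814128447081afbd85422c81328224717404afbe11812fbda3851a54e0c16f7595042a38b2012d9912416f7d2284206d85022279a6011e5921c2afbd10c1216870c1257574816f98f242afbefbd21344c18119450141afbef90a6fb22801202860c12d658441285522836fa21401afbefb012c891302afbc6101afbef4c8afbe3701efbefbd52d7cc181afbefbce2179c5012d80b241afbef401afbef644248992422a513401efbefbca258171016f612381afbc3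08127855282afbef402afbef4026f5ce201afbef3422d896381afbec1816fa132c5275d23c1afbefbcf2a8574412a997381afbcb0c1afbefbd6237c60812889c1c3287d44412fbec1416fb554c1244cb242afbefbefafbe40c11b5d12c36f48f241afbefbc5afbe17c12338a1c26fb6a6812b920242afbef8c4287910c122716345afbea7011b5112421e68f1c22258e281afbefa03288581412c8491c22b6c91c2afbef6cc268913416f855141afbef684afbe3401afbdd5822048d243afbef74dafbefbd66f9182022fbd71832a9d73c12c84a202afbd60c16fb256812c8ce1812064c1821240e2012881c5032c74d1012b8a0701afbefbc4afbefbc12b8181c1afbef584227d0302afbef883afbefbca6f94c1c32fbdc2421a50e0812ca1d1c1afbe0301256903031d649081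
attribute [irreducible] seqS0 seqW
def rho : Z47 → F2 := vS seqS0
def force {α : Type} (x : ℕ) (K : ℕ → α) : α := Nat.rec (K 0) (fun n _ => K (Nat.succ n)) x
theorem force_eq {α : Type} (x : ℕ) (K : ℕ → α) : force x K = K x := by cases x <;> rfl
def posP (w q : ℕ) : ℕ := Nat.pow 2 (Nat.mul 48 (Nat.land (Nat.shiftRight w (Nat.mul 6 q)) 63))
def witM (w : ℕ) : ℕ :=
  Nat.land (Nat.xor 1 (Nat.xor (posP w 0) (Nat.xor (posP w 1) (Nat.xor (posP w 2) (Nat.xor (posP w 3) (posP w 4)))))) spM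
def seqOk (w t s : ℕ) : Bool :=
  force (witM w) fun m => force (Nat.mod m spD) fun n => force (Nat.mod (convS s m) spD) fun c =>
  force (Nat.add n (Nat.mod n 2)) fun n' =>
  force (cond (Nat.beq (Nat.land (Nat.shiftRight w 30) 1) 0) (Nat.add n' c) (Nat.sub (Nat.add 48 n') c)) fun wt =>
  and (Nat.ble 1 n) (cond (Nat.beq (Nat.shiftRight w 31) 0) (Nat.ble wt 12)
    (and (Nat.beq wt 16) (and (Nat.beq (Nat.mod (Nat.mod s spD) 4) 2) (Nat.beq (Nat.mod s spQ) t))))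
def seqRec (i : ℕ) : ℕ := Nat.land (Nat.shiftRight seqW (Nat.mul 32 i)) 0xffffffff
def simdFk (k : ℕ) : ℕ := Nat.land (Nat.shiftRight simdT (Nat.mul 48 k)) 0xffffffffffff
noncomputable def seqPass (f : ℕ) : ℕ → ℕ → ℕ → Bool :=
  Nat.rec (fun _ k _ => Nat.beq k 1532) (fun _ ih i k s =>
    force (seqRec i) fun w => and (seqOk w (simdFk k) s)
      (force (Nat.add i 1) fun i' => force (Nat.add k (Nat.shiftRight w 31)) fun k' =>
       force (convS s (convS s s)) fun s' => ih i' k' s')) f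

theorem seq_ok : Nat.land seqS0 spM = seqS0 ∧ seqPass 3880 0 0 seqS0 = true := by
  refine ⟨Nat.eq_of_beq_eq_true (by decide +kernel), by decide +kernel⟩

theorem UU_rho : UU rho := by
  rw [UU_iff]
  funext t
  revert t
  decide +kernel

theorem rho_ne : ∀ s, rho ≠ affine 1 s eps := by
  have h : ∀ s : Z47, rho 3 ≠ affine 1 s eps 3 ∨ rho 4 ≠ affine 1 s eps 4 := by decide +kernel
  intro s hs
  rcases h s with h | h <;> exact h (congrFun hs _)

def Wit (r : Z47 → F2) (w : ℕ) : Prop :=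
  ∃ m : Z47 → F2, 1 ≤ hammingNorm m ∧ (hammingNorm m + hammingNorm m % 2 + hammingNorm (conv r m) = w ∨
    48 + (hammingNorm m + hammingNorm m % 2) = w + hammingNorm (conv r m))

def GoodAt (k i : ℕ) : Prop := rrF rho i = rG k ∧ hammingNorm (rG k) % 4 = 2 ∧ Wit (rG k) 16
def BadAt (i : ℕ) : Prop := ∃ w ≤ 12, Wit (rrF rho i) w

theorem hn_le47 (u : Z47 → F2) : hammingNorm u ≤ 47 := by
  have := hammingNorm_le_card_fintype (x := u)
  simpa using this

theorem simdFk_eq (k : ℕ) : simdFk k = simdF k := by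
  show (simdT >>> (48 * k)) &&& (2 ^ 48 - 1) = _
  rw [Nat.and_two_pow_sub_one_eq_mod, Nat.shiftRight_eq_div_pow]; rfl

theorem seqOk_spec {w t s : ℕ} (hs : OkS s) (h : seqOk w t s = true) :
    (w >>> 31 = 0 ∧ ∃ w ≤ 12, Wit (vS s) w) ∨
    (w >>> 31 ≠ 0 ∧ Wit (vS s) 16 ∧ hammingNorm (vS s) % 4 = 2 ∧ vecN t = vS s) := by
  unfold seqOk at h
  simp only [force_eq] at h
  have hm : OkS (witM w) := okS_land _
  have hc : OkS (convS s (witM w)) := okS_land _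
  rw [pop_spD hm, pop_spD hc, pop_spD hs, vS_convS hs hm, Bool.and_eq_true] at h
  obtain ⟨h1, h2⟩ := h
  have h1 := Nat.le_of_ble_eq_true h1
  have key : ∀ W, (cond (Nat.beq (Nat.land (Nat.shiftRight w 30) 1) 0)
      (Nat.add (Nat.add (hammingNorm (vS (witM w))) (Nat.mod (hammingNorm (vS (witM w))) 2)) (hammingNorm (conv (vS s) (vS (witM w)))))
      (Nat.sub (Nat.add 48 (Nat.add (hammingNorm (vS (witM w))) (Nat.mod (hammingNorm (vS (witM w))) 2))) (hammingNorm (conv (vS s) (vS (witM w)))))) = W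
      → Wit (vS s) W := by
    intro W hW
    refine ⟨vS (witM w), h1, ?_⟩
    have h47 := hn_le47 (conv (vS s) (vS (witM w)))
    revert hW
    cases (Nat.beq (Nat.land (Nat.shiftRight w 30) 1) 0)
    · intro hW
      right
      have hW : 48 + (hammingNorm (vS (witM w)) + hammingNorm (vS (witM w)) % 2) - hammingNorm (conv (vS s) (vS (witM w))) = W := hW
      omega
    · intro hW
      left
      exact hW
  cases h3 : Nat.beq (Nat.shiftRight w 31) 0
  · right
    rw [h3] at h2
    have h3 := Nat.ne_of_beq_eq_false h3
    simp only [cond_false, Bool.and_eq_true] at h2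
    obtain ⟨h4, h5, h6⟩ := h2
    have h4 := Nat.eq_of_beq_eq_true h4
    have h5 := Nat.eq_of_beq_eq_true h5
    have h6 := Nat.eq_of_beq_eq_true h6
    have h7 : hammingNorm (vS s) % 4 = 2 := h5
    refine ⟨h3, key _ h4, h7, vecN_of_mod hs ?_ h6⟩
    have := hn_le47 (vS s)
    omega
  · left
    rw [h3] at h2
    exact ⟨Nat.eq_of_beq_eq_true h3, _, Nat.le_of_ble_eq_true h2, key _ rfl⟩

theorem seqRec_lt (i : ℕ) : seqRec i >>> 31 ≤ 1 := by
  have : seqRec i ≤ 0xffffffff := Nat.and_le_right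
  rw [Nat.shiftRight_eq_div_pow]
  omega

theorem seqPass_spec (f : ℕ) : ∀ i k s, OkS s → vS s = rrF rho i → seqPass f i k s = true →
    k ≤ 1532 ∧ ∃ ι : ℕ → ℕ, (∀ a, k ≤ a → a < 1532 → i ≤ ι a ∧ ι a < i + f ∧ GoodAt a (ι a)) ∧
      (∀ a b, k ≤ a → a < b → b < 1532 → ι a < ι b) ∧
      (∀ i', i ≤ i' → i' < i + f → BadAt i' ∨ ∃ a, k ≤ a ∧ a < 1532 ∧ ι a = i') := by
  induction f with
  | zero =>
    intro i k s _ _ h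
    have h : k = 1532 := Nat.eq_of_beq_eq_true h
    subst h
    exact ⟨le_refl _, fun a => a, fun a h1 h2 => by omega, fun a b h1 h2 h3 => by omega, fun i' h1 h2 => by omega⟩
  | succ f ih =>
    intro i k s hs hi h
    have h : (force (seqRec i) fun w => and (seqOk w (simdFk k) s)
      (force (Nat.add i 1) fun i' => force (Nat.add k (Nat.shiftRight w 31)) fun k' =>
       force (convS s (convS s s)) fun s' => seqPass f i' k' s')) = true := h
    simp only [force_eq, Bool.and_eq_true] at h
    obtain ⟨h1, h2⟩ := h
    have hs' : OkS (convS s (convS s s)) := okS_land _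
    have hi' : vS (convS s (convS s s)) = rrF rho (i + 1) := by
      have h5 : OkS (convS s s) := okS_land _
      rw [vS_convS hs h5, vS_convS hs hs, hi]; rfl
    obtain ⟨hk, ι, p1, p2, p3⟩ := ih (i + 1) (k + seqRec i >>> 31) _ hs' hi' h2
    rcases seqOk_spec hs h1 with ⟨e, hb⟩ | ⟨e, hw, hn, ht⟩
    · rw [e, add_zero] at hk p1 p2 p3
      refine ⟨hk, ι, fun a ha ha' => ?_, p2, fun i' h3 h4 => ?_⟩
      · obtain ⟨q1, q2, q3⟩ := p1 a ha ha'
        exact ⟨by omega, by omega, q3⟩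
      · rcases Nat.eq_or_lt_of_le h3 with rfl | h5
        · left; unfold BadAt; rw [← hi]; exact hb
        · exact p3 i' h5 (by omega)
    · have e1 : seqRec i >>> 31 = 1 := by have := seqRec_lt i; omega
      rw [e1] at hk p1 p2 p3
      have hg : rG k = vS s := by unfold rG; rw [← simdFk_eq, ht]
      refine ⟨by omega, fun a => if a = k then i else ι a, fun a ha ha' => ?_, fun a b ha hab hb => ?_, fun i' h3 h4 => ?_⟩
      · by_cases hak : a = k
        · simp only [hak, if_true]
          refine ⟨le_refl _, by omega, ?_⟩
          unfold GoodAt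
          rw [hg, ← hi]; exact ⟨rfl, hn, hw⟩
        · simp only [hak, if_false]
          obtain ⟨q1, q2, q3⟩ := p1 a (by omega) ha'
          exact ⟨by omega, by omega, q3⟩
      · have hbk : b ≠ k := by omega
        simp only [hbk, if_false]
        by_cases hak : a = k
        · simp only [hak, if_true]
          have := (p1 b (by omega) hb).1
          omega
        · simp only [hak, if_false]
          exact p2 a b (by omega) hab hb
      · rcases Nat.eq_or_lt_of_le h3 with rfl | h5
        · right; exact ⟨k, le_refl _, by omega, by simp⟩
        · rcases p3 i' h5 (by omega) with h6 | ⟨a, q1, q2, q3⟩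
          · left; exact h6
          · right
            refine ⟨a, by omega, q2, ?_⟩
            simp only [show a ≠ k by omega, if_false]; exact q3

theorem seq_main : ∃ ι : ℕ → ℕ, (∀ a < 1532, ι a < 3880 ∧ GoodAt a (ι a)) ∧
    (∀ a b, a < b → b < 1532 → ι a < ι b) ∧ (∀ i < 3880, BadAt i ∨ ∃ a < 1532, ι a = i) := by
  have h0 : OkS seqS0 := by
    have := okS_land seqS0
    rwa [seq_ok.1] at this
  obtain ⟨_, ι, p1, p2, p3⟩ := seqPass_spec 3880 0 0 seqS0 h0 rfl seq_ok.2
  refine ⟨ι, fun a ha => ?_, fun a b => p2 a b (Nat.zero_le _), fun i hi => ?_⟩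
  · have := p1 a (Nat.zero_le _) ha
    exact ⟨by omega, this.2.2⟩
  · rcases p3 i (Nat.zero_le _) (by omega) with h | ⟨a, _, h1, h2⟩
    · exact Or.inl h
    · exact Or.inr ⟨a, h1, h2⟩

open Matrix
def bmat (r : Z47 → F2) : Matrix (Fin 48) (Fin 48) F2 := fun i j =>
  Fin.cases (motive := fun _ => F2) (Fin.cases (motive := fun _ => F2) 0 (fun _ => 1) j)
    (fun i' => Fin.cases (motive := fun _ => F2) 1 (fun j' => r ((i' : Z47) - (j' : Z47))) j) i

abbrev sc (j : Z47) : Fin 48 := Fin.succ (n := 47) j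

theorem bmat_00 (r) : bmat r 0 0 = 0 := rfl
theorem bmat_0s (r) (j : Z47) : bmat r 0 (sc j) = 1 := rfl
theorem bmat_s0 (r) (i : Z47) : bmat r (sc i) 0 = 1 := rfl
theorem bmat_ss (r) (i j : Z47) : bmat r (sc i) (sc j) = r (i - j) := rfl

theorem sum48 (f : Fin 48 → F2) : ∑ i, f i = f 0 + ∑ j : Z47, f (sc j) := Fin.sum_univ_succ (n := 47) f
theorem sum48N (f : Fin 48 → ℕ) : ∑ i, f i = f 0 + ∑ j : Z47, f (sc j) := Fin.sum_univ_succ (n := 47) f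
theorem all48 {p : Fin 48 → Prop} (h0 : p 0) (hs : ∀ j : Z47, p (sc j)) : ∀ i, p i :=
  fun i => Fin.cases (n := 47) h0 hs i

theorem isBorder_bmat (r : Z47 → F2) : IsBorderMatrix (n := 47) (bmat r) := by
  refine ⟨rfl, ?_, ?_, circulant (n := Fin 47) r, ⟨r, rfl⟩, fun i j => rfl⟩
  · exact all48 (p := fun j => j ≠ 0 → bmat r 0 j = 1) (fun h => absurd rfl h) (fun j _ => rfl)
  · exact all48 (p := fun j => j ≠ 0 → bmat r j 0 = 1) (fun h => absurd rfl h) (fun j _ => rfl)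

theorem border_eq {B : Matrix (Fin 48) (Fin 48) F2} (h : IsBorderMatrix (n := 47) B) : ∃ r, B = bmat r := by
  obtain ⟨h0, h1, h2, R, ⟨v, rfl⟩, h3⟩ := h
  refine ⟨v, ?_⟩
  funext i j
  revert i
  refine all48 ?_ ?_
  · revert j
    exact all48 h0 (fun j => h1 _ (Fin.succ_ne_zero _))
  · intro i
    revert j
    exact all48 (h2 _ (Fin.succ_ne_zero _)) (fun j => h3 i j)

abbrev Wd := Fin 48 ⊕ Fin 48 → F2
def code (r : Z47 → F2) : Submodule F2 Wd := borderedDCC (n := 47) (bmat r)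
def xL (x : Wd) : Fin 48 → F2 := fun i => x (Sum.inl i)
def xR (x : Wd) : Fin 48 → F2 := fun i => x (Sum.inr i)
def lz (x : Wd) : F2 := x (Sum.inl 0)
def rz (x : Wd) : F2 := x (Sum.inr 0)
def lv (x : Wd) : Z47 → F2 := fun j => x (Sum.inl (sc j))
def rv (x : Wd) : Z47 → F2 := fun j => x (Sum.inr (sc j))

theorem mem_iffM (B : Matrix (Fin 48) (Fin 48) F2) (x : Wd) :
    x ∈ borderedDCC (n := 47) B ↔ xR x = Matrix.vecMul (xL x) B := by
  unfold borderedDCC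
  rw [Submodule.mem_span_range_iff_exists_fun]
  constructor
  · rintro ⟨c, rfl⟩
    have hL : xL (∑ i : Fin (47 + 1), c i • (Sum.elim (fun j => if j = i then (1 : ZMod 2) else 0) (B i) : Wd)) = c := by
      funext j
      unfold xL
      rw [Finset.sum_apply]
      simp
    rw [hL]
    funext j
    unfold xR
    rw [Finset.sum_apply]
    simp [Matrix.vecMul, dotProduct]
  · intro h
    refine ⟨xL x, ?_⟩
    funext j
    rw [Finset.sum_apply]
    cases j with
    | inl j => simp [xL]
    | inr j =>
      have := congrFun h j
      simp only [xR, Matrix.vecMul, dotProduct] at this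
      rw [this]
      simp

theorem mem_iff (r : Z47 → F2) (x : Wd) :
    x ∈ code r ↔ rz x = ∑ j, lv x j ∧ ∀ i, rv x i = lz x + ∑ j, lv x j * r (j - i) := by
  unfold code
  rw [mem_iffM]
  constructor
  · intro h
    refine ⟨?_, fun i => ?_⟩
    · have := congrFun h 0
      simp only [Matrix.vecMul, dotProduct, sum48, bmat_00, bmat_s0, mul_zero, zero_add, mul_one] at this
      exact this
    · have := congrFun h (sc i)
      simp only [Matrix.vecMul, dotProduct, sum48, bmat_0s, bmat_ss, mul_one] at this
      exact this
  · rintro ⟨h0, h1⟩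
    funext i
    revert i
    refine all48 ?_ fun i => ?_
    · simp only [Matrix.vecMul, dotProduct, sum48, bmat_00, bmat_s0, mul_zero, zero_add, mul_one]
      exact h0
    · simp only [Matrix.vecMul, dotProduct, sum48, bmat_0s, bmat_ss, mul_one]
      exact h1 i

theorem dot_eq (x y : Wd) : dot x y = xL x ⬝ᵥ xL y + xR x ⬝ᵥ xR y := by
  unfold dot
  rw [Fintype.sum_sum_type]; rfl

theorem f2_add_self (a : F2) : a + a = 0 := by revert a; decide

theorem sum_ac {r : Z47 → F2} (h : ac r = eps) : ∑ j, r j = 0 := by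
  have h1 : ∑ t, ac r t = (∑ j, r j) * (∑ j, r j) := by
    unfold ac
    rw [Finset.sum_comm, Finset.sum_mul]
    refine Finset.sum_congr rfl fun j _ => ?_
    rw [← Finset.mul_sum]
    exact congrArg (r j * ·) (Equiv.sum_comp (Equiv.addLeft j) r)
  rw [h] at h1
  have h2 : ∑ t, eps t = 0 := by decide +kernel
  rw [h2] at h1
  exact (mul_self_eq_zero.1 h1.symm)

theorem bmat_orth {r : Z47 → F2} (h : ac r = eps) : bmat r * (bmat r).transpose = 1 := by
  have hs := sum_ac h
  have hs' : ∀ i : Z47, ∑ j, r (i - j) = 0 := fun i => by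
    rw [← hs]; exact Equiv.sum_comp (Equiv.subLeft i) r
  have h47 : ∑ _j : Z47, (1 : F2) = 1 := by decide +kernel
  ext i j
  simp only [Matrix.mul_apply, Matrix.transpose_apply, sum48]
  revert i j
  refine all48 (all48 ?_ fun j => ?_) (fun i => all48 ?_ fun j => ?_)
  · simp only [bmat_00, bmat_0s, mul_one, zero_mul, h47]; rfl
  · simp only [bmat_00, bmat_0s, bmat_s0, bmat_ss, one_mul, mul_one, hs']
    refine Eq.trans (by decide) (Matrix.one_apply_ne (Fin.succ_ne_zero _).symm).symm
  · simp only [bmat_00, bmat_0s, bmat_s0, bmat_ss, mul_one, hs']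
    refine Eq.trans (by decide) (Matrix.one_apply_ne (Fin.succ_ne_zero _)).symm
  · simp only [bmat_s0, bmat_ss, mul_one]
    have h1 : ∑ k : Z47, r (i - k) * r (j - k) = eps (j - i) := by
      rw [← h]
      unfold ac
      rw [← Equiv.sum_comp (Equiv.subLeft i)]
      refine Finset.sum_congr rfl fun k _ => ?_
      rw [Equiv.subLeft_apply, sub_sub_cancel, show j - (i - k) = k + (j - i) by ring]
    rw [h1]
    unfold eps
    by_cases hij : i = j
    · subst hij
      rw [if_pos (sub_self _), add_zero]
      exact (Matrix.one_apply_eq _).symm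
    · rw [if_neg (by intro h; exact hij (sub_eq_zero.1 h).symm)]
      exact Eq.trans (by decide) (Matrix.one_apply_ne (by intro h; exact hij (Fin.succ_injective 47 h))).symm

theorem code_orth {r : Z47 → F2} (h : ac r = eps) {x y : Wd} (hx : x ∈ code r) (hy : y ∈ code r) : dot x y = 0 := by
  unfold code at hx hy
  rw [mem_iffM] at hx hy
  rw [dot_eq, hx, hy, ← Matrix.mulVec_transpose (bmat r) (xL y), Matrix.dotProduct_mulVec, Matrix.vecMul_vecMul,
    bmat_orth h, Matrix.vecMul_one]
  exact f2_add_self _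

theorem code_back {r : Z47 → F2} (h : ac r = eps) {x : Wd} (hx : x ∈ code r) :
    lz x = ∑ j, rv x j ∧ ∀ i, lv x i = rz x + conv r (rv x) i := by
  unfold code at hx
  rw [mem_iffM] at hx
  have h1 : xL x = Matrix.vecMul (xR x) (bmat r).transpose := by
    rw [hx, Matrix.vecMul_vecMul, bmat_orth h, Matrix.vecMul_one]
  refine ⟨?_, fun i => ?_⟩
  · have := congrFun h1 0
    simp only [Matrix.vecMul, dotProduct, sum48, Matrix.transpose_apply, bmat_00, bmat_0s, mul_zero, zero_add, mul_one] at this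
    exact this
  · have := congrFun h1 (sc i)
    simp only [Matrix.vecMul, dotProduct, sum48, Matrix.transpose_apply, bmat_s0, bmat_ss, mul_one] at this
    refine this.trans ?_
    exact congrArg (rz x + ·) (Finset.sum_congr rfl fun j _ => mul_comm _ _)

theorem gen_mem (r : Z47 → F2) (i : Fin 48) :
    (Sum.elim (fun j => if j = i then (1 : ZMod 2) else 0) (bmat r i) : Wd) ∈ code r :=
  Submodule.subset_span ⟨i, rfl⟩

theorem dot_gen (x : Wd) (r : Z47 → F2) (i : Fin 48) :
    dot x (Sum.elim (fun j => if j = i then (1 : ZMod 2) else 0) (bmat r i)) = x (Sum.inl i) + ∑ j, x (Sum.inr j) * bmat r i j := by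
  unfold dot
  rw [Fintype.sum_sum_type]
  simp

theorem ac_of_selfDual {r : Z47 → F2} (h : IsSelfDual (code r)) : ac r = eps := by
  funext t
  have h1 := (h _).1 (gen_mem r (sc t)) _ (gen_mem r (sc 0))
  rw [dot_gen] at h1
  simp only [Sum.elim_inl, Sum.elim_inr, sum48, bmat_s0, bmat_ss, one_mul] at h1
  have h2 : ∑ j : Z47, r (t - j) * r (0 - j) = ac r t := by
    unfold ac
    rw [← Equiv.sum_comp (Equiv.neg Z47)]
    refine Finset.sum_congr rfl fun k _ => ?_
    rw [Equiv.neg_apply, mul_comm, show (0 : Z47) - -k = k by ring, show t - -k = k + t by ring]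
  rw [h2] at h1
  unfold eps
  by_cases ht : t = 0
  · subst ht
    rw [if_pos rfl, ← add_assoc] at h1
    rw [if_pos rfl]
    have e : (1 : F2) + 1 = 0 := by decide
    rw [e, zero_add] at h1; exact h1
  · rw [if_neg (by intro h; exact ht (Fin.succ_injective 47 h).symm), zero_add] at h1
    rw [if_neg ht]
    revert h1; generalize ac r t = a; revert a; decide

theorem tr_mul {n : ℕ} (A : Matrix (Fin n) (Fin n) F2) (h : A * A.transpose = 1) : A.transpose * A = 1 :=
  mul_eq_one_comm.1 h

theorem selfDual {r : Z47 → F2} (h : ac r = eps) : IsSelfDual (code r) := by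
  intro x
  refine ⟨fun hx y hy => code_orth h hx hy, fun hx => ?_⟩
  have e : ∀ i, xL x i + (bmat r *ᵥ xR x) i = 0 := by
    intro i
    have := hx _ (gen_mem r i)
    rw [dot_gen] at this
    rw [← this, show (bmat r *ᵥ xR x) i = bmat r i ⬝ᵥ xR x from rfl, dotProduct_comm]
    unfold dotProduct
    rfl
  have e2 : xL x = bmat r *ᵥ xR x := by
    funext i
    have := e i
    revert this; generalize xL x i = a; generalize (bmat r *ᵥ xR x) i = b; revert a b; decide
  unfold code
  rw [mem_iffM, e2, ← Matrix.mulVec_transpose, Matrix.mulVec_mulVec, tr_mul _ (bmat_orth h), Matrix.one_mulVec]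

def nz (a : F2) : ℕ := if a ≠ 0 then 1 else 0

theorem hn_sum {ι : Type*} [Fintype ι] (u : ι → F2) : hammingNorm u = ∑ i, nz (u i) := by
  unfold hammingNorm nz; rw [Finset.card_filter]

theorem wt_split (x : Wd) : hammingNorm x = nz (lz x) + hammingNorm (lv x) + (nz (rz x) + hammingNorm (rv x)) := by
  rw [hn_sum, Fintype.sum_sum_type, sum48N, sum48N, hn_sum, hn_sum]; rfl

theorem nz_sum {ι : Type*} [Fintype ι] (u : ι → F2) : nz (∑ i, u i) = hammingNorm u % 2 := by
  have h : ((hammingNorm u : ℕ) : F2) = ∑ i, u i := by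
    rw [hn_sum]
    push_cast
    refine Finset.sum_congr rfl fun i _ => ?_
    generalize u i = a; revert a; decide
  rw [← h]
  unfold nz
  rcases Nat.mod_two_eq_zero_or_one (hammingNorm u) with h1 | h1
  · rw [h1, if_neg]
    simp only [not_not]
    exact (ZMod.natCast_eq_zero_iff _ 2).2 (Nat.dvd_of_mod_eq_zero h1)
  · rw [h1, if_pos]
    intro h2
    have := Nat.mod_eq_zero_of_dvd ((ZMod.natCast_eq_zero_iff _ 2).1 h2)
    omega

theorem hn_compl (u : Z47 → F2) : hammingNorm (fun i => 1 + u i) + hammingNorm u = 47 := by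
  rw [hn_sum, hn_sum, ← Finset.sum_add_distrib]
  have : ∀ a : F2, nz (1 + a) + nz a = 1 := by decide
  simp [this]

theorem lv_conv (r : Z47 → F2) (u : Z47 → F2) (i : Z47) : ∑ j, u j * r (j - i) = conv r (fun j => u (-j)) (-i) := by
  unfold conv
  rw [← Equiv.sum_comp (Equiv.neg Z47)]
  refine Finset.sum_congr rfl fun k _ => ?_
  rw [Equiv.neg_apply, mul_comm, show -i - k = -k - i by ring]

theorem hn_neg (u : Z47 → F2) : hammingNorm (fun j => u (-j)) = hammingNorm u := hn_equiv (Equiv.neg Z47) u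

/-- word with prescribed left part -/
def mkW (r : Z47 → F2) (a : F2) (u : Z47 → F2) : Wd :=
  Sum.elim (fun i => Fin.cases (n := 47) (motive := fun _ => F2) a u i)
    (fun i => Fin.cases (n := 47) (motive := fun _ => F2) (∑ j, u j) (fun (i' : Z47) => a + ∑ j, u j * r (j - i')) i)

theorem mkW_mem (r a u) : mkW r a u ∈ code r := (mem_iff r _).2 ⟨rfl, fun _ => rfl⟩

theorem wit_word {r : Z47 → F2} {w : ℕ} (h : Wit r w) : ∃ x ∈ code r, x ≠ 0 ∧ hammingNorm x = w := by
  obtain ⟨m, h1, h2⟩ := h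
  have hc : ∀ a i, rv (mkW r a (fun j => m (-j))) i = a + conv r m (-i) := by
    intro a i
    show a + ∑ j, (fun j => m (-j)) j * r (j - i) = _
    rw [lv_conv]; simp only [neg_neg]
  have hl : ∀ a, hammingNorm (lv (mkW r a (fun j => m (-j)))) = hammingNorm m := fun a => hn_neg m
  have hr : ∀ a, nz (rz (mkW r a (fun j => m (-j)))) = hammingNorm m % 2 := by
    intro a
    show nz (∑ j, (fun j => m (-j)) j) = _
    rw [nz_sum, hn_neg]
  have hw : ∀ a, mkW r a (fun j => m (-j)) ≠ 0 := by
    intro a h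
    have := hl a
    rw [h] at this
    have e : lv (0 : Wd) = 0 := rfl
    rw [e, hammingNorm_zero] at this
    omega
  rcases h2 with h2 | h2
  · refine ⟨mkW r 0 (fun j => m (-j)), mkW_mem _ _ _, hw _, ?_⟩
    rw [wt_split, hl, hr, show rv (mkW r 0 (fun j => m (-j))) = fun j => conv r m (-j) by funext i; rw [hc, zero_add], hn_neg]
    have : nz (lz (mkW r 0 (fun j => m (-j)))) = 0 := rfl
    omega
  · refine ⟨mkW r 1 (fun j => m (-j)), mkW_mem _ _ _, hw _, ?_⟩
    rw [wt_split, hl, hr, show rv (mkW r 1 (fun j => m (-j))) = fun i => 1 + conv r m (-i) by funext i; rw [hc]]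
    have h3 := hn_compl (fun j => conv r m (-j))
    rw [hn_neg] at h3
    have : nz (lz (mkW r 1 (fun j => m (-j)))) = 1 := rfl
    omega

theorem wit_affine {r : Z47 → F2} {w : ℕ} (h : Wit r w) {m : Z47} (hm : m ≠ 0) (s : Z47) : Wit (affine m s r) w := by
  obtain ⟨u, h1, h2⟩ := h
  have e1 : hammingNorm (fun j => u (m * j)) = hammingNorm u := hn_equiv (Equiv.mulLeft₀ m hm) u
  have e2 : hammingNorm (conv (affine m s r) (fun j => u (m * j))) = hammingNorm (conv r u) := by
    have : conv (affine m s r) (fun j => u (m * j)) =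
        fun i => conv r u (((Equiv.mulLeft₀ m hm).trans (Equiv.addRight s)) i) := by
      funext i
      unfold conv affine
      rw [← Equiv.sum_comp (Equiv.mulLeft₀ m hm) (fun j => r (((Equiv.mulLeft₀ m hm).trans (Equiv.addRight s)) i - j) * u j)]
      refine Finset.sum_congr rfl fun j _ => ?_
      simp only [Equiv.trans_apply, Equiv.mulLeft₀_apply, Equiv.coe_addRight]
      rw [show m * (i - j) + s = m * i + s - m * j by ring]
    rw [this, hn_equiv]
  exact ⟨fun j => u (m * j), by rw [e1]; exact h1, by rw [e1, e2]; exact h2⟩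

theorem wit_eps : Wit eps 4 := by
  refine ⟨fun j => if j = 0 ∨ j = 1 then 1 else 0, ?_, Or.inl ?_⟩
  · decide +kernel
  · decide +kernel

theorem f2c (a : F2) : a = 0 ∨ a = 1 := by revert a; decide

/-- parity relations on both sides -/
theorem half {r u v : Z47 → F2} {a : F2} (hB : ∀ w : Z47 → F2, 1 ≤ hammingNorm w → hammingNorm w ≤ 6 →
      Bd (hammingNorm w) (hammingNorm (conv r w)))
    (hp : nz a = hammingNorm v % 2) (e : ∀ i, v i = a + conv r u i) :
    (hammingNorm v % 2 = 0 → (1 ≤ hammingNorm u → hammingNorm u ≤ 6 → 13 ≤ hammingNorm u + hammingNorm u % 2 + hammingNorm v) ∧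
      (hammingNorm u = 0 → hammingNorm v = 0)) ∧
    (hammingNorm v % 2 = 1 → (1 ≤ hammingNorm u → hammingNorm u ≤ 5 → 12 ≤ hammingNorm u + hammingNorm u % 2 + hammingNorm v) ∧
      (hammingNorm u = 0 → hammingNorm v = 47)) := by
  have h0 : hammingNorm u = 0 → hammingNorm (conv r u) = 0 := by
    intro h
    have : u = 0 := hammingNorm_eq_zero.1 h
    subst this
    rw [hammingNorm_eq_zero]
    funext i
    simp [conv]
  have hB := hB u
  rcases f2c a with rfl | rfl
  · have hv : v = conv r u := by funext i; rw [e, zero_add]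
    rw [← hv] at hB h0
    have : nz (0 : F2) = 0 := rfl
    rw [this] at hp
    refine ⟨fun _ => ⟨fun h1 h2 => (hB h1 h2).1, h0⟩, fun h => by omega⟩
  · have hv : v = fun i => 1 + conv r u i := by funext i; rw [e]
    have hc := hn_compl (conv r u)
    rw [← hv] at hc
    have : nz (1 : F2) = 1 := rfl
    rw [this] at hp
    refine ⟨fun h => by omega, fun _ => ⟨fun h1 h2 => ?_, fun h => ?_⟩⟩
    · have := (hB h1 (by omega)).2 h2
      omega
    · have := h0 h; omega

theorem min13 {r : Z47 → F2} (h : ac r = eps) (hB : ∀ w : Z47 → F2, 1 ≤ hammingNorm w → hammingNorm w ≤ 6 →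
      Bd (hammingNorm w) (hammingNorm (conv r w))) {x : Wd} (hx : x ∈ code r) (h0 : x ≠ 0) : 13 ≤ hammingNorm x := by
  obtain ⟨a1, a2⟩ := (mem_iff r x).1 hx
  obtain ⟨b1, b2⟩ := code_back h hx
  have hr : nz (rz x) = hammingNorm (lv x) % 2 := by rw [a1, nz_sum]
  have hl : nz (lz x) = hammingNorm (rv x) % 2 := by rw [b1, nz_sum]
  have H1 := half hB (u := rv x) (v := lv x) hr b2
  have H2 := half hB (u := fun j => lv x (-j)) (v := fun j => rv x (-j)) (a := lz x) (by rw [hn_neg]; exact hl)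
    (fun i => by rw [a2, lv_conv, neg_neg])
  rw [hn_neg, hn_neg] at H2
  have hw := wt_split x
  have hpos : hammingNorm x ≠ 0 := fun h => h0 (hammingNorm_eq_zero.1 h)
  rw [hr, hl] at hw
  generalize hammingNorm (lv x) = n at *
  generalize hammingNorm (rv x) = p at *
  generalize hammingNorm x = w at *
  rcases Nat.mod_two_eq_zero_or_one n with hn | hn <;> rcases Nat.mod_two_eq_zero_or_one p with hp | hp <;>
    simp only [hn, hp, true_imp_iff, Nat.zero_ne_one, Nat.one_ne_zero, false_imp_iff, and_true, true_and] at H1 H2 hw <;> omega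

theorem hn_add (x y : Wd) : hammingNorm (x + y) + 2 * hammingNorm (fun i => x i * y i) = hammingNorm x + hammingNorm y := by
  rw [hn_sum, hn_sum, hn_sum, hn_sum, Finset.mul_sum, ← Finset.sum_add_distrib, ← Finset.sum_add_distrib]
  refine Finset.sum_congr rfl fun i _ => ?_
  show nz (x i + y i) + 2 * nz (x i * y i) = _
  generalize x i = a; generalize y i = b; revert a b; decide

theorem hn_dot (x y : Wd) (h : dot x y = 0) : hammingNorm (fun i => x i * y i) % 2 = 0 := by
  rw [← nz_sum]
  have : ∑ i, x i * y i = 0 := h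
  rw [this]; rfl

theorem doubly_even {r : Z47 → F2} (h : ac r = eps) (hr : hammingNorm r % 4 = 2) {x : Wd} (hx : x ∈ code r) :
    hammingNorm x % 4 = 0 := by
  have hx' : x ∈ Submodule.span (ZMod 2) (Set.range fun i : Fin 48 =>
      (Sum.elim (fun j => if j = i then (1 : ZMod 2) else 0) (bmat r i) : Wd)) := hx
  refine Submodule.span_induction (p := fun x _ => hammingNorm x % 4 = 0) ?_ ?_ ?_ ?_ hx'
  · rintro _ ⟨i, rfl⟩
    show hammingNorm (Sum.elim (fun j => if j = i then (1 : ZMod 2) else 0) (bmat r i) : Wd) % 4 = 0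
    rw [hn_sum, Fintype.sum_sum_type]
    have e1 : ∑ j : Fin 48, nz ((Sum.elim (fun j => if j = i then (1 : ZMod 2) else 0) (bmat r i) : Wd) (Sum.inl j)) = 1 := by
      simp only [Sum.elim_inl]
      rw [Finset.sum_eq_single i]
      · simp [nz]
      · intro b _ hb; simp [nz, hb]
      · intro h; exact absurd (Finset.mem_univ _) h
    rw [e1]
    simp only [Sum.elim_inr]
    rw [sum48N]
    revert i
    refine all48 (fun _ => ?_) (fun i _ => ?_)
    · simp only [bmat_00, bmat_0s]
      decide +kernel
    · simp only [bmat_s0, bmat_ss]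
      rw [← hn_sum (fun j => r (i - j)), show hammingNorm (fun j => r (i - j)) = hammingNorm r from hn_equiv (Equiv.subLeft i) r]
      have : nz (1 : F2) = 1 := rfl
      omega
  · simp
  · intro x y hx hy h1 h2
    have h3 := hn_add x y
    have h4 := hn_dot x y (code_orth h hx hy)
    omega
  · intro a x _ hx
    rcases f2c a with rfl | rfl
    · rw [zero_smul]; simp
    · rw [one_smul]; exact hx

theorem good_min {r : Z47 → F2} (h : ac r = eps) (hB : ∀ w : Z47 → F2, 1 ≤ hammingNorm w → hammingNorm w ≤ 6 →
      Bd (hammingNorm w) (hammingNorm (conv r w))) (hr : hammingNorm r % 4 = 2) (hw : Wit r 16) : MinWeightIs (code r) 16 := by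
  refine ⟨wit_word hw, fun x hx h0 => ?_⟩
  have h1 := min13 h hB hx h0
  have h2 := doubly_even h hr hx
  omega

theorem codeEquiv_iff (C C' : Submodule F2 Wd) : CodeEquiv C C' ↔ ∃ σ : Equiv.Perm (Fin 48 ⊕ Fin 48), ∀ x : Wd, x ∈ C ↔ x ∘ σ ∈ C' := by
  unfold CodeEquiv
  refine exists_congr fun σ => ?_
  constructor
  · rintro rfl x
    refine ⟨fun h => ⟨x, h, rfl⟩, ?_⟩
    rintro ⟨y, hy, e⟩
    have : y = x := by
      funext i
      have := congrFun e (σ.symm i)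
      simpa [LinearMap.funLeft] using this
    rw [← this]; exact hy
  · intro h
    ext y
    constructor
    · rintro ⟨x, hx, rfl⟩
      exact (h x).1 hx
    · intro hy
      refine ⟨y ∘ σ.symm, (h _).2 ?_, ?_⟩
      · rw [Function.comp_assoc]; simpa using hy
      · funext i; simp [LinearMap.funLeft]

def ext48 (π : Equiv.Perm Z47) : Equiv.Perm (Fin 48) where
  toFun i := Fin.cases (n := 47) (motive := fun _ => Fin 48) 0 (fun j => sc (π j)) i
  invFun i := Fin.cases (n := 47) (motive := fun _ => Fin 48) 0 (fun j => sc (π.symm j)) i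
  left_inv := all48 rfl (fun j => by show sc (π.symm (π j)) = _; rw [Equiv.symm_apply_apply])
  right_inv := all48 rfl (fun j => by show sc (π (π.symm j)) = _; rw [Equiv.apply_symm_apply])

theorem equiv_affine (r : Z47 → F2) {m : Z47} (hm : m ≠ 0) (s : Z47) : CodeEquiv (code r) (code (affine m s r)) := by
  rw [codeEquiv_iff]
  let p1 : Equiv.Perm Z47 := (Equiv.mulLeft₀ m hm).trans (Equiv.addRight s)
  let p2 : Equiv.Perm Z47 := Equiv.mulLeft₀ m hm
  refine ⟨Equiv.sumCongr (ext48 p1) (ext48 p2), fun x => ?_⟩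
  rw [mem_iff, mem_iff]
  have e1 : rz (x ∘ (Equiv.sumCongr (ext48 p1) (ext48 p2))) = rz x := rfl
  have e2 : lz (x ∘ (Equiv.sumCongr (ext48 p1) (ext48 p2))) = lz x := rfl
  have e3 : ∀ j, lv (x ∘ (Equiv.sumCongr (ext48 p1) (ext48 p2))) j = lv x (p1 j) := fun _ => rfl
  have e4 : ∀ j, rv (x ∘ (Equiv.sumCongr (ext48 p1) (ext48 p2))) j = rv x (p2 j) := fun _ => rfl
  simp only [e1, e2, e3, e4]
  have e5 : ∑ j, lv x (p1 j) = ∑ j, lv x j := Equiv.sum_comp p1 (lv x)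
  have e6 : ∀ i, ∑ j, lv x (p1 j) * affine m s r (j - i) = ∑ j, lv x j * r (j - p2 i) := by
    intro i
    rw [← Equiv.sum_comp p1 (fun j => lv x j * r (j - p2 i))]
    refine Finset.sum_congr rfl fun j _ => ?_
    have : p1 j - p2 i = m * (j - i) + s := by
      show m * j + s - m * i = _
      ring
    rw [this]; rfl
  simp only [e5, e6]
  exact and_congr_right fun _ => ⟨fun h i => h (p2 i), fun h i => by have := h (p2.symm i); rwa [Equiv.apply_symm_apply] at this⟩

open Pointwise in
theorem syl {G : Type*} [Group G] [Finite G] (p : ℕ) [hp : Fact p.Prime] (a b : G) (ha : orderOf a = p) (hb : orderOf b = p)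
    (hc : ∀ h : G, Commute h a → h ^ (p ^ 2) = 1 → h ∈ Subgroup.zpowers a) : ∃ (g : G) (n : ℕ), g * a * g⁻¹ = b ^ n := by
  have hca : Nat.card (Subgroup.zpowers a) = p := by rw [Nat.card_zpowers, ha]
  have hcb : Nat.card (Subgroup.zpowers b) = p := by rw [Nat.card_zpowers, hb]
  have h0 : Nat.card G ≠ 0 := Nat.card_pos.ne'
  have hdiv : ¬ p ^ 2 ∣ Nat.card G := by
    intro hd
    obtain ⟨K, hK, hle⟩ := Sylow.exists_subgroup_card_pow_succ (p := p) (n := 1) hd (H := Subgroup.zpowers a) (by rw [hca, pow_one])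
    have hcomm := (IsPGroup.isMulCommutative_of_card_eq_prime_sq (p := p) (G := K) hK).is_comm.comm
    have hKa : K ≤ Subgroup.zpowers a := by
      intro h hh
      refine hc h ?_ ?_
      · have := hcomm ⟨h, hh⟩ ⟨a, hle (Subgroup.mem_zpowers a)⟩
        exact congrArg Subtype.val this
      · have := pow_card_eq_one' (G := K) (x := ⟨h, hh⟩)
        rw [hK] at this
        exact congrArg Subtype.val this
    have := Subgroup.card_le_of_le hKa
    rw [hca, hK] at this
    have h2 := hp.out.two_le
    rw [show 1 + 1 = 2 from rfl] at this
    nlinarith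
  have hf : p ^ (Nat.card G).factorization p = p := by
    have h1 : p ∣ Nat.card G := ha ▸ orderOf_dvd_natCard a
    have h2 : (Nat.card G).factorization p = 1 := by
      apply le_antisymm
      · by_contra h
        exact hdiv ((hp.out.pow_dvd_iff_le_factorization h0).2 (by omega))
      · exact (hp.out.pow_dvd_iff_le_factorization h0).1 (by simpa using h1)
    rw [h2, pow_one]
  let P := Sylow.ofCard (Subgroup.zpowers a) (hca.trans hf.symm)
  let Q := Sylow.ofCard (Subgroup.zpowers b) (hcb.trans hf.symm)
  obtain ⟨g, hg⟩ := MulAction.exists_smul_eq G P Q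
  have hmem : g * a * g⁻¹ ∈ Subgroup.zpowers b := by
    have h1 : MulAut.conj g • a ∈ MulAut.conj g • (P : Subgroup G) :=
      Subgroup.smul_mem_pointwise_smul _ _ _ (Subgroup.mem_zpowers a)
    have h2 : MulAut.conj g • (P : Subgroup G) = (Q : Subgroup G) := by
      rw [← hg]; rfl
    rw [h2] at h1
    exact h1
  obtain ⟨n, hn⟩ := (mem_powers_iff_mem_zpowers).2 hmem
  exact ⟨g, n, hn.symm⟩

abbrev XX := Fin 48 ⊕ Fin 48
def shP (c : Z47) : Equiv.Perm XX := Equiv.sumCongr (ext48 (Equiv.addRight c)) (ext48 (Equiv.addRight c))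
def pL (j : Z47) : XX := Sum.inl (sc j)
def pR (j : Z47) : XX := Sum.inr (sc j)
def zL : XX := Sum.inl 0
def zR : XX := Sum.inr 0

theorem sh_L (c j) : shP c (pL j) = pL (j + c) := rfl
theorem sh_R (c j) : shP c (pR j) = pR (j + c) := rfl
theorem sh_zL (c) : shP c zL = zL := rfl
theorem sh_zR (c) : shP c zR = zR := rfl
theorem pL_inj {i j} (h : pL i = pL j) : i = j := Fin.succ_injective 47 (Sum.inl_injective h)
theorem pR_inj {i j} (h : pR i = pR j) : i = j := Fin.succ_injective 47 (Sum.inr_injective h)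
theorem LR {i j} (h : pL i = pR j) : False := by cases h
theorem allX {p : XX → Prop} (h1 : p zL) (h2 : p zR) (h3 : ∀ j, p (pL j)) (h4 : ∀ j, p (pR j)) : ∀ x, p x := by
  rintro (x | x)
  · exact all48 (p := fun i => p (Sum.inl i)) h1 h3 x
  · exact all48 (p := fun i => p (Sum.inr i)) h2 h4 x

theorem sh_add (c d) : shP (c + d) = shP c * shP d := by
  refine Equiv.ext (allX rfl rfl (fun j => ?_) (fun j => ?_))
  · rw [Equiv.Perm.mul_apply, sh_L, sh_L, sh_L, add_comm c, add_assoc]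
  · rw [Equiv.Perm.mul_apply, sh_R, sh_R, sh_R, add_comm c, add_assoc]
theorem sh_0 : shP 0 = 1 := by
  refine Equiv.ext (allX rfl rfl (fun j => ?_) (fun j => ?_))
  · rw [sh_L, add_zero]; rfl
  · rw [sh_R, add_zero]; rfl
theorem sh_pow (n : ℕ) : shP 1 ^ n = shP (n : Z47) := by
  induction n with
  | zero => rw [pow_zero, Nat.cast_zero, sh_0]
  | succ n ih => rw [pow_succ, ih, Nat.cast_succ, sh_add]
theorem sh_ne (c : Z47) (h : shP c = 1) : c = 0 := by
  have h1 : shP c (pL 0) = pL 0 := by rw [h]; rfl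
  rw [sh_L, zero_add] at h1
  exact pL_inj h1
theorem sh_order : orderOf (shP 1) = 47 := by
  refine orderOf_eq_prime ?_ ?_
  · rw [sh_pow]
    exact sh_0
  · intro h
    exact absurd (sh_ne 1 h) one_ne_zero

def Aut (C : Submodule F2 Wd) : Subgroup (Equiv.Perm XX) where
  carrier := {σ | ∀ x : Wd, x ∈ C ↔ x ∘ σ ∈ C}
  one_mem' := fun x => Iff.rfl
  mul_mem' := fun {a b} ha hb x => (ha x).trans (hb (x ∘ a))
  inv_mem' := fun {a} ha x => by
    have := ha (x ∘ (a⁻¹ : Equiv.Perm XX))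
    rw [this]
    have e : (x ∘ (a⁻¹ : Equiv.Perm XX)) ∘ a = x := by
      funext i; simp
    rw [e]

theorem code_sh (r : Z47 → F2) (c : Z47) : shP c ∈ Aut (code r) := by
  intro x
  rw [mem_iff, mem_iff]
  have e1 : rz (x ∘ shP c) = rz x := rfl
  have e2 : lz (x ∘ shP c) = lz x := rfl
  have e3 : ∀ j, lv (x ∘ shP c) j = lv x (j + c) := fun _ => rfl
  have e4 : ∀ j, rv (x ∘ shP c) j = rv x (j + c) := fun _ => rfl
  simp only [e1, e2, e3, e4]
  have e5 : ∑ j, lv x (j + c) = ∑ j, lv x j := Equiv.sum_comp (Equiv.addRight c) (lv x)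
  have e6 : ∀ i, ∑ j, lv x (j + c) * r (j - i) = ∑ j, lv x j * r (j - (i + c)) := by
    intro i
    rw [← Equiv.sum_comp (Equiv.addRight c) (fun j => lv x j * r (j - (i + c)))]
    refine Finset.sum_congr rfl fun j _ => ?_
    rw [Equiv.coe_addRight, add_sub_add_right_eq_sub]
  simp only [e5, e6]
  exact and_congr_right fun _ => ⟨fun h i => h (i + c), fun h i => by have := h (i - c); rwa [sub_add_cancel] at this⟩

theorem orb {ν : Equiv.Perm XX} {m : Z47} (h : ∀ x, ν (shP 1 x) = shP m (ν x)) (n : ℕ) (x) : ν (shP (n : Z47) x) = shP (m * n) (ν x) := by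
  induction n with
  | zero => rw [Nat.cast_zero, mul_zero, sh_0]; rfl
  | succ n ih =>
    rw [Nat.cast_succ, add_comm, sh_add, Equiv.Perm.mul_apply, h, ih, ← Equiv.Perm.mul_apply, ← sh_add]
    rw [mul_add, mul_one]

theorem orb' {ν : Equiv.Perm XX} {m : Z47} (h : ∀ x, ν (shP 1 x) = shP m (ν x)) (c : Z47) (x) : ν (shP c x) = shP (m * c) (ν x) := by
  have := orb h c.val x
  rwa [ZMod.natCast_zmod_val] at this

def Zid (ν : Equiv.Perm XX) : Prop := ν zL = zL ∧ ν zR = zR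
def Zsw (ν : Equiv.Perm XX) : Prop := ν zL = zR ∧ ν zR = zL
def Cid (ν : Equiv.Perm XX) (m a b : Z47) : Prop := ∀ j, ν (pL j) = pL (m * j + a) ∧ ν (pR j) = pR (m * j + b)
def Csw (ν : Equiv.Perm XX) (m a b : Z47) : Prop := ∀ j, ν (pL j) = pR (m * j + a) ∧ ν (pR j) = pL (m * j + b)

theorem fixpt {m : Z47} (hm : m ≠ 0) : ∀ x, shP m x = x → x = zL ∨ x = zR := by
  refine allX (fun _ => Or.inl rfl) (fun _ => Or.inr rfl) (fun j h => ?_) (fun j h => ?_)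
  · rw [sh_L] at h
    exact absurd (add_eq_left.1 (pL_inj h)) hm
  · rw [sh_R] at h
    exact absurd (add_eq_left.1 (pR_inj h)) hm

theorem struct {ν : Equiv.Perm XX} {m : Z47} (hm : m ≠ 0) (h : ∀ x, ν (shP 1 x) = shP m (ν x)) :
    (Zid ν ∨ Zsw ν) ∧ ∃ a b, Cid ν m a b ∨ Csw ν m a b := by
  have hL : ν zL = zL ∨ ν zL = zR := fixpt hm _ (by rw [← h, sh_zL])
  have hR : ν zR = zL ∨ ν zR = zR := fixpt hm _ (by rw [← h, sh_zR])
  have hne : ν zL ≠ ν zR := fun e => by cases ν.injective e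
  have hZ : Zid ν ∨ Zsw ν := by
    rcases hL with hL | hL <;> rcases hR with hR | hR
    · exact absurd (hL.trans hR.symm) hne
    · exact Or.inl ⟨hL, hR⟩
    · exact Or.inr ⟨hL, hR⟩
    · exact absurd (hL.trans hR.symm) hne
  have hzz : ∀ x, (ν x = zL ∨ ν x = zR) → x = zL ∨ x = zR := by
    intro x hx
    rcases hZ with ⟨h1, h2⟩ | ⟨h1, h2⟩ <;> rcases hx with hx | hx
    · exact Or.inl (ν.injective (hx.trans h1.symm))
    · exact Or.inr (ν.injective (hx.trans h2.symm))
    · exact Or.inr (ν.injective (hx.trans h2.symm))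
    · exact Or.inl (ν.injective (hx.trans h1.symm))
  have hX : ∀ y : XX, (y = zL ∨ y = zR) ∨ (∃ a, y = pL a) ∨ ∃ a, y = pR a :=
    allX (Or.inl (Or.inl rfl)) (Or.inl (Or.inr rfl)) (fun j => Or.inr (Or.inl ⟨j, rfl⟩)) (fun j => Or.inr (Or.inr ⟨j, rfl⟩))
  have hl : (∃ a, ν (pL 0) = pL a) ∨ ∃ a, ν (pL 0) = pR a := by
    rcases hX (ν (pL 0)) with h1 | h1
    · rcases hzz _ h1 with h2 | h2 <;> cases h2
    · exact h1
  have hr : (∃ a, ν (pR 0) = pL a) ∨ ∃ a, ν (pR 0) = pR a := by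
    rcases hX (ν (pR 0)) with h1 | h1
    · rcases hzz _ h1 with h2 | h2 <;> cases h2
    · exact h1
  have gl : ∀ j, ν (pL j) = shP (m * j) (ν (pL 0)) := fun j => by rw [← orb' h, sh_L, zero_add]
  have gr : ∀ j, ν (pR j) = shP (m * j) (ν (pR 0)) := fun j => by rw [← orb' h, sh_R, zero_add]
  refine ⟨hZ, ?_⟩
  have hms : ∀ a b : Z47, m * (m⁻¹ * (b - a)) = b - a := fun a b => by rw [← mul_assoc, mul_inv_cancel₀ hm, one_mul]
  rcases hl with ⟨a, ha⟩ | ⟨a, ha⟩ <;> rcases hr with ⟨b, hb⟩ | ⟨b, hb⟩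
  · exfalso
    have e : ν (pL (m⁻¹ * (b - a))) = ν (pR 0) := by
      rw [gl, ha, sh_L, hb, hms, add_sub_cancel]
    exact LR (ν.injective e)
  · refine ⟨a, b, Or.inl fun j => ⟨?_, ?_⟩⟩
    · rw [gl, ha, sh_L, add_comm]
    · rw [gr, hb, sh_R, add_comm]
  · refine ⟨a, b, Or.inr fun j => ⟨?_, ?_⟩⟩
    · rw [gl, ha, sh_R, add_comm]
    · rw [gr, hb, sh_L, add_comm]
  · exfalso
    have e : ν (pL (m⁻¹ * (b - a))) = ν (pR 0) := by
      rw [gl, ha, sh_R, hb, hms, add_sub_cancel]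
    exact LR (ν.injective e)

theorem top_mem (r : Z47 → F2) (x : Wd) (h1 : x zL = 1) (h2 : x zR = 0) (h3 : ∀ j, x (pL j) = 0) (h4 : ∀ j, x (pR j) = 1) : x ∈ code r := by
  rw [mem_iff]
  refine ⟨?_, fun i => ?_⟩
  · refine h2.trans (Finset.sum_eq_zero fun j _ => h3 j).symm
  · have e : ∑ j, lv x j * r (j - i) = 0 := Finset.sum_eq_zero fun j _ => by
      rw [show lv x j = 0 from h3 j, zero_mul]
    rw [e, add_zero]
    exact (h4 i).trans h1.symm

def topW : Wd := mkW 0 1 0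
theorem topW_mem (r : Z47 → F2) : topW ∈ code r := by
  refine top_mem r _ rfl ?_ (fun _ => rfl) (fun j => ?_)
  · show ∑ j : Z47, (0 : F2) = 0
    exact Finset.sum_const_zero
  · show (1 : F2) + ∑ j : Z47, (0 : F2) * 0 = 1
    simp
theorem topW_zL : topW zL = 1 := rfl
theorem topW_zR : topW zR = 0 := by
    show ∑ j : Z47, (0 : F2) = 0
    exact Finset.sum_const_zero
theorem topW_L (j) : topW (pL j) = 0 := rfl
theorem topW_R (j) : topW (pR j) = 1 := by
    show (1 : F2) + ∑ j : Z47, (0 : F2) * 0 = 1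
    simp

theorem mix1 {r : Z47 → F2} (hr : ac r = eps) {ν : Equiv.Perm XX} (h : topW ∘ ν ∈ code r) {m a b} (h1 : Zid ν) (h2 : Csw ν m a b) : False := by
  have e := (code_back hr h).2 0
  have q : ∀ j, rv (topW ∘ ν) j = 0 := fun j => by
    show topW (ν (pR j)) = 0
    rw [(h2 j).2, topW_L]
  have q2 : lv (topW ∘ ν) 0 = 1 := by
    show topW (ν (pL 0)) = 1
    rw [(h2 0).1, topW_R]
  have q3 : rz (topW ∘ ν) = 0 := by
    show topW (ν zR) = 0
    rw [h1.2, topW_zR]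
  rw [q2, q3] at e
  unfold conv at e
  simp only [q, mul_zero, Finset.sum_const_zero, add_zero] at e
  exact absurd e (by decide)

theorem mix2 {r : Z47 → F2} {ν : Equiv.Perm XX} (h : topW ∘ ν ∈ code r) {m a b} (h1 : Zsw ν) (h2 : Cid ν m a b) : False := by
  have e := ((mem_iff _ _).1 h).2 0
  have q : ∀ j, lv (topW ∘ ν) j = 0 := fun j => by
    show topW (ν (pL j)) = 0
    rw [(h2 j).1, topW_L]
  have q2 : rv (topW ∘ ν) 0 = 1 := by
    show topW (ν (pR 0)) = 1
    rw [(h2 0).2, topW_R]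
  have q3 : lz (topW ∘ ν) = 0 := by
    show topW (ν zL) = 0
    rw [h1.1, topW_zR]
  rw [q2, q3] at e
  simp only [q, zero_mul, Finset.sum_const_zero, add_zero] at e
  exact absurd e (by decide)

def unitW (r : Z47 → F2) (c : Z47) : Wd := mkW r 0 (fun j => if j = c then 1 else 0)
theorem unitW_zL (r c) : unitW r c zL = 0 := rfl
theorem unitW_zR (r c) : unitW r c zR = 1 := by
  show ∑ j : Z47, (if j = c then (1 : F2) else 0) = 1
  simp
theorem unitW_L (r c j) : unitW r c (pL j) = if j = c then 1 else 0 := rfl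
theorem unitW_R (r c i) : unitW r c (pR i) = r (c - i) := by
  show (0 : F2) + ∑ j : Z47, (if j = c then (1 : F2) else 0) * r (j - i) = r (c - i)
  simp

theorem case_id {r r' : Z47 → F2} {ν : Equiv.Perm XX} (h : ∀ x : Wd, x ∈ code r → x ∘ ν ∈ code r') {m a b : Z47} (hm : m ≠ 0)
    (h1 : Zid ν) (h2 : Cid ν m a b) : r' = affine m (a - b) r := by
  funext j0
  have e := ((mem_iff _ _).1 (h _ (mkW_mem r 0 (fun j => if j = m * j0 + a then 1 else 0)))).2 0
  change (unitW r (m * j0 + a) ∘ ν) (pR 0) = (unitW r (m * j0 + a) ∘ ν) zL + ∑ j, (unitW r (m * j0 + a) ∘ ν) (pL j) * r' (j - 0) at e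
  simp only [Function.comp_apply, (h2 _).1, (h2 _).2, h1.1, unitW_zL, unitW_L, unitW_R, add_left_inj, zero_add, sub_zero, mul_zero,
    mul_right_inj' hm, ite_mul, one_mul, zero_mul, Finset.sum_ite_eq', Finset.mem_univ, if_true] at e
  rw [← e]
  unfold affine
  rw [add_sub_assoc]

theorem case_sw {r r' : Z47 → F2} (hr : ac r' = eps) {ν : Equiv.Perm XX} (h : ∀ x : Wd, x ∈ code r → x ∘ ν ∈ code r') {m a b : Z47} (hm : m ≠ 0)
    (h1 : Zsw ν) (h2 : Csw ν m a b) : r' = affine (-m) (b - a) r := by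
  funext i
  have e := (code_back hr (h _ (mkW_mem r 0 (fun j => if j = b then 1 else 0)))).2 i
  unfold conv at e
  change (unitW r b ∘ ν) (pL i) = (unitW r b ∘ ν) zR + ∑ j, r' (i - j) * (unitW r b ∘ ν) (pR j) at e
  simp only [Function.comp_apply, (h2 _).1, (h2 _).2, h1.2, unitW_zL, unitW_L, unitW_R, zero_add, add_eq_right, mul_eq_zero, hm, false_or,
    mul_ite, mul_one, mul_zero, Finset.sum_ite_eq', Finset.mem_univ, if_true, sub_zero] at e
  rw [← e]
  unfold affine
  rw [show b - (m * i + a) = -m * i + (b - a) by ring]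

theorem no_period {r : Z47 → F2} (hr : ac r = eps) {c : Z47} (h : r = affine 1 c r) : c = 0 := by
  by_contra hc
  have h1 : ∀ j, r (j + c) = r j := fun j => by
    have := congrFun h j
    unfold affine at this
    rw [one_mul] at this
    exact this.symm
  have e0 : ac r 0 = ac r c := by
    unfold ac
    refine Finset.sum_congr rfl fun j _ => ?_
    rw [h1, add_zero]
  rw [hr] at e0
  unfold eps at e0
  rw [if_pos rfl, if_neg hc] at e0
  exact absurd e0 (by decide)

theorem central {r : Z47 → F2} (hr : ac r = eps) {h : Equiv.Perm XX} (hh : h ∈ Aut (code r)) (hc : h * shP 1 = shP 1 * h)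
    (ho : h ^ (47 ^ 2) = 1) : ∃ a, h = shP a := by
  have hx : ∀ x, h (shP 1 x) = shP 1 (h x) := fun x => congrArg (fun f : Equiv.Perm XX => f x) hc
  have hv : ∀ x : Wd, x ∈ code r → x ∘ h ∈ code r := fun x hx => (hh x).1 hx
  obtain ⟨hZ, a, b, hC⟩ := struct one_ne_zero hx
  rcases hZ with hZ | hZ <;> rcases hC with hC | hC
  · have e := no_period hr (case_id hv one_ne_zero hZ hC)
    have e' : a = b := sub_eq_zero.1 e
    subst e'
    refine ⟨a, Equiv.ext (allX hZ.1 hZ.2 (fun j => ?_) (fun j => ?_))⟩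
    · rw [(hC j).1, one_mul, sh_L]
    · rw [(hC j).2, one_mul, sh_R]
  · exact (mix1 hr (hv _ (topW_mem r)) hZ hC).elim
  · exact (mix2 (hv _ (topW_mem r)) hZ hC).elim
  · exfalso
    have h2 : ∀ n : ℕ, (h ^ (2 * n)) zL = zL := by
      intro n
      induction n with
      | zero => rfl
      | succ n ih =>
        rw [mul_add, pow_add, Equiv.Perm.mul_apply, mul_one, pow_two, Equiv.Perm.mul_apply, hZ.1, hZ.2, ih]
    have h3 : (h ^ (47 ^ 2)) zL = zR := by
      rw [show 47 ^ 2 = 1 + 2 * 1104 by norm_num, pow_add, Equiv.Perm.mul_apply, h2, pow_one, hZ.1]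
    rw [ho] at h3
    cases h3

theorem equiv_imp {r r' : Z47 → F2} (hr' : ac r' = eps) (h : CodeEquiv (code r) (code r')) :
    ∃ m s, m ≠ 0 ∧ r' = affine m s r := by
  obtain ⟨τ, hτ⟩ := (codeEquiv_iff _ _).1 h
  have hb : τ⁻¹ * shP 1 * τ ∈ Aut (code r') := by
    intro x
    have e1 := hτ ((x ∘ (τ⁻¹ : Equiv.Perm XX)) ∘ shP 1)
    have e2 := hτ (x ∘ (τ⁻¹ : Equiv.Perm XX))
    have e3 := code_sh r 1 (x ∘ (τ⁻¹ : Equiv.Perm XX))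
    have e : (x ∘ (τ⁻¹ : Equiv.Perm XX)) ∘ τ = x := by
      funext i; simp
    rw [e] at e2
    exact e2.symm.trans (e3.trans e1)
  have hob : orderOf (τ⁻¹ * shP 1 * τ) = 47 := by
    have : SemiconjBy τ⁻¹ (shP 1) (τ⁻¹ * shP 1 * τ) := by
      show τ⁻¹ * shP 1 = τ⁻¹ * shP 1 * τ * τ⁻¹
      group
    rw [← this.orderOf_eq, sh_order]
  obtain ⟨⟨g, hg⟩, n, e⟩ := syl (G := Aut (code r')) 47 ⟨shP 1, code_sh r' 1⟩ ⟨_, hb⟩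
    (by rw [Subgroup.orderOf_mk]; exact sh_order) (by rw [Subgroup.orderOf_mk]; exact hob) (by
      rintro ⟨k, hk⟩ hc ho
      have ho' : k ^ (47 ^ 2) = 1 := by
        rw [← Subgroup.coe_mk (Aut (code r')) k hk, ← Subgroup.coe_pow, ho, Subgroup.coe_one]
      obtain ⟨a, ha⟩ := central hr' hk (congrArg Subtype.val hc) ho'
      refine ⟨a.val, Subtype.ext ?_⟩
      subst ha
      show shP 1 ^ (a.val : ℤ) = shP a
      rw [zpow_natCast, sh_pow, ZMod.natCast_zmod_val])
  have e' : g * shP 1 * g⁻¹ = (τ⁻¹ * shP 1 * τ) ^ n := congrArg Subtype.val e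
  have e2 : (τ⁻¹ * shP 1 * τ) ^ n = τ⁻¹ * shP (n : Z47) * τ := by
    rw [← sh_pow]
    have := conj_pow (a := τ⁻¹) (b := shP 1) (i := n)
    rwa [inv_inv] at this
  rw [e2] at e'
  have hν : (τ * g) * shP 1 = shP (n : Z47) * (τ * g) := by
    have : g * shP 1 = τ⁻¹ * shP (n : Z47) * τ * g := by rw [← e']; group
    rw [mul_assoc, this]; group
  have hm : (n : Z47) ≠ 0 := by
    intro h0
    rw [h0, sh_0, one_mul] at hν
    have : shP 1 = 1 := mul_eq_left.1 hν
    exact absurd (sh_ne 1 this) one_ne_zero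
  have hv : ∀ x : Wd, x ∈ code r → x ∘ (τ * g) ∈ code r' := fun x hx => (hg _).1 ((hτ x).1 hx)
  obtain ⟨hZ, a, b, hC⟩ := struct (ν := τ * g) hm (fun x => congrArg (fun f : Equiv.Perm XX => f x) hν)
  rcases hZ with hZ | hZ <;> rcases hC with hC | hC
  · exact ⟨_, _, hm, case_id hv hm hZ hC⟩
  · exact (mix1 hr' (hv _ (topW_mem r)) hZ hC).elim
  · exact (mix2 (hv _ (topW_mem r)) hZ hC).elim
  · exact ⟨_, _, neg_ne_zero.2 hm, case_sw hr' hv hm hZ hC⟩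

theorem bad_contra {r : Z47 → F2} {w : ℕ} (hw : w ≤ 12) (h : Wit r w) (hm : MinWeightIs (code r) 16) : False := by
  obtain ⟨x, hx, h0, e⟩ := wit_word h
  have := hm.2 x hx h0
  omega

theorem classification_bordered_dcc_96_doubly_even :
    ∃ reps : Fin 1532 → Submodule (ZMod 2) (Fin 48 ⊕ Fin 48 → ZMod 2),
      (∀ k, (∃ B : Matrix (Fin 48) (Fin 48) (ZMod 2), IsBorderMatrix (n := 47) B ∧ reps k = borderedDCC (n := 47) B) ∧
        IsSelfDual (reps k) ∧ (∀ x ∈ reps k, hammingNorm x % 4 = 0) ∧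
        MinWeightIs (reps k) 16) ∧
      (∀ k l, CodeEquiv (reps k) (reps l) → k = l) ∧
      (∀ B : Matrix (Fin 48) (Fin 48) (ZMod 2), IsBorderMatrix (n := 47) B →
        IsSelfDual (borderedDCC (n := 47) B) →
        (∀ x ∈ borderedDCC (n := 47) B, hammingNorm x % 4 = 0) →
        MinWeightIs (borderedDCC (n := 47) B) 16 →
        ∃ k, CodeEquiv (reps k) (borderedDCC (n := 47) B)) := by
  obtain ⟨ι, hgood, hmono, hall⟩ := seq_main
  have hac : ∀ k < 1532, ac (rG k) = eps := fun k hk => by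
    rw [← (hgood k hk).2.1]
    exact (UU_iff _).1 (UU_rrF UU_rho _)
  refine ⟨fun k => code (rG k), fun k => ⟨⟨bmat (rG k), isBorder_bmat _, rfl⟩, selfDual (hac k k.2), fun x hx => ?_, ?_⟩, ?_, ?_⟩
  · exact doubly_even (hac k k.2) (hgood k k.2).2.2.1 hx
  · exact good_min (hac k k.2) (simd_main k k.2) (hgood k k.2).2.2.1 (hgood k k.2).2.2.2
  · intro k l h
    obtain ⟨m, s, hm, e⟩ := equiv_imp (hac l l.2) h
    rw [← (hgood k k.2).2.1, ← (hgood l l.2).2.1] at e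
    have h1 := UU_dist UU_rho rho_ne (hgood k k.2).1 (hgood l l.2).1 hm e
    rcases lt_trichotomy (k : ℕ) (l : ℕ) with h2 | h2 | h2
    · exact absurd h1 (hmono _ _ h2 l.2).ne
    · exact Fin.ext h2
    · exact absurd h1 (hmono _ _ h2 k.2).ne'
  · intro B hB hsd _ hmin
    obtain ⟨r, rfl⟩ := border_eq hB
    change MinWeightIs (code r) 16 at hmin
    have hr := ac_of_selfDual (r := r) hsd
    rcases UU_class UU_rho rho_ne ((UU_iff r).2 hr) with ⟨s, e⟩ | ⟨i, hi, m, s, hm, e⟩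
    · subst e
      exact (bad_contra (by norm_num) (wit_affine wit_eps one_ne_zero s) hmin).elim
    · subst e
      rcases hall i hi with ⟨w, hw, hb⟩ | ⟨a, ha, hai⟩
      · exact (bad_contra hw (wit_affine hb hm s) hmin).elim
      · refine ⟨⟨a, ha⟩, ?_⟩
        have e1 : rrF rho i = rG a := by rw [← hai]; exact (hgood a ha).2.1
        rw [e1]
        exact equiv_affine _ hm s
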